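/- Let c ∈ [1, 16/15), γ = 1/c, and h ∈ F_c. Suppose (a_n)_{n∈ℕ} is a sequence of complex numbers with |a_n| ≤ 1 for all n. Then for every r > (26 − 24γ)/(16γ − 15) there is a constant C_{r,γ} > 0, independent of N, such that ‖Σ_{p ∈ P_{h,N}} a_p e^{2πipξ}‖_{L^r(𝕋, dξ)} ≤ C_{r,γ} ‖Σ_{p ∈ P_{h,N}} e^{2πipξ}‖_{L^r(𝕋, dξ)} for every N ∈ ℕ. -/

import Mathlib

open Filter Real Set
open scoped Classical

structure Fc (c : ℝ) where
  x₀ : ℝ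
  one_le_x₀ : 1 ≤ x₀
  toFun : ℝ → ℝ
  vth : ℝ → ℝ
  Ch : ℝ
  Ch_pos : 0 < Ch
  one_le : ∀ x ≥ x₀, 1 ≤ toFun x
  contDiffOn : ContDiffOn ℝ 3 toFun (Set.Ici x₀)
  deriv_pos : ∀ x ≥ x₀, 0 < deriv toFun x
  deriv2_pos : ∀ x ≥ x₀, 0 < iteratedDeriv 2 toFun x
  vth_contDiffOn : ContDiffOn ℝ 2 vth (Set.Ici x₀)
  eqn : ∀ x ≥ x₀, toFun x = Ch * x ^ c * Real.exp (∫ t in x₀..x, vth t / t)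
  cond_gt : 1 < c →
    Filter.Tendsto vth Filter.atTop (nhds 0) ∧
    Filter.Tendsto (fun x => x * deriv vth x) Filter.atTop (nhds 0) ∧
    Filter.Tendsto (fun x => x ^ 2 * deriv (deriv vth) x) Filter.atTop (nhds 0)
  cond_eq : c = 1 →
    (∀ x ≥ x₀, 0 < vth x) ∧
    (∀ x y, x₀ ≤ x → x ≤ y → vth y ≤ vth x) ∧
    (∀ ε : ℝ, 0 < ε → ∃ C > 0, ∀ x ≥ x₀, 1 / vth x ≤ C * x ^ ε) ∧
    Filter.Tendsto (fun x => x / toFun x) Filter.atTop (nhds 0) ∧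
    Filter.Tendsto vth Filter.atTop (nhds 0) ∧
    Filter.Tendsto (fun x => x * deriv vth x / vth x) Filter.atTop (nhds 0) ∧
    Filter.Tendsto (fun x => x ^ 2 * deriv (deriv vth) x / vth x) Filter.atTop (nhds 0)

def Ph {c : ℝ} (F : Fc c) : Set ℕ :=
  {p : ℕ | p.Prime ∧ ∃ n : ℕ, F.x₀ ≤ (n : ℝ) ∧ (p : ℤ) = ⌊F.toFun n⌋}

noncomputable def e (t : ℝ) : ℂ := Complex.exp (2 * Real.pi * Complex.I * t)

lemma e_add (s t : ℝ) : e (s + t) = e s * e t := by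
  unfold e; rw [← Complex.exp_add]; push_cast; ring_nf

lemma norm_e (t : ℝ) : ‖e t‖ = 1 := by
  unfold e
  rw [Complex.norm_exp]; simp

lemma e_int (k : ℤ) : e (k : ℝ) = 1 := by
  unfold e
  rw [Complex.exp_eq_one_iff]
  exact ⟨k, by push_cast; ring⟩

lemma e_nat (k : ℕ) : e (k : ℝ) = 1 := by simpa using e_int (k : ℤ)

lemma e_zero : e 0 = 1 := by simpa using e_int 0

lemma e_neg (t : ℝ) : e (-t) = (starRingEnd ℂ) (e t) := by
  unfold e
  rw [← Complex.exp_conj]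
  simp [map_ofNat (starRingEnd ℂ) 2]

lemma e_sub (s t : ℝ) : e (s - t) = e s * (starRingEnd ℂ) (e t) := by
  rw [sub_eq_add_neg, e_add, e_neg]

lemma e_ne_zero (t : ℝ) : e t ≠ 0 := by
  unfold e; exact Complex.exp_ne_zero _

lemma e_add_int (t : ℝ) (k : ℤ) : e (t + k) = e t := by
  rw [e_add, e_int, mul_one]

lemma e_re (t : ℝ) : (e t).re = Real.cos (2 * π * t) := by
  unfold e
  have : (2 * (π : ℂ) * Complex.I * (t : ℂ)) = ((2 * π * t : ℝ) : ℂ) * Complex.I := by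
    push_cast; ring
  rw [this, Complex.exp_ofReal_mul_I_re]

lemma e_im (t : ℝ) : (e t).im = Real.sin (2 * π * t) := by
  unfold e
  have : (2 * (π : ℂ) * Complex.I * (t : ℂ)) = ((2 * π * t : ℝ) : ℂ) * Complex.I := by
    push_cast; ring
  rw [this, Complex.exp_ofReal_mul_I_im]

lemma continuous_e : Continuous e := by unfold e; fun_prop

lemma e_nat_mul (n : ℕ) (t : ℝ) : e (n * t) = e t ^ n := by
  unfold e
  rw [← Complex.exp_nat_mul]; push_cast; ring_nf

/-- cotangent identity: `1/(1-e(t)) = 1/2 + (i/2) cot(π t)` in multiplied form -/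
lemma inv_one_sub_e (t : ℝ) (hs : Real.sin (π * t) ≠ 0) :
    (1 / 2 + Complex.I / 2 * ((Real.cos (π * t) / Real.sin (π * t) : ℝ) : ℂ)) * (1 - e t) = 1 := by
  have h2 : (2 * π * t) = 2 * (π * t) := by ring
  apply Complex.ext
  · simp only [Complex.mul_re, Complex.add_re, Complex.add_im, Complex.sub_re, Complex.sub_im,
      Complex.one_re, Complex.one_im, e_re, e_im, Complex.mul_im, Complex.ofReal_re, Complex.ofReal_im]
    norm_num
    rw [h2, Real.sin_two_mul, Real.cos_two_mul]
    field_simp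
    have := Real.sin_sq_add_cos_sq (π * t)
    nlinarith
  · simp only [Complex.mul_re, Complex.add_re, Complex.add_im, Complex.sub_re, Complex.sub_im,
      Complex.one_re, Complex.one_im, e_re, e_im, Complex.mul_im, Complex.ofReal_re, Complex.ofReal_im]
    norm_num
    rw [h2, Real.sin_two_mul, Real.cos_two_mul]
    field_simp
    have := Real.sin_sq_add_cos_sq (π * t)
    have h3 : Real.sin (π * t) ^ 2 = 1 - Real.cos (π * t) ^ 2 := by linarith
    rw [h3]; ring

noncomputable def cotp (t : ℝ) : ℝ := Real.cos (π * t) / Real.sin (π * t)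

lemma sin_lower {θ t : ℝ} (hθ : 0 < θ) (hθ2 : θ ≤ t) (ht : t ≤ 1 - θ) : 2 * θ ≤ Real.sin (π * t) := by
  have hpi := Real.pi_pos
  have key : ∀ s : ℝ, θ ≤ s → s ≤ 1 / 2 → 2 * θ ≤ Real.sin (π * s) := by
    intro s h1 h2
    have h3 := Real.mul_le_sin (x := π * s) (mul_nonneg hpi.le (by linarith)) (by nlinarith)
    have h4 : 2 / π * (π * s) = 2 * s := by field_simp
    rw [h4] at h3; linarith
  rcases le_total t (1 / 2) with h | h
  · exact key t hθ2 h
  · have := key (1 - t) (by linarith) (by linarith)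
    have h5 : π * (1 - t) = π - π * t := by ring
    rwa [h5, Real.sin_pi_sub] at this

lemma cotp_antitone {θ s t : ℝ} (hθ : 0 < θ) (hs : θ ≤ s) (hst : s ≤ t) (ht : t ≤ 1 - θ) :
    cotp t ≤ cotp s := by
  have h1 := sin_lower hθ hs (by linarith)
  have h2 := sin_lower hθ (by linarith) ht
  unfold cotp
  rw [div_le_div_iff₀ (by linarith) (by linarith)]
  have h3 : Real.sin (π * t - π * s) = Real.sin (π * t) * Real.cos (π * s) - Real.cos (π * t) * Real.sin (π * s) :=
    Real.sin_sub _ _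
  have h4 : 0 ≤ Real.sin (π * t - π * s) := by
    apply Real.sin_nonneg_of_nonneg_of_le_pi
    · nlinarith [Real.pi_pos]
    · nlinarith [Real.pi_pos]
  linarith

lemma abs_cotp_le {θ t : ℝ} (hθ : 0 < θ) (hs : θ ≤ t) (ht : t ≤ 1 - θ) : |cotp t| ≤ 1 / (2 * θ) := by
  have h1 := sin_lower hθ hs ht
  unfold cotp
  rw [abs_div, abs_of_pos (show 0 < Real.sin (π * t) by linarith)]
  exact div_le_div₀ zero_le_one (Real.abs_cos_le_one _) (by linarith) h1

/-- Kusmin–Landau on `range L`, with differences in `[θ, 1-θ]`. -/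
lemma kusmin_landau0 (f : ℕ → ℝ) (L : ℕ) (θ : ℝ) (hθ : 0 < θ) (hθ2 : θ ≤ 1 / 2)
    (hmono : ∀ n, n + 1 < L → f (n + 1) - f n ≤ f (n + 2) - f (n + 1))
    (hlo : ∀ n, n < L → θ ≤ f (n + 1) - f n)
    (hhi : ∀ n, n < L → f (n + 1) - f n ≤ 1 - θ) :
    ‖∑ n ∈ Finset.range L, e (f n)‖ ≤ 2 / θ := by
  set D : ℕ → ℝ := fun n => f (n + 1) - f n with hD
  set g : ℕ → ℂ := fun n => 1 / 2 + Complex.I / 2 * ((cotp (D n) : ℝ) : ℂ) with hg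
  have hgn : ∀ n, n < L → ‖g n‖ ≤ 1 / 2 + 1 / (4 * θ) := by
    intro n hn
    have h1 := abs_cotp_le hθ (hlo n hn) (hhi n hn)
    calc ‖g n‖ ≤ ‖(1 / 2 : ℂ)‖ + ‖Complex.I / 2 * ((cotp (D n) : ℝ) : ℂ)‖ := norm_add_le _ _
      _ = 1 / 2 + 1 / 2 * |cotp (D n)| := by
          rw [norm_mul, Complex.norm_real]; norm_num
      _ ≤ 1 / 2 + 1 / 2 * (1 / (2 * θ)) := by gcongr
      _ = 1 / 2 + 1 / (4 * θ) := by field_simp; ring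
  have hterm : ∀ n, n < L → e (f n) = g n * (e (f n) - e (f (n + 1))) := by
    intro n hn
    have h1 := sin_lower hθ (hlo n hn) (hhi n hn)
    have h2 := inv_one_sub_e (D n) (by simp only [hD]; linarith)
    have h3 : e (f (n + 1)) = e (f n) * e (D n) := by
      rw [← e_add]; congr 1; simp [hD]
    rw [h3]
    have : g n * (e (f n) - e (f n) * e (D n)) = (g n * (1 - e (D n))) * e (f n) := by ring
    rw [this]
    have h4 : g n * (1 - e (D n)) = 1 := h2
    rw [h4, one_mul]
  -- induction: partial sums
  have key : ∀ K, K + 1 ≤ L → ‖∑ n ∈ Finset.range (K + 1), e (f n) + g K * e (f (K + 1))‖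
      ≤ ‖g 0‖ + 1 / 2 * (cotp (D 0) - cotp (D K)) := by
    intro K
    induction K with
    | zero =>
      intro hK
      simp only [zero_add, Finset.range_one, Finset.sum_singleton, sub_self, mul_zero, add_zero]
      have := hterm 0 (by omega)
      have h5 : e (f 0) + g 0 * e (f 1) = g 0 * e (f 0) := by
        have h6 : g 0 * e (f 0) = e (f 0) + g 0 * e (f 1) := by
          conv_rhs => rw [this]
          simp only [zero_add]; ring
        exact h6.symm
      rw [h5, norm_mul, norm_e, mul_one]
    | succ K ih =>
      intro hK
      have ih' := ih (by omega)
      have h1 := hterm (K + 1) (by omega)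
      have h2 : ∑ n ∈ Finset.range (K + 1 + 1), e (f n) + g (K + 1) * e (f (K + 1 + 1))
          = (∑ n ∈ Finset.range (K + 1), e (f n) + g K * e (f (K + 1)))
            + (g (K + 1) - g K) * e (f (K + 1)) := by
        rw [Finset.sum_range_succ]
        have h3 : e (f (K + 1)) + g (K + 1) * e (f (K + 1 + 1)) = g (K + 1) * e (f (K + 1)) := by
          have h6 : g (K + 1) * e (f (K + 1)) = e (f (K + 1)) + g (K + 1) * e (f (K + 1 + 1)) := by
            conv_rhs => rw [h1]
            ring
          exact h6.symm
        linear_combination h3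
      rw [h2]
      have h4 : ‖(g (K + 1) - g K) * e (f (K + 1))‖ = 1 / 2 * (cotp (D K) - cotp (D (K + 1))) := by
        rw [norm_mul, norm_e, mul_one]
        have : g (K + 1) - g K = Complex.I / 2 * ((cotp (D (K + 1)) - cotp (D K) : ℝ) : ℂ) := by
          simp only [hg]; push_cast; ring
        rw [this, norm_mul, Complex.norm_real]
        have h7 : cotp (D (K + 1)) ≤ cotp (D K) :=
          cotp_antitone hθ (hlo K (by omega)) (hmono K (by omega)) (hhi (K + 1) (by omega))
        rw [Real.norm_eq_abs, abs_of_nonpos (by linarith)]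
        norm_num
      calc _ ≤ _ := norm_add_le _ _
        _ ≤ ‖g 0‖ + 1 / 2 * (cotp (D 0) - cotp (D K)) + 1 / 2 * (cotp (D K) - cotp (D (K + 1))) := by
            rw [h4]; gcongr
        _ = _ := by ring
  rcases Nat.eq_zero_or_pos L with h0 | h0
  · subst h0; simp; positivity
  obtain ⟨K, rfl⟩ : ∃ K, L = K + 1 := ⟨L - 1, by omega⟩
  have h1 := key K le_rfl
  have h2 : ‖∑ n ∈ Finset.range (K + 1), e (f n)‖ ≤
      ‖∑ n ∈ Finset.range (K + 1), e (f n) + g K * e (f (K + 1))‖ + ‖g K * e (f (K + 1))‖ := by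
    have := norm_sub_le (∑ n ∈ Finset.range (K + 1), e (f n) + g K * e (f (K + 1))) (g K * e (f (K + 1)))
    simpa using this
  rw [norm_mul, norm_e, mul_one] at h2
  have h3 := hgn 0 (by omega)
  have h4 := hgn K (by omega)
  have h5 := abs_le.mp (abs_cotp_le hθ (hlo 0 (by omega)) (hhi 0 (by omega)))
  have h6 := abs_le.mp (abs_cotp_le hθ (hlo K (by omega)) (hhi K (by omega)))
  have h7 : 1 / (2 * θ) = 2 * (1 / (4 * θ)) := by field_simp; ring
  have h8 : 1 ≤ 2 * (1 / (4 * θ)) := by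
    rw [← h7, le_div_iff₀ (by positivity)]; linarith
  have h9 : 2 / θ = 8 * (1 / (4 * θ)) := by field_simp; ring
  rw [h9]
  simp only [hD] at *
  linarith [h5.2, h6.1]

/-- Kusmin–Landau on order-connected finsets, with an integer shift. -/
lemma kusmin_landau (f : ℕ → ℝ) (S : Finset ℕ) (hS : ∀ x ∈ S, ∀ y ∈ S, ∀ z, x ≤ z → z ≤ y → z ∈ S)
    (k : ℤ) (θ : ℝ) (hθ : 0 < θ) (hθ2 : θ ≤ 1 / 2)
    (hmono : ∀ n, n ∈ S → n + 1 ∈ S → f (n + 1) - f n ≤ f (n + 2) - f (n + 1))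
    (hlo : ∀ n ∈ S, k + θ ≤ f (n + 1) - f n)
    (hhi : ∀ n ∈ S, f (n + 1) - f n ≤ k + 1 - θ) :
    ‖∑ n ∈ S, e (f n)‖ ≤ 2 / θ := by
  rcases S.eq_empty_or_nonempty with h0 | hne
  · subst h0; simp; positivity
  set a := S.min' hne
  set b := S.max' hne
  have hab : a ≤ b := S.min'_le_max' hne
  have hSe : S = Finset.Ico a (b + 1) := by
    ext x
    rw [Finset.mem_Ico]
    constructor
    · intro hx; exact ⟨S.min'_le x hx, Nat.lt_succ_of_le (S.le_max' x hx)⟩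
    · rintro ⟨h1, h2⟩
      exact hS a (S.min'_mem hne) b (S.max'_mem hne) x h1 (by omega)
  have hmem : ∀ n, n < b + 1 - a → a + n ∈ S := by
    intro n hn; rw [hSe, Finset.mem_Ico]; omega
  have h1 := kusmin_landau0 (fun n => f (a + n) - k * n) (b + 1 - a) θ hθ hθ2 (by
      intro n hn
      have := hmono (a + n) (hmem n (by omega)) (hmem (n + 1) hn)
      push_cast
      have e1 : a + (n + 1) = a + n + 1 := rfl
      have e2 : a + (n + 2) = a + n + 2 := rfl
      rw [e1, e2]; linarith) (by
      intro n hn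
      have := hlo (a + n) (hmem n hn)
      push_cast
      have e1 : a + (n + 1) = a + n + 1 := rfl
      rw [e1]; linarith) (by
      intro n hn
      have := hhi (a + n) (hmem n hn)
      push_cast
      have e1 : a + (n + 1) = a + n + 1 := rfl
      rw [e1]; linarith)
  have h2 : ∑ n ∈ S, e (f n) = ∑ n ∈ Finset.range (b + 1 - a), e (f (a + n) - k * n) := by
    rw [hSe, Finset.sum_Ico_eq_sum_range]
    apply Finset.sum_congr rfl
    intro n _
    have : f (a + n) - k * n = f (a + n) + ((-(k * n) : ℤ) : ℝ) := by push_cast; ring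
    rw [this, e_add_int]
  rw [h2]; exact h1

lemma card_le_of_diam (T : Finset ℕ) (D : ℝ) (hD : 0 ≤ D)
    (h : ∀ x ∈ T, ∀ y ∈ T, x ≤ y → (y : ℝ) - x ≤ D) : (T.card : ℝ) ≤ D + 1 := by
  rcases T.eq_empty_or_nonempty with rfl | hT
  · simp; linarith
  · have h1 := h _ (T.min'_mem hT) _ (T.max'_mem hT) (T.min'_le _ (T.max'_mem hT))
    have h2 : T ⊆ Finset.Icc (T.min' hT) (T.max' hT) := by
      intro x hx
      exact Finset.mem_Icc.2 ⟨T.min'_le _ hx, T.le_max' _ hx⟩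
    have h3 := Finset.card_le_card h2
    rw [Nat.card_Icc] at h3
    have h4 : T.min' hT ≤ T.max' hT := T.min'_le _ (T.max'_mem hT)
    have h5 : T.card + T.min' hT ≤ T.max' hT + 1 := by omega
    have h6 : (T.card : ℝ) + (T.min' hT : ℝ) ≤ (T.max' hT : ℝ) + 1 := by exact_mod_cast h5
    linarith

lemma norm_sum_e_le_card (T : Finset ℕ) (f : ℕ → ℝ) : ‖∑ n ∈ T, e (f n)‖ ≤ T.card := by
  refine (norm_sum_le _ _).trans ?_
  simp [norm_e]

lemma vdc (f : ℕ → ℝ) (a b : ℕ) (lam al L : ℝ) (hl : 0 < lam) (hal : 1 ≤ al)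
    (hL : (b : ℝ) - a ≤ L) (hL0 : 0 ≤ L)
    (h2 : ∀ n, a ≤ n → n < b → lam ≤ f (n + 2) - f (n + 1) - (f (n + 1) - f n) ∧
      f (n + 2) - f (n + 1) - (f (n + 1) - f n) ≤ al * lam) :
    ‖∑ n ∈ Finset.Ico a b, e (f n)‖ ≤ 12 * al * (L * √lam + 1 / √lam) := by
  have hs : 0 < √lam := Real.sqrt_pos.2 hl
  have hs2 : √lam * √lam = lam := Real.mul_self_sqrt hl.le
  rcases le_or_gt b a with hab | hab
  · rw [Finset.Ico_eq_empty (by omega)]; simp; positivity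
  by_cases hl4 : 1 / 4 < lam
  · have h1 : 1 / 2 < √lam := by
      by_contra hcon; push Not at hcon; nlinarith
    have := norm_sum_e_le_card (Finset.Ico a b) f
    rw [Nat.card_Ico, Nat.cast_sub hab.le] at this
    have h3 : L ≤ 12 * al * (L * √lam) := by nlinarith [mul_nonneg hL0 (by linarith : (0:ℝ) ≤ al - 1), mul_nonneg (mul_nonneg hL0 (by linarith : (0:ℝ) ≤ al)) (by linarith : (0:ℝ) ≤ √lam - 1/2)]
    have h4 : 0 ≤ 12 * al * (1 / √lam) := by positivity
    rw [mul_add]; linarith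
  push Not at hl4
  set θ := √lam with hθ
  have hθ2 : θ ≤ 1 / 2 := by nlinarith
  set d : ℕ → ℝ := fun n => f (n + 1) - f n with hd
  have hdd : ∀ n, a ≤ n → n < b → lam ≤ d (n + 1) - d n ∧ d (n + 1) - d n ≤ al * lam := h2
  have hdiff : ∀ j n, a ≤ n → n + j ≤ b → lam * j ≤ d (n + j) - d n ∧ d (n + j) - d n ≤ al * lam * j := by
    intro j
    induction j with
    | zero => intro n _ _; simp
    | succ j ih =>
      intro n h1 h3
      have i1 := ih n h1 (by omega)
      have i2 := hdd (n + j) (by omega) (by omega)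
      push_cast
      rw [show n + (j + 1) = n + j + 1 by ring]
      constructor <;> nlinarith
  have hdiff2 : ∀ x y, a ≤ x → x ≤ y → y ≤ b → lam * ((y:ℝ) - x) ≤ d y - d x ∧ d y - d x ≤ al * lam * ((y:ℝ) - x) := by
    intro x y h1 h3 h4
    have := hdiff (y - x) x h1 (by omega)
    rw [show x + (y - x) = y by omega, Nat.cast_sub h3] at this
    exact this
  have hmono : ∀ x y, a ≤ x → x ≤ y → y ≤ b → d x ≤ d y := by
    intro x y h1 h3 h4
    have := (hdiff2 x y h1 h3 h4).1
    have h5 : (0:ℝ) ≤ (y:ℝ) - x := by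
      have : (x:ℝ) ≤ y := by exact_mod_cast h3
      linarith
    nlinarith
  set I := Finset.Ico a b with hI
  set K := Finset.Icc ⌊d a⌋ ⌊d b⌋ with hK
  have hmaps : ∀ n ∈ I, ⌊d n⌋ ∈ K := by
    intro n hn
    rw [hI, Finset.mem_Ico] at hn
    rw [hK, Finset.mem_Icc]
    exact ⟨Int.floor_le_floor (hmono a n le_rfl hn.1 hn.2.le), Int.floor_le_floor (hmono n b hn.1 hn.2.le le_rfl)⟩
  rw [← Finset.sum_fiberwise_of_maps_to hmaps]
  have hθl : θ / lam = 1 / θ := by rw [← hs2]; field_simp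
  have hsmall : ∀ (T : Finset ℕ) (z : ℝ), T ⊆ I → (∀ n ∈ T, z ≤ d n ∧ d n ≤ z + θ) → ‖∑ n ∈ T, e (f n)‖ ≤ 2 / θ := by
    intro T z hT h
    refine (norm_sum_e_le_card T f).trans ?_
    have h0 := card_le_of_diam T (1 / θ) (by positivity) (by
      intro x hx y hy hxy
      have hx1 := Finset.mem_Ico.1 (hT hx)
      have hy1 := Finset.mem_Ico.1 (hT hy)
      have h5 := (hdiff2 x y hx1.1 hxy hy1.2.le).1
      have h6 := h x hx
      have h7 := h y hy
      rw [← hθl, le_div_iff₀ hl]; linarith)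
    have : 1 ≤ 1 / θ := by rw [le_div_iff₀ hs]; linarith
    have h8 : 2 / θ = 1 / θ + 1 / θ := by ring
    linarith
  have hfib : ∀ k ∈ K, ‖∑ n ∈ I with ⌊d n⌋ = k, e (f n)‖ ≤ 6 / θ := by
    intro k _
    set J := I.filter (fun n => ⌊d n⌋ = k) with hJ
    have hJm : ∀ n ∈ J, n ∈ I ∧ (k : ℝ) ≤ d n ∧ d n < k + 1 := by
      intro n hn
      rw [hJ, Finset.mem_filter] at hn
      exact ⟨hn.1, by rw [← hn.2]; exact Int.floor_le _, by rw [← hn.2]; exact Int.lt_floor_add_one _⟩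
    have hJc : ∀ n, n ∈ I → (k : ℝ) ≤ d n → d n < k + 1 → n ∈ J := by
      intro n h1 h3 h4
      rw [hJ, Finset.mem_filter]
      exact ⟨h1, Int.floor_eq_iff.2 ⟨h3, h4⟩⟩
    rw [← Finset.sum_filter_add_sum_filter_not J (fun n => d n < k + θ),
      ← Finset.sum_filter_add_sum_filter_not (J.filter (fun n => ¬ d n < k + θ)) (fun n => d n ≤ k + 1 - θ)]
    have b1 := hsmall (J.filter (fun n => d n < k + θ)) k (fun n hn => (hJm n (Finset.mem_filter.1 hn).1).1)
      (fun n hn => ⟨(hJm n (Finset.mem_filter.1 hn).1).2.1, (Finset.mem_filter.1 hn).2.le⟩)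
    have b3 := hsmall ((J.filter (fun n => ¬ d n < k + θ)).filter (fun n => ¬ d n ≤ k + 1 - θ)) (k + 1 - θ)
      (fun n hn => (hJm n (Finset.mem_filter.1 (Finset.mem_filter.1 hn).1).1).1)
      (fun n hn => ⟨(not_le.1 (Finset.mem_filter.1 hn).2).le, by
        have := (hJm n (Finset.mem_filter.1 (Finset.mem_filter.1 hn).1).1).2.2; linarith⟩)
    have b2 := kusmin_landau f ((J.filter (fun n => ¬ d n < k + θ)).filter (fun n => d n ≤ k + 1 - θ))
      (by
        intro x hx y hy z hxz hzy
        simp only [Finset.mem_filter, not_lt] at hx hy ⊢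
        have hx1 := hJm x hx.1.1
        have hy1 := hJm y hy.1.1
        rw [hI, Finset.mem_Ico] at hx1 hy1
        have m1 := hmono x z hx1.1.1 hxz (by omega)
        have m2 := hmono z y (by omega) hzy (by omega)
        exact ⟨⟨hJc z (Finset.mem_Ico.2 ⟨by omega, by omega⟩) (by linarith) (by linarith), by linarith⟩, by linarith⟩)
      k θ hs hθ2
      (by
        intro n hn _
        simp only [Finset.mem_filter, not_lt] at hn
        have := (hJm n hn.1.1).1
        rw [hI, Finset.mem_Ico] at this
        have := (h2 n this.1 this.2).1
        linarith)
      (by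
        intro n hn
        simp only [Finset.mem_filter, not_lt] at hn
        exact hn.1.2)
      (by
        intro n hn
        simp only [Finset.mem_filter, not_lt] at hn
        exact hn.2)
    refine (norm_add_le _ _).trans ?_
    refine (add_le_add b1 ((norm_add_le _ _).trans (add_le_add b2 b3))).trans (le_of_eq ?_)
    ring
  refine (norm_sum_le _ _).trans ((Finset.sum_le_sum hfib).trans ?_)
  rw [Finset.sum_const, nsmul_eq_mul]
  have hKc : (K.card : ℝ) ≤ al * lam * L + 2 := by
    rw [hK, Int.card_Icc]
    have h1 := (hdiff2 a b le_rfl hab.le le_rfl).2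
    have h3 : ⌊d a⌋ ≤ ⌊d b⌋ := Int.floor_le_floor (hmono a b le_rfl hab.le le_rfl)
    have h4 : (((⌊d b⌋ + 1 - ⌊d a⌋).toNat : ℤ) : ℝ) = ((⌊d b⌋ + 1 - ⌊d a⌋ : ℤ) : ℝ) := by
      rw [Int.toNat_of_nonneg (by omega)]
    have h5 := Int.floor_le (d b)
    have h6 := Int.lt_floor_add_one (d a)
    have h7 : al * lam * ((b:ℝ) - a) ≤ al * lam * L := by gcongr
    push_cast at h4
    rw [h4]; linarith
  have h9 : (al * lam * L + 2) * (6 / θ) ≤ 12 * al * (L * θ + 1 / θ) := by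
    rw [← hs2]
    have : (al * (θ * θ) * L + 2) * (6 / θ) = 6 * al * L * θ + 12 * (1 / θ) := by field_simp; ring
    rw [this]
    have h1 : 0 ≤ al * L * θ := by positivity
    have h3 : 0 ≤ 1 / θ := by positivity
    nlinarith
  exact (mul_le_mul_of_nonneg_right hKc (by positivity)).trans h9

lemma vdc_neg (f : ℕ → ℝ) (a b : ℕ) (lam al L : ℝ) (hl : 0 < lam) (hal : 1 ≤ al)
    (hL : (b : ℝ) - a ≤ L) (hL0 : 0 ≤ L)
    (h2 : ∀ n, a ≤ n → n < b → lam ≤ -(f (n + 2) - f (n + 1) - (f (n + 1) - f n)) ∧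
      -(f (n + 2) - f (n + 1) - (f (n + 1) - f n)) ≤ al * lam) :
    ‖∑ n ∈ Finset.Ico a b, e (f n)‖ ≤ 12 * al * (L * √lam + 1 / √lam) := by
  have := vdc (fun n => - f n) a b lam al L hl hal hL hL0 (by
    intro n h1 h3
    have := h2 n h1 h3
    constructor <;> linarith)
  simp only [e_neg] at this
  rw [← map_sum, RCLike.norm_conj] at this
  exact this

/-- second difference from second derivative -/
lemma second_diff (F F1 F2 : ℝ → ℝ) (x A B : ℝ)
    (h1 : ∀ y ∈ Set.Icc x (x + 2), HasDerivAt F (F1 y) y)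
    (h2 : ∀ y ∈ Set.Icc x (x + 2), HasDerivAt F1 (F2 y) y)
    (hA : ∀ y ∈ Set.Icc x (x + 2), A ≤ F2 y) (hB : ∀ y ∈ Set.Icc x (x + 2), F2 y ≤ B) :
    A ≤ F (x + 2) - F (x + 1) - (F (x + 1) - F x) ∧
      F (x + 2) - F (x + 1) - (F (x + 1) - F x) ≤ B := by
  have hG : ∀ y ∈ Set.Icc x (x + 1), HasDerivAt (fun y => F (y + 1) - F y) (F1 (y + 1) - F1 y) y := by
    intro y hy
    exact ((h1 (y + 1) ⟨by linarith [hy.1], by linarith [hy.2]⟩).comp_add_const y 1).sub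
      (h1 y ⟨by linarith [hy.1], by linarith [hy.2]⟩)
  obtain ⟨y, hy, hy2⟩ := exists_hasDerivAt_eq_slope (fun y => F (y + 1) - F y) (fun y => F1 (y + 1) - F1 y)
    (show x < x + 1 by linarith) (fun y hy => (hG y hy).continuousAt.continuousWithinAt)
    (fun y hy => hG y ⟨hy.1.le, hy.2.le⟩)
  obtain ⟨z, hz, hz2⟩ := exists_hasDerivAt_eq_slope F1 F2
    (show y < y + 1 by linarith) (fun w hw => (h2 w ⟨by linarith [hw.1, hy.1], by linarith [hw.2, hy.2]⟩).continuousAt.continuousWithinAt)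
    (fun w hw => h2 w ⟨by linarith [hw.1, hy.1], by linarith [hw.2, hy.2]⟩)
  have hzm : z ∈ Set.Icc x (x + 2) := ⟨by linarith [hz.1, hy.1], by linarith [hz.2, hy.2]⟩
  have e1 : F (x + 2) - F (x + 1) - (F (x + 1) - F x) = F2 z := by
    rw [hz2]
    have : (y + 1 - y) = 1 := by ring
    rw [this, div_one, hy2]
    rw [show x + 1 + 1 = x + 2 by ring, show x + 1 - x = 1 by ring, div_one]
  rw [e1]
  exact ⟨hA z hzm, hB z hzm⟩

/-- distance to nearest integer at least `θ`: geometric sum bound. -/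
lemma geom_bound (a b : ℕ) (t θ : ℝ) (k : ℤ) (hθ : 0 < θ) (h1 : k + θ ≤ t) (h2 : t ≤ k + 1 - θ) :
    ‖∑ n ∈ Finset.Ico a b, e (n * t)‖ ≤ 2 / θ := by
  refine kusmin_landau (fun n => n * t) (Finset.Ico a b) ?_ k θ hθ (by linarith) ?_ ?_ ?_
  · intro x hx y hy z h1 h2
    rw [Finset.mem_Ico] at *; omega
  · intro n _ _; push_cast; linarith
  · intro n _; push_cast; linarith
  · intro n _; push_cast; linarith

structure Reg (S : Set ℕ) (γ' : ℝ) (φ φ1 H H1 : ℝ → ℝ) (Y0 : ℝ) : Prop where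
  one_le_Y0 : 1 ≤ Y0
  one_le : ∀ y ≥ Y0, 1 ≤ φ y
  d0 : ∀ y ≥ Y0, HasDerivAt φ (φ1 y) y
  d1 : ∀ y ≥ Y0, HasDerivAt φ1 (-(H y / y ^ 2)) y
  d2 : ∀ y ≥ Y0, HasDerivAt H (H1 y) y
  phi1_lo : ∀ y ≥ Y0, 15 / 16 * φ y ≤ y * φ1 y
  phi1_hi : ∀ y ≥ Y0, y * φ1 y ≤ φ y
  H_pos : ∀ y ≥ Y0, 0 < H y
  H_le : ∀ y ≥ Y0, H y ≤ φ y
  H1_lo : ∀ y ≥ Y0, 1 / 2 * H y ≤ y * H1 y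
  H1_hi : ∀ y ≥ Y0, y * H1 y ≤ 2 * H y
  growth : ∀ y ≥ Y0, y ^ γ' ≤ H y
  small : Tendsto (fun y => φ y / y) atTop (nhds 0)
  mem : ∀ p : ℕ, Y0 ≤ p → (p ∈ S ↔ p.Prime ∧ ∃ n : ℕ, φ p ≤ n ∧ (n : ℝ) < φ (p + 1))

lemma mono_of_log_deriv (f f1 : ℝ → ℝ) (Y0 β : ℝ) (hY : 0 < Y0)
    (hd : ∀ y ≥ Y0, HasDerivAt f (f1 y) y) (h : ∀ y ≥ Y0, β * f y ≤ y * f1 y) :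
    MonotoneOn (fun y => f y * y ^ (-β)) (Set.Ici Y0) := by
  have hd2 : ∀ y ∈ Set.Ici Y0, HasDerivAt (fun y => f y * y ^ (-β)) (f1 y * y ^ (-β) + f y * ((-β) * y ^ (-β - 1))) y := by
    intro y hy
    have hy0 : 0 < y := lt_of_lt_of_le hY hy
    exact (hd y hy).mul (Real.hasDerivAt_rpow_const (Or.inl hy0.ne'))
  refine monotoneOn_of_deriv_nonneg (convex_Ici Y0) (fun y hy => (hd2 y hy).continuousAt.continuousWithinAt)
    (fun y hy => (hd2 y (interior_subset hy)).differentiableAt.differentiableWithinAt) ?_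
  intro y hy
  have hy := interior_subset hy
  have hy0 : 0 < y := lt_of_lt_of_le hY hy
  rw [(hd2 y hy).deriv, Real.rpow_sub_one hy0.ne']
  have h1 := h y hy
  have h2 : 0 < y ^ (-β) := Real.rpow_pos_of_pos hy0 _
  have : f1 y * y ^ (-β) + f y * ((-β) * (y ^ (-β) / y)) = (y ^ (-β) / y) * (y * f1 y - β * f y) := by
    field_simp
    ring
  rw [this]
  exact mul_nonneg (by positivity) (by linarith)

lemma anti_of_log_deriv (f f1 : ℝ → ℝ) (Y0 β : ℝ) (hY : 0 < Y0)
    (hd : ∀ y ≥ Y0, HasDerivAt f (f1 y) y) (h : ∀ y ≥ Y0, y * f1 y ≤ β * f y) :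
    AntitoneOn (fun y => f y * y ^ (-β)) (Set.Ici Y0) := by
  have := mono_of_log_deriv (fun y => - f y) (fun y => - f1 y) Y0 β hY (fun y hy => (hd y hy).neg)
    (fun y hy => by have := h y hy; linarith)
  intro x hx y hy hxy
  have := this hx hy hxy
  simp only [neg_mul] at this
  simpa using this

namespace Fc
variable {c : ℝ} (F : Fc c)

lemma vth_diff {x : ℝ} (hx : F.x₀ < x) : HasDerivAt F.vth (deriv F.vth x) x := by
  have : ContDiffAt ℝ 2 F.vth x := F.vth_contDiffOn.contDiffAt (Ici_mem_nhds hx)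
  exact (this.differentiableAt (by norm_num)).hasDerivAt

lemma vth_diff2 {x : ℝ} (hx : F.x₀ < x) : HasDerivAt (deriv F.vth) (deriv (deriv F.vth) x) x := by
  have : ContDiffAt ℝ 2 F.vth x := F.vth_contDiffOn.contDiffAt (Ici_mem_nhds hx)
  have h2 : ContDiffAt ℝ 1 (deriv F.vth) x := by
    exact this.derivWithin (m := 1) (by norm_num)
  exact (h2.differentiableAt (by norm_num)).hasDerivAt

lemma toFun_diff {x : ℝ} (hx : F.x₀ < x) :
    HasDerivAt F.toFun (F.toFun x * (c + F.vth x) / x) x := by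
  have hx0 : 0 < x := lt_of_lt_of_le (by linarith [F.one_le_x₀]) hx.le
  have hcont : ContinuousOn (fun t => F.vth t / t) (Set.Ici F.x₀) := by
    refine F.vth_contDiffOn.continuousOn.div continuousOn_id ?_
    intro t ht
    have := F.one_le_x₀
    have ht' : F.x₀ ≤ t := ht
    show t ≠ 0
    linarith
  have hI : HasDerivAt (fun y => ∫ t in F.x₀..y, F.vth t / t) (F.vth x / x) x := by
    refine intervalIntegral.integral_hasDerivAt_right ?_ ?_ ?_
    · refine ContinuousOn.intervalIntegrable ?_
      rw [Set.uIcc_of_le hx.le]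
      exact hcont.mono (fun t ht => ht.1)
    · exact (hcont.mono (Ioi_subset_Ici_self)).stronglyMeasurableAtFilter isOpen_Ioi x hx
    · exact hcont.continuousAt (Ici_mem_nhds hx)
  have h1 : HasDerivAt (fun y => F.Ch * y ^ c * Real.exp (∫ t in F.x₀..y, F.vth t / t))
      (F.Ch * (c * x ^ (c - 1)) * Real.exp (∫ t in F.x₀..x, F.vth t / t) +
        F.Ch * x ^ c * (Real.exp (∫ t in F.x₀..x, F.vth t / t) * (F.vth x / x))) x :=
    ((Real.hasDerivAt_rpow_const (Or.inl hx0.ne')).const_mul F.Ch).mul hI.exp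
  have h2 : F.toFun =ᶠ[nhds x] (fun y => F.Ch * y ^ c * Real.exp (∫ t in F.x₀..y, F.vth t / t)) := by
    filter_upwards [Ioi_mem_nhds hx] with y hy
    exact F.eqn y (le_of_lt hy)
  refine (h1.congr_of_eventuallyEq h2).congr_deriv ?_
  rw [F.eqn x hx.le, Real.rpow_sub_one hx0.ne']
  field_simp

end Fc

namespace Fc
variable {c : ℝ} (F : Fc c)

lemma vth_tendsto (hc : 1 ≤ c) : Tendsto F.vth atTop (nhds 0) := by
  rcases hc.eq_or_lt with h | h
  · exact (F.cond_eq h.symm).2.2.2.2.1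
  · exact (F.cond_gt h).1

lemma ev_bounds (hc : 1 ≤ c) (hc2 : c < 16 / 15) : ∀ᶠ x in atTop,
    0 < c - 1 + F.vth x ∧ c - 1 + F.vth x ≤ 1 / 15 ∧
    |x * deriv F.vth x| ≤ (c - 1 + F.vth x) / 100 ∧
    |x ^ 2 * deriv (deriv F.vth) x| ≤ (c - 1 + F.vth x) / 100 := by
  have hv := F.vth_tendsto hc
  have hv1 : ∀ᶠ x in atTop, F.vth x < 16 / 15 - c := hv.eventually_lt_const (by linarith)
  rcases hc.eq_or_lt with h | h
  · obtain ⟨hp, -, -, -, -, ha, hb⟩ := F.cond_eq h.symm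
    have ha' := (ha.abs).eventually_lt_const (show |(0:ℝ)| < 1 / 100 by simp)
    have hb' := (hb.abs).eventually_lt_const (show |(0:ℝ)| < 1 / 100 by simp)
    filter_upwards [hv1, ha', hb', eventually_ge_atTop F.x₀] with x h1 h2 h3 h4
    have hpx := hp x h4
    rw [abs_div, abs_of_pos hpx, div_lt_iff₀ hpx] at h2 h3
    refine ⟨by linarith, by linarith, by linarith, by linarith⟩
  · obtain ⟨-, ha, hb⟩ := F.cond_gt h
    have hc3 : 0 < c - 1 := by linarith
    have hv2 : ∀ᶠ x in atTop, -((c - 1) / 2) < F.vth x := hv.eventually_const_lt (by linarith)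
    have ha' := (ha.abs).eventually_lt_const (show |(0:ℝ)| < (c - 1) / 200 by simp; linarith)
    have hb' := (hb.abs).eventually_lt_const (show |(0:ℝ)| < (c - 1) / 200 by simp; linarith)
    filter_upwards [hv1, hv2, ha', hb'] with x h1 h2 h3 h4
    refine ⟨by linarith, by linarith, by linarith, by linarith⟩

lemma ev_s_lower (hc : 1 ≤ c) (ε : ℝ) (hε : 0 < ε) : ∃ C > 0, ∀ᶠ x in atTop,
    C * x ^ (-ε) ≤ c - 1 + F.vth x := by
  rcases hc.eq_or_lt with h | h
  · obtain ⟨hp, -, hl, -⟩ := F.cond_eq h.symm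
    obtain ⟨C, hC, hCx⟩ := hl ε hε
    refine ⟨1 / C, by positivity, ?_⟩
    filter_upwards [eventually_ge_atTop F.x₀] with x h4
    have hpx := hp x h4
    have hx0 : 0 < x := by linarith [F.one_le_x₀]
    have h5 := hCx x h4
    have h6 : 0 < x ^ ε := Real.rpow_pos_of_pos hx0 _
    rw [div_le_iff₀ hpx] at h5
    rw [Real.rpow_neg hx0.le]
    have : 1 / C * (x ^ ε)⁻¹ ≤ F.vth x := by
      rw [one_div, ← mul_inv, inv_le_iff_one_le_mul₀ (by positivity)]; linarith
    have h' : (1:ℝ) = c := h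
    linarith
  · have hc3 : 0 < c - 1 := by linarith
    have hv2 : ∀ᶠ x in atTop, -((c - 1) / 2) < F.vth x := (F.vth_tendsto hc).eventually_const_lt (by linarith)
    refine ⟨(c - 1) / 2, by linarith, ?_⟩
    filter_upwards [hv2, eventually_ge_atTop 1] with x h1 h2
    have : x ^ (-ε) ≤ 1 := Real.rpow_le_one_of_one_le_of_nonpos h2 (by linarith)
    nlinarith

lemma strictMono : StrictMonoOn F.toFun (Set.Ici F.x₀) := by
  refine strictMonoOn_of_deriv_pos (convex_Ici _) F.contDiffOn.continuousOn ?_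
  intro x hx
  exact F.deriv_pos x (interior_subset hx)

lemma deriv_mono : MonotoneOn (deriv F.toFun) (Set.Ioi F.x₀) := by
  have h2 : ∀ x ∈ Set.Ioi F.x₀, DifferentiableAt ℝ (deriv F.toFun) x := by
    intro x hx
    have : ContDiffAt ℝ 3 F.toFun x := F.contDiffOn.contDiffAt (Ici_mem_nhds hx)
    have h2 : ContDiffAt ℝ 2 (deriv F.toFun) x := this.derivWithin (m := 2) (by norm_num)
    exact h2.differentiableAt (by norm_num)
  refine monotoneOn_of_deriv_nonneg (convex_Ioi _) (fun x hx => (h2 x hx).continuousAt.continuousWithinAt)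
    (fun x hx => (h2 x (interior_subset hx)).differentiableWithinAt) ?_
  intro x hx
  have hx' : F.x₀ < x := interior_subset hx
  have := F.deriv2_pos x hx'.le
  rw [iteratedDeriv_succ, iteratedDeriv_one] at this
  exact this.le

lemma toFun_tendsto : Tendsto F.toFun atTop atTop := by
  set x1 := F.x₀ + 1
  have hm := F.deriv_pos x1 (by simp [x1])
  have hlow : ∀ x ≥ x1, F.toFun x1 + deriv F.toFun x1 * (x - x1) ≤ F.toFun x := by
    intro x hx
    have h3 : deriv F.toFun x1 * (x - x1) ≤ F.toFun x - F.toFun x1 := by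
      refine Convex.mul_sub_le_image_sub_of_le_deriv (convex_Ici x1) ?_ ?_ ?_ x1 (by simp) x hx hx
      · intro z hz
        have hz' : x1 ≤ z := hz
        exact (F.toFun_diff (by simp [x1] at hz'; linarith)).continuousAt.continuousWithinAt
      · intro z hz
        have hz' : x1 ≤ z := interior_subset hz
        exact (F.toFun_diff (by simp [x1] at hz'; linarith)).differentiableAt.differentiableWithinAt
      · intro z hz
        have hz' : x1 ≤ z := interior_subset hz
        refine F.deriv_mono (by simp [x1]) (show F.x₀ < z by simp [x1] at hz'; linarith) hz'
    linarith
  refine tendsto_atTop_mono' _ (eventually_ge_atTop x1 |>.mono hlow) ?_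
  refine tendsto_atTop_add_const_left _ _ ?_
  exact Tendsto.const_mul_atTop hm (tendsto_atTop_add_const_right _ (-x1) tendsto_id)

lemma exists_inv {y : ℝ} (hy : F.toFun F.x₀ ≤ y) : ∃ x, F.x₀ ≤ x ∧ F.toFun x = y := by
  obtain ⟨z, hz1, hz2⟩ := ((eventually_ge_atTop F.x₀).and (F.toFun_tendsto.eventually_ge_atTop y)).exists
  have := intermediate_value_Icc hz1 (F.contDiffOn.continuousOn.mono (fun t ht => ht.1)) 
  obtain ⟨x, hx, hxy⟩ := this ⟨hy, hz2⟩
  exact ⟨x, hx.1, hxy⟩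

noncomputable def inv (y : ℝ) : ℝ := if h : F.toFun F.x₀ ≤ y then (F.exists_inv h).choose else 0

lemma inv_ge {y : ℝ} (hy : F.toFun F.x₀ ≤ y) : F.x₀ ≤ F.inv y := by
  rw [inv, dif_pos hy]; exact (F.exists_inv hy).choose_spec.1

lemma toFun_inv {y : ℝ} (hy : F.toFun F.x₀ ≤ y) : F.toFun (F.inv y) = y := by
  rw [inv, dif_pos hy]; exact (F.exists_inv hy).choose_spec.2

lemma inv_le_iff {x y : ℝ} (hy : F.toFun F.x₀ ≤ y) (hx : F.x₀ ≤ x) : F.inv y ≤ x ↔ y ≤ F.toFun x := by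
  conv_rhs => rw [← F.toFun_inv hy]
  exact (F.strictMono.le_iff_le (F.inv_ge hy) hx).symm

lemma lt_inv_iff {x y : ℝ} (hy : F.toFun F.x₀ ≤ y) (hx : F.x₀ ≤ x) : x < F.inv y ↔ F.toFun x < y := by
  rw [← not_le, F.inv_le_iff hy hx, not_le]

lemma inv_toFun {x : ℝ} (hx : F.x₀ ≤ x) : F.inv (F.toFun x) = x := by
  have hy : F.toFun F.x₀ ≤ F.toFun x := F.strictMono.monotoneOn (by simp) hx hx
  exact F.strictMono.injOn (F.inv_ge hy) hx (F.toFun_inv hy)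

lemma inv_tendsto : Tendsto F.inv atTop atTop := by
  refine tendsto_atTop.2 fun b => ?_
  filter_upwards [eventually_ge_atTop (F.toFun F.x₀), eventually_ge_atTop (F.toFun (max b F.x₀) + 1)] with y h1 h2
  exact (le_max_left _ _).trans ((F.lt_inv_iff h1 (le_max_right _ _)).2 (by linarith)).le

lemma inv_cont {y : ℝ} (hy : F.toFun F.x₀ < y) : ContinuousAt F.inv y := by
  have hm : MonotoneOn F.inv (Set.Ioi (F.toFun F.x₀)) := by
    intro a ha b hb hab
    rw [F.inv_le_iff (le_of_lt ha) (F.inv_ge (le_of_lt hb)), F.toFun_inv (le_of_lt hb)]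
    exact hab
  refine continuousAt_of_monotoneOn_of_image_mem_nhds hm (Ioi_mem_nhds hy) ?_
  refine mem_of_superset (Ioi_mem_nhds ((F.lt_inv_iff hy.le le_rfl).2 hy)) ?_
  intro x hx
  exact ⟨F.toFun x, F.strictMono (by simp) (le_of_lt hx : F.x₀ ≤ x) hx, F.inv_toFun (le_of_lt hx)⟩

lemma inv_gt {y : ℝ} (hy : F.toFun F.x₀ < y) : F.x₀ < F.inv y := (F.lt_inv_iff hy.le le_rfl).2 hy

lemma x₀_pos : 0 < F.x₀ := by linarith [F.one_le_x₀]

lemma inv_diff {y : ℝ} (hy : F.toFun F.x₀ < y) (hu : c + F.vth (F.inv y) ≠ 0) :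
    HasDerivAt F.inv (F.inv y / (y * (c + F.vth (F.inv y)))) y := by
  have hx := F.inv_gt hy
  have hx0 : 0 < F.inv y := F.x₀_pos.trans hx
  have h1 := F.toFun_diff hx
  have hy0 : y ≠ 0 := by
    have := F.one_le F.x₀ le_rfl; linarith
  rw [F.toFun_inv hy.le] at h1
  have := h1.of_local_left_inverse (F.inv_cont hy) (by positivity) (by
    filter_upwards [Ioi_mem_nhds hy] with z hz
    exact F.toFun_inv (le_of_lt hz))
  refine this.congr_deriv ?_
  field_simp

/-- `H` in terms of `x = φ(y)` -/
noncomputable def Aux (x : ℝ) : ℝ :=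
  x * ((c + F.vth x) * (c - 1 + F.vth x) + x * deriv F.vth x) / (c + F.vth x) ^ 3

noncomputable def Aux1 (x : ℝ) : ℝ :=
  ((c + F.vth x) * (c - 1 + F.vth x) + x * deriv F.vth x
   + (c - 1 + F.vth x) * (x * deriv F.vth x) + (c + F.vth x) * (x * deriv F.vth x)
   + x * deriv F.vth x + x ^ 2 * deriv (deriv F.vth) x
   - 3 * ((c + F.vth x) * (c - 1 + F.vth x) + x * deriv F.vth x) * (x * deriv F.vth x) / (c + F.vth x))
   / (c + F.vth x) ^ 3

lemma Aux_diff {x : ℝ} (hx : F.x₀ < x) (hu : c + F.vth x ≠ 0) : HasDerivAt F.Aux (F.Aux1 x) x := by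
  have h1 := F.vth_diff hx
  have h2 := F.vth_diff2 hx
  have hid := hasDerivAt_id x
  have := (hid.mul (((h1.const_add c).mul (h1.const_add (c - 1))).add (hid.mul h2))).div ((h1.const_add c).pow 3)
    (pow_ne_zero 3 hu)
  have h3 : F.Aux = (id * ((((fun x => c + F.vth x) * fun x => c - 1 + F.vth x) + id * deriv F.vth))) / (fun x => c + F.vth x) ^ 3 := by
    funext x; simp [Aux]
  rw [h3]
  refine this.congr_deriv ?_
  simp only [Aux1, Pi.mul_apply, Pi.add_apply, id, Pi.pow_apply]
  field_simp
  push_cast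
  ring

lemma phi1_diff {y : ℝ} (hy : F.toFun F.x₀ < y) (hu : c + F.vth (F.inv y) ≠ 0) :
    HasDerivAt (fun y => F.inv y / (y * (c + F.vth (F.inv y)))) (-(F.Aux (F.inv y) / y ^ 2)) y := by
  have hx := F.inv_gt hy
  have hy0 : y ≠ 0 := by
    have := F.one_le F.x₀ le_rfl; linarith
  have h1 := F.inv_diff hy hu
  have h2 := (F.vth_diff hx).comp y h1
  have := h1.div ((hasDerivAt_id y).mul (h2.const_add c)) (mul_ne_zero hy0 hu)
  refine this.congr_deriv ?_
  simp only [Aux, Pi.mul_apply, id, Function.comp]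
  field_simp
  ring

end Fc

lemma H_arith {s a b : ℝ} (hs : 0 < s) (hs2 : s ≤ 1 / 15) (ha : |a| ≤ s / 100) (hb : |b| ≤ s / 100) :
    0.99 * s ≤ (1 + s) * s + a ∧ (1 + s) * s + a ≤ 1.08 * s ∧
    (1 + s) * s + a ≤ (1 + s) ^ 3 ∧ 
    1 / 2 * (((1 + s) * s + a) * (1 + s)) ≤ ((1 + s) * s + a + s * a + (1 + s) * a + a + b - 3 * ((1 + s) * s + a) * a / (1 + s)) ∧
    ((1 + s) * s + a + s * a + (1 + s) * a + a + b - 3 * ((1 + s) * s + a) * a / (1 + s)) ≤ 2 * (((1 + s) * s + a) * (1 + s)) := by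
  obtain ⟨ha1, ha2⟩ := abs_le.1 ha
  obtain ⟨hb1, hb2⟩ := abs_le.1 hb
  have p1 : 0.99 * s ≤ (1 + s) * s + a := by nlinarith
  have p2 : (1 + s) * s + a ≤ 1.08 * s := by nlinarith
  set P := (1 + s) * s + a with hP
  have hP0 : 0 < P := by linarith
  have hP1 : P ≤ 1 := by linarith
  have hT : |3 * P * a / (1 + s)| ≤ 0.01 * s := by
    rw [abs_div, abs_of_pos (by linarith : 0 < 1 + s), div_le_iff₀ (by linarith), abs_mul, abs_of_pos (by linarith : 0 < 3 * P)]
    have : 3 * P ≤ 0.3 := by linarith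
    calc 3 * P * |a| ≤ 0.3 * (s / 100) := by gcongr
      _ ≤ 0.01 * s * (1 + s) := by nlinarith
  obtain ⟨hT1, hT2⟩ := abs_le.1 hT
  have hsa1 : -(s / 1500) ≤ s * a := by nlinarith
  have hsa2 : s * a ≤ s / 1500 := by nlinarith
  refine ⟨p1, p2, by nlinarith [pow_pos hs 3, pow_pos hs 2], by nlinarith, by nlinarith⟩

lemma H_arith2 {P N x u : ℝ} (hx : 0 < x) (hu : 0 < u) (h : 1 / 2 * (P * u) ≤ N) :
    1 / 2 * (x * P / u ^ 3) ≤ N / u ^ 3 * (x / u) := by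
  have h1 : 1 / 2 * (x * P / u ^ 3) = (1 / 2 * (P * u)) * (x / u ^ 4) := by field_simp
  have h2 : N / u ^ 3 * (x / u) = N * (x / u ^ 4) := by field_simp
  rw [h1, h2]; gcongr

lemma exists_reg {c : ℝ} (hc : 1 ≤ c) (hc2 : c < 16 / 15) (F : Fc c) (γ' : ℝ) (hγ0 : 0 < γ') (hγ : γ' < 1 / c) :
    ∃ φ φ1 H H1 Y0, Reg (Ph F) γ' φ φ1 H H1 Y0 := by
  have hb := F.inv_tendsto.eventually (F.ev_bounds hc hc2)
  -- basic derivative facts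
  set φ := F.inv with hφ
  obtain ⟨Y1, hY1⟩ := eventually_atTop.1 (hb.and ((eventually_ge_atTop (F.toFun F.x₀ + 1)).and (eventually_ge_atTop (1:ℝ))))
  have hy1 : ∀ y ≥ Y1, F.toFun F.x₀ < y := fun y hy => by linarith [(hY1 y hy).2.1]
  have hy0 : ∀ y ≥ Y1, 1 ≤ y := fun y hy => (hY1 y hy).2.2
  have hu : ∀ y ≥ Y1, 1 < c + F.vth (φ y) := fun y hy => by linarith [(hY1 y hy).1.1]
  have hu2 : ∀ y ≥ Y1, c + F.vth (φ y) ≤ 16 / 15 := fun y hy => by linarith [(hY1 y hy).1.2.1]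
  have hx1 : ∀ y ≥ Y1, 1 ≤ φ y := fun y hy => F.one_le_x₀.trans (F.inv_gt (hy1 y hy)).le
  have hd0 : ∀ y ≥ Y1, HasDerivAt φ (φ y / (y * (c + F.vth (φ y)))) y := fun y hy =>
    F.inv_diff (hy1 y hy) (by linarith [hu y hy])
  have hyphi : ∀ y ≥ Y1, y * (φ y / (y * (c + F.vth (φ y)))) = φ y / (c + F.vth (φ y)) := by
    intro y hy
    have := hy0 y hy
    have := hu y hy
    field_simp
  have hH_eq : ∀ y ≥ Y1, F.Aux (φ y) = φ y * ((1 + (c - 1 + F.vth (φ y))) * (c - 1 + F.vth (φ y)) + φ y * deriv F.vth (φ y)) / (1 + (c - 1 + F.vth (φ y))) ^ 3 := by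
    intro y hy
    rw [Fc.Aux, show 1 + (c - 1 + F.vth (φ y)) = c + F.vth (φ y) by ring]
  have hH1_eq : ∀ y ≥ Y1, y * (F.Aux1 (φ y) * (φ y / (y * (c + F.vth (φ y))))) = F.Aux1 (φ y) * (φ y / (1 + (c - 1 + F.vth (φ y)))) := by
    intro y hy
    rw [show 1 + (c - 1 + F.vth (φ y)) = c + F.vth (φ y) by ring, ← hyphi y hy]; ring
  have hvt : Tendsto (fun y => c + F.vth (φ y)) atTop (nhds c) := by
    simpa using ((F.vth_tendsto hc).comp F.inv_tendsto).const_add c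
  -- growth
  have hgrow : ∀ᶠ y in atTop, y ^ γ' ≤ F.Aux (φ y) := by
    have hcpos : 0 < c := by linarith
    obtain ⟨β, hβ1, hβ2⟩ := exists_between hγ
    have hβ0 : 0 < β := hγ0.trans hβ1
    have hε : 0 < (1 - γ' / β) / 2 := by
      have : γ' / β < 1 := by rw [div_lt_one hβ0]; exact hβ1
      linarith
    set ε := (1 - γ' / β) / 2 with hεd
    have hε1 : ε < 1 := by
      have : 0 < γ' / β := by positivity
      linarith
    have hcβ : c < 1 / β := by
      rw [lt_div_iff₀ hcpos] at hβ2; rw [lt_div_iff₀ hβ0]; linarith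
    obtain ⟨C, hC, hCs⟩ := F.ev_s_lower hc ε hε
    obtain ⟨Y2, hY2⟩ := eventually_atTop.1 ((eventually_ge_atTop Y1).and (hvt.eventually_lt_const hcβ))
    have hm := mono_of_log_deriv φ _ (max Y2 1) β (by positivity) (fun y hy => hd0 y (hY2 y (le_of_max_le_left hy)).1) (by
      intro y hy
      have h1 := hY2 y (le_of_max_le_left hy)
      have h3 := hu y h1.1
      have h4 := hx1 y h1.1
      rw [hyphi y h1.1, le_div_iff₀ (by linarith)]
      have h5 := h1.2
      rw [lt_div_iff₀ hβ0] at h5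
      nlinarith)
    set Y3 := max Y2 1
    set C2 := φ Y3 * Y3 ^ (-β) with hC2
    have hC2pos : 0 < C2 := by
      have := hx1 Y3 (hY2 Y3 (le_max_left _ _)).1
      have : 0 < Y3 := by positivity
      positivity
    have hexp : 0 < β * (1 - ε) - γ' := by
      have : β * (1 - ε) - γ' = (β - γ') / 2 := by rw [hεd]; field_simp; ring
      rw [this]; linarith
    have hbig := (tendsto_rpow_atTop hexp).eventually_ge_atTop (1 / (C / 2 * C2 ^ (1 - ε)))
    filter_upwards [hbig, eventually_ge_atTop Y3, F.inv_tendsto.eventually hCs] with y h1 h2 h3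
    have hyY := hY2 y (le_of_max_le_left h2)
    have hy1 := hy0 y hyY.1
    have hph : C2 * y ^ β ≤ φ y := by
      have := hm (show Y3 ∈ Set.Ici Y3 by simp) h2 h2
      simp only at this
      rw [Real.rpow_neg (by linarith : (0:ℝ) ≤ y), ← div_eq_mul_inv, le_div_iff₀ (by positivity)] at this
      exact this
    have hx := hx1 y hyY.1
    obtain ⟨⟨b1, b2, b3, b4⟩, -⟩ := hY1 y hyY.1
    obtain ⟨q1, -⟩ := H_arith b1 b2 b3 b4
    have hAux : φ y * (c - 1 + F.vth (φ y)) / 2 ≤ F.Aux (φ y) := by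
      rw [hH_eq y hyY.1, div_le_div_iff₀ (by norm_num) (by positivity)]
      have h6 : (1 + (c - 1 + F.vth (φ y))) ^ 3 ≤ 1.5 := by
        calc (1 + (c - 1 + F.vth (φ y))) ^ 3 ≤ (1 + 1 / 15) ^ 3 := by gcongr
          _ ≤ 1.5 := by norm_num
      set s := c - 1 + F.vth (φ y)
      calc φ y * s * (1 + s) ^ 3 ≤ φ y * s * 1.5 := by gcongr
        _ ≤ φ y * (0.99 * s) * 2 := by nlinarith [mul_pos (by linarith : 0 < φ y) b1]
        _ ≤ _ := by gcongr
    refine le_trans ?_ hAux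
    have h7 : C / 2 * (φ y) ^ (1 - ε) ≤ φ y * (c - 1 + F.vth (φ y)) / 2 := by
      have : (φ y) ^ (1 - ε) = φ y * (φ y) ^ (-ε) := by
        rw [sub_eq_add_neg, Real.rpow_add (by linarith), Real.rpow_one]
      rw [this]
      have := mul_le_mul_of_nonneg_left h3 (by linarith : 0 ≤ φ y)
      linarith
    refine le_trans ?_ h7
    have h8 : C2 ^ (1 - ε) * y ^ (β * (1 - ε)) ≤ (φ y) ^ (1 - ε) := by
      rw [Real.rpow_mul (by linarith), ← Real.mul_rpow hC2pos.le (by positivity)]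
      exact Real.rpow_le_rpow (by positivity) hph (by linarith)
    have h9 : y ^ γ' ≤ C / 2 * C2 ^ (1 - ε) * y ^ (β * (1 - ε)) := by
      rw [show β * (1 - ε) = γ' + (β * (1 - ε) - γ') by ring, Real.rpow_add (by linarith)]
      rw [div_le_iff₀ (by positivity)] at h1
      have h10 : 0 < y ^ γ' := by positivity
      nlinarith
    calc y ^ γ' ≤ _ := h9
      _ = C / 2 * (C2 ^ (1 - ε) * y ^ (β * (1 - ε))) := by ring
      _ ≤ _ := by gcongr
  -- smallness
  have hsmall : Tendsto (fun y => φ y / y) atTop (nhds 0) := by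
    rcases hc.eq_or_lt with h | h
    · have h1 := ((F.cond_eq h.symm).2.2.2.1).comp F.inv_tendsto
      refine h1.congr' ?_
      filter_upwards [eventually_ge_atTop Y1] with y hy
      simp only [Function.comp]
      rw [F.toFun_inv (hy1 y hy).le]
    · obtain ⟨β, hβ1, hβ2⟩ := exists_between h
      have hβ0 : 0 < β := by linarith
      obtain ⟨Y2, hY2⟩ := eventually_atTop.1 ((eventually_ge_atTop Y1).and (hvt.eventually_const_lt hβ2))
      have hm := anti_of_log_deriv φ _ (max Y2 1) (1 / β) (by positivity) (fun y hy => hd0 y (hY2 y (le_of_max_le_left hy)).1) (by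
        intro y hy
        have h1 := hY2 y (le_of_max_le_left hy)
        have h3 := hu y h1.1
        have h4 := hx1 y h1.1
        rw [hyphi y h1.1, div_le_iff₀ (by linarith)]
        have : 1 ≤ 1 / β * (c + F.vth (φ y)) := by
          rw [one_div, inv_mul_eq_div, le_div_iff₀ hβ0]; linarith [h1.2]
        nlinarith)
      set Y3 := max Y2 1
      set C2 := φ Y3 * Y3 ^ (-(1 / β)) with hC2
      have hlt : 1 / β < 1 := by rw [div_lt_one hβ0]; exact hβ1
      have hz : Tendsto (fun y : ℝ => C2 * y ^ (-(1 - 1 / β))) atTop (nhds 0) := by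
        simpa using (tendsto_rpow_neg_atTop (by linarith : 0 < 1 - 1 / β)).const_mul C2
      refine squeeze_zero' ?_ ?_ hz
      · filter_upwards [eventually_ge_atTop Y1] with y hy
        have := hx1 y hy
        have := hy0 y hy
        positivity
      · filter_upwards [eventually_ge_atTop Y3] with y h2
        have hyY := hY2 y (le_of_max_le_left h2)
        have hy1 := hy0 y hyY.1
        have := hm (show Y3 ∈ Set.Ici Y3 by simp) h2 h2
        simp only at this
        rw [Real.rpow_neg (by linarith : (0:ℝ) ≤ y), ← div_eq_mul_inv, div_le_iff₀ (by positivity)] at this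
        rw [show -(1 - 1 / β) = 1 / β - 1 by ring, Real.rpow_sub_one (by linarith), ← mul_div_assoc]
        gcongr
  obtain ⟨Y4, hY4⟩ := eventually_atTop.1 hgrow
  have hmax : ∀ y ≥ max Y1 (max Y4 1), y ≥ Y1 ∧ y ≥ Y4 ∧ y ≥ 1 := by
    intro y hy
    exact ⟨le_of_max_le_left hy, le_of_max_le_left (le_of_max_le_right hy), le_of_max_le_right (le_of_max_le_right hy)⟩
  refine ⟨φ, fun y => φ y / (y * (c + F.vth (φ y))), fun y => F.Aux (φ y), fun y => F.Aux1 (φ y) * (φ y / (y * (c + F.vth (φ y)))),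
    max Y1 (max Y4 1), ?_⟩
  constructor
  · simp
  · intro y hy; exact hx1 y (hmax y hy).1
  · intro y hy; exact hd0 y (hmax y hy).1
  · intro y hy; exact F.phi1_diff (hy1 y (hmax y hy).1) (by linarith [hu y (hmax y hy).1])
  · intro y hy
    have h1 := (hmax y hy).1
    exact (F.Aux_diff (F.inv_gt (hy1 y h1)) (by linarith [hu y h1])).comp y (hd0 y h1)
  · intro y hy
    have h1 := (hmax y hy).1
    have := hu y h1
    have := hu2 y h1
    have := hx1 y h1
    rw [hyphi y h1, le_div_iff₀ (by linarith)]
    nlinarith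
  · intro y hy
    have h1 := (hmax y hy).1
    have := hu y h1
    have := hx1 y h1
    rw [hyphi y h1, div_le_iff₀ (by linarith)]
    nlinarith
  · intro y hy
    have h1 := (hmax y hy).1
    have := hx1 y h1
    obtain ⟨⟨b1, b2, b3, b4⟩, -⟩ := hY1 y h1
    obtain ⟨q1, q2, q3, q4, q5⟩ := H_arith b1 b2 b3 b4
    rw [hH_eq y h1]
    refine div_pos (mul_pos (by linarith) (by linarith)) (by positivity)
  · intro y hy
    have h1 := (hmax y hy).1
    have := hx1 y h1
    obtain ⟨⟨b1, b2, b3, b4⟩, -⟩ := hY1 y h1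
    obtain ⟨q1, q2, q3, q4, q5⟩ := H_arith b1 b2 b3 b4
    rw [hH_eq y h1, div_le_iff₀ (by positivity)]
    gcongr
  · intro y hy
    have h1 := (hmax y hy).1
    have hx := hx1 y h1
    obtain ⟨⟨b1, b2, b3, b4⟩, -⟩ := hY1 y h1
    obtain ⟨q1, q2, q3, q4, q5⟩ := H_arith b1 b2 b3 b4
    rw [hH1_eq y h1, hH_eq y h1, Fc.Aux1, show c + F.vth (φ y) = 1 + (c - 1 + F.vth (φ y)) by ring]
    set s := c - 1 + F.vth (φ y)
    exact H_arith2 (by linarith) (by linarith) q4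
  · intro y hy
    have h1 := (hmax y hy).1
    have hx := hx1 y h1
    obtain ⟨⟨b1, b2, b3, b4⟩, -⟩ := hY1 y h1
    obtain ⟨q1, q2, q3, q4, q5⟩ := H_arith b1 b2 b3 b4
    rw [hH1_eq y h1, hH_eq y h1, Fc.Aux1, show c + F.vth (φ y) = 1 + (c - 1 + F.vth (φ y)) by ring]
    set s := c - 1 + F.vth (φ y)
    rw [div_mul_div_comm, ← mul_div_assoc, div_le_div_iff₀ (by positivity) (by positivity)]
    have := mul_le_mul_of_nonneg_left q5 (by positivity : 0 ≤ φ y * (1 + s) ^ 3)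
    linarith
  · intro y hy; exact hY4 y (hmax y hy).2.1
  · exact hsmall
  · intro p hp
    have h1 := (hmax p hp).1
    have h2 := hy1 p h1
    simp only [Ph, Set.mem_ofPred_eq]
    refine and_congr_right fun _ => ?_
    constructor
    · rintro ⟨n, hn, hpn⟩
      have := (Int.floor_eq_iff.1 hpn.symm)
      push_cast at this
      exact ⟨n, (F.inv_le_iff h2.le hn).2 this.1, (F.lt_inv_iff (by linarith) hn).2 this.2⟩
    · rintro ⟨n, hn1, hn2⟩
      have hn : F.x₀ ≤ n := (F.inv_ge h2.le).trans hn1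
      refine ⟨n, hn, (Int.floor_eq_iff.2 ⟨?_, ?_⟩).symm⟩
      · push_cast; exact (F.inv_le_iff h2.le hn).1 hn1
      · push_cast; exact (F.lt_inv_iff (by linarith) hn).1 hn2

namespace Reg
variable {S : Set ℕ} {γ' : ℝ} {φ φ1 H H1 : ℝ → ℝ} {Y0 : ℝ}

lemma H_mono (R : Reg S γ' φ φ1 H H1 Y0) : MonotoneOn H (Set.Ici Y0) := by
  have := mono_of_log_deriv H H1 Y0 0 (by linarith [R.one_le_Y0]) R.d2 (fun y hy => by
    have := R.H1_lo y hy; have := R.H_pos y hy; linarith)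
  simpa using this

lemma H_anti (R : Reg S γ' φ φ1 H H1 Y0) : AntitoneOn (fun y => H y / y ^ 2) (Set.Ici Y0) := by
  have := anti_of_log_deriv H H1 Y0 2 (by linarith [R.one_le_Y0]) R.d2 R.H1_hi
  intro x hx y hy hxy
  have hx0 : (0:ℝ) < x := lt_of_lt_of_le (by linarith [R.one_le_Y0]) (show Y0 ≤ x from hx)
  have hy0 : (0:ℝ) < y := by linarith
  have h := this hx hy hxy
  simp only [Real.rpow_neg hx0.le, Real.rpow_neg hy0.le] at h
  norm_cast at h

lemma phi_mono (R : Reg S γ' φ φ1 H H1 Y0) : MonotoneOn φ (Set.Ici Y0) := by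
  have := mono_of_log_deriv φ φ1 Y0 0 (by linarith [R.one_le_Y0]) R.d0 (fun y hy => by
    have := R.phi1_lo y hy; have := R.one_le y hy; linarith)
  simpa using this

lemma phi_pow (R : Reg S γ' φ φ1 H H1 Y0) : MonotoneOn (fun y => φ y * y ^ (-(15 / 16 : ℝ))) (Set.Ici Y0) :=
  mono_of_log_deriv φ φ1 Y0 (15 / 16) (by linarith [R.one_le_Y0]) R.d0 R.phi1_lo

lemma phi_anti (R : Reg S γ' φ φ1 H H1 Y0) : AntitoneOn (fun y => φ y / y) (Set.Ici Y0) := by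
  have := anti_of_log_deriv φ φ1 Y0 1 (by linarith [R.one_le_Y0]) R.d0 (fun y hy => by
    rw [one_mul]; exact R.phi1_hi y hy)
  intro x hx y hy hxy
  have hx0 : (0:ℝ) < x := lt_of_lt_of_le (by linarith [R.one_le_Y0]) (show Y0 ≤ x from hx)
  have hy0 : (0:ℝ) < y := by linarith
  have h := this hx hy hxy
  simp only [Real.rpow_neg hx0.le, Real.rpow_neg hy0.le, Real.rpow_one] at h
  exact h

variable {N y : ℝ}

lemma sec_hi (R : Reg S γ' φ φ1 H H1 Y0) (hN : 4 * Y0 ≤ N) (h1 : N / 4 ≤ y) : H y / y ^ 2 ≤ 16 * H N / N ^ 2 := by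
  have hY := R.one_le_Y0
  have hN0 : 0 < N := by linarith
  have a1 := R.H_anti (show Y0 ≤ N / 4 by linarith) (show Y0 ≤ y by linarith) h1
  have a2 := R.H_mono (show Y0 ≤ N / 4 by linarith) (show Y0 ≤ N by linarith) (by linarith)
  simp only at a1
  refine a1.trans ?_
  rw [show H (N / 4) / (N / 4) ^ 2 = 16 * H (N / 4) / N ^ 2 by field_simp; ring]
  gcongr

lemma sec_lo (R : Reg S γ' φ φ1 H H1 Y0) (hN : 4 * Y0 ≤ N) (h1 : N / 4 ≤ y) (h2 : y ≤ 4 * N) : H N / N ^ 2 / 16 ≤ H y / y ^ 2 := by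
  have hY := R.one_le_Y0
  have hN0 : 0 < N := by linarith
  have a1 := R.H_anti (show Y0 ≤ y by linarith) (show Y0 ≤ 4 * N by linarith) h2
  have a2 := R.H_mono (show Y0 ≤ N by linarith) (show Y0 ≤ 4 * N by linarith) (by linarith)
  simp only at a1
  refine le_trans ?_ a1
  rw [show H (4 * N) / (4 * N) ^ 2 = H (4 * N) / N ^ 2 / 16 by field_simp; ring]
  gcongr

lemma H1_hi' (R : Reg S γ' φ φ1 H H1 Y0) (hN : 4 * Y0 ≤ N) (h1 : N / 4 ≤ y) (h2 : y ≤ 4 * N) : H1 y ≤ 128 * H N / N := by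
  have hY := R.one_le_Y0
  have hN0 : 0 < N := by linarith
  have hy0 : 0 < y := by linarith
  have a1 := R.H1_hi y (by linarith)
  have a2 := R.sec_hi hN h1
  have h3 : H1 y ≤ 2 * y * (H y / y ^ 2) := by
    have : 2 * y * (H y / y ^ 2) = 2 * H y / y := by field_simp
    rw [this, le_div_iff₀ hy0]; linarith
  have hH := R.H_pos N (by linarith)
  calc H1 y ≤ 2 * y * (H y / y ^ 2) := h3
    _ ≤ 2 * (4 * N) * (16 * H N / N ^ 2) := by
        have := R.H_pos y (by linarith)
        gcongr
    _ = 128 * H N / N := by field_simp; ring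

lemma H1_lo' (R : Reg S γ' φ φ1 H H1 Y0) (hN : 4 * Y0 ≤ N) (h1 : N / 4 ≤ y) (h2 : y ≤ 4 * N) : H N / N / 128 ≤ H1 y := by
  have hY := R.one_le_Y0
  have hN0 : 0 < N := by linarith
  have hy0 : 0 < y := by linarith
  have a1 := R.H1_lo y (by linarith)
  have a2 := R.sec_lo hN h1 h2
  have h3 : 1 / 2 * y * (H y / y ^ 2) ≤ H1 y := by
    have : 1 / 2 * y * (H y / y ^ 2) = 1 / 2 * H y / y := by field_simp
    rw [this, div_le_iff₀ hy0]; linarith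
  have hH := R.H_pos N (by linarith)
  calc H N / N / 128 = 1 / 2 * (N / 4) * (H N / N ^ 2 / 16) := by field_simp; ring
    _ ≤ 1 / 2 * y * (H y / y ^ 2) := by gcongr
    _ ≤ _ := h3

lemma phi1_hi' (R : Reg S γ' φ φ1 H H1 Y0) (hN : 4 * Y0 ≤ N) (h1 : N / 4 ≤ y) : φ1 y ≤ 4 * φ N / N := by
  have hY := R.one_le_Y0
  have hN0 : 0 < N := by linarith
  have hy0 : 0 < y := by linarith
  have a1 := R.phi1_hi y (by linarith)
  have a2 := R.phi_anti (show Y0 ≤ N / 4 by linarith) (show Y0 ≤ y by linarith) h1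
  have a3 := R.phi_mono (show Y0 ≤ N / 4 by linarith) (show Y0 ≤ N by linarith) (by linarith)
  simp only at a2
  calc φ1 y ≤ φ y / y := by rw [le_div_iff₀ hy0]; linarith
    _ ≤ _ := a2
    _ = 4 * φ (N / 4) / N := by field_simp
    _ ≤ _ := by gcongr

lemma phi1_lo' (R : Reg S γ' φ φ1 H H1 Y0) (hN : 4 * Y0 ≤ N) (h1 : N / 4 ≤ y) (h2 : y ≤ 4 * N) : φ N / N / 5 ≤ φ1 y := by
  have hY := R.one_le_Y0
  have hN0 : 0 < N := by linarith
  have hy0 : 0 < y := by linarith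
  have a1 := R.phi1_lo y (by linarith)
  have a2 := R.phi_anti (show Y0 ≤ y by linarith) (show Y0 ≤ 4 * N by linarith) h2
  have a3 := R.phi_mono (show Y0 ≤ N by linarith) (show Y0 ≤ 4 * N by linarith) (by linarith)
  have a4 := R.one_le N (by linarith)
  simp only at a2
  calc φ N / N / 5 ≤ 15 / 16 * (φ (4 * N) / (4 * N)) := by
        rw [show 15 / 16 * (φ (4 * N) / (4 * N)) = (15 / 64 * φ (4 * N)) / N by field_simp; ring, div_div, mul_comm N 5,
          ← div_div]
        gcongr; linarith
    _ ≤ 15 / 16 * (φ y / y) := by gcongr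
    _ ≤ _ := by rw [← mul_div_assoc, div_le_iff₀ hy0]; linarith

lemma phi_diff_lo (R : Reg S γ' φ φ1 H H1 Y0) (hN : 4 * Y0 ≤ N) (h1 : N / 4 ≤ y) (h2 : y ≤ 2 * N) : φ N / N / 5 ≤ φ (y + 1) - φ y := by
  have hY := R.one_le_Y0
  obtain ⟨z, hz, hz2⟩ := exists_hasDerivAt_eq_slope φ φ1 (show y < y + 1 by linarith)
    (fun w hw => (R.d0 w (by linarith [hw.1])).continuousAt.continuousWithinAt) (fun w hw => R.d0 w (by linarith [hw.1]))
  rw [show y + 1 - y = 1 by ring, div_one] at hz2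
  rw [← hz2]
  exact R.phi1_lo' hN (by linarith [hz.1]) (by linarith [hz.2])

lemma phi_diff_hi (R : Reg S γ' φ φ1 H H1 Y0) (hN : 4 * Y0 ≤ N) (h1 : N / 4 ≤ y) : φ (y + 1) - φ y ≤ 4 * φ N / N := by
  have hY := R.one_le_Y0
  obtain ⟨z, hz, hz2⟩ := exists_hasDerivAt_eq_slope φ φ1 (show y < y + 1 by linarith)
    (fun w hw => (R.d0 w (by linarith [hw.1])).continuousAt.continuousWithinAt) (fun w hw => R.d0 w (by linarith [hw.1]))
  rw [show y + 1 - y = 1 by ring, div_one] at hz2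
  rw [← hz2]
  exact R.phi1_hi' hN (by linarith [hz.1])

/-- Type I sums with a linear phase. -/
lemma expsum1 (R : Reg S γ' φ φ1 H H1 Y0) (hN : 4 * Y0 ≤ N) (k : ℕ) (hk : 1 ≤ k) (hkN : (k : ℝ) ≤ N) (m θ : ℝ) (hm : 0 < m) (a b : ℕ)
    (ha : N ≤ 4 * (k * a)) (hb : (k : ℝ) * b ≤ 2 * N) :
    ‖∑ l ∈ Finset.Ico a b, e (m * φ (k * l) + θ * l)‖ ≤ 24576 * (√(m * H N) + N / √(m * H N)) := by
  have hY := R.one_le_Y0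
  have hN0 : 0 < N := by linarith
  have hH := R.H_pos N (by linarith)
  have hk0 : (0:ℝ) < k := by exact_mod_cast hk
  have hmH : 0 < m * H N := by positivity
  set lam := m * k ^ 2 * (H N / N ^ 2 / 16) with hlam
  have hl0 : 0 < lam := by positivity
  have hsq : √lam = k * √(m * H N) / (4 * N) := by
    rw [hlam, show m * k ^ 2 * (H N / N ^ 2 / 16) = (m * H N) * (k / (4 * N)) ^ 2 by field_simp; ring,
      Real.sqrt_mul hmH.le, Real.sqrt_sq (by positivity)]
    field_simp
  have := vdc_neg (fun l : ℕ => m * φ (k * l) + θ * l) a b lam 256 (2 * N / k) hl0 (by norm_num)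
    (by rw [le_div_iff₀ hk0]; have : (0:ℝ) ≤ a * k := by positivity
        linarith [this]) (by positivity) (by
      intro n hn1 hn2
      have hn1' : (a:ℝ) ≤ n := by exact_mod_cast hn1
      have hn2' : (n:ℝ) + 1 ≤ b := by exact_mod_cast hn2
      have hrange : ∀ t ∈ Set.Icc (n:ℝ) (n + 2), N / 4 ≤ k * t ∧ k * t ≤ 4 * N := by
        intro t ht
        constructor
        · have : (k:ℝ) * a ≤ k * t := by gcongr; linarith [ht.1]
          linarith
        · have : (k:ℝ) * t ≤ k * (b + 1) := by gcongr; linarith [ht.2]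
          linarith
      have h := second_diff (fun t => -(m * φ (k * t) + θ * t)) (fun t => -(m * (φ1 (k * t) * k) + θ)) (fun t => m * k ^ 2 * (H (k * t) / (k * t) ^ 2))
        n lam (256 * lam) ?_ ?_ ?_ ?_
      · push_cast
        constructor <;> linarith [h.1, h.2]
      · intro t ht
        have hd := R.d0 (k * t) (by linarith [(hrange t ht).1])
        have h2 : HasDerivAt (fun t : ℝ => (k:ℝ) * t) k t := by simpa using (hasDerivAt_id t).const_mul (k:ℝ)
        have h3 : HasDerivAt (fun t : ℝ => θ * t) θ t := by simpa using (hasDerivAt_id t).const_mul θ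
        exact (((hd.comp t h2).const_mul m).add h3).neg
      · intro t ht
        have hd := R.d1 (k * t) (by linarith [(hrange t ht).1])
        have h2 : HasDerivAt (fun t : ℝ => (k:ℝ) * t) k t := by simpa using (hasDerivAt_id t).const_mul (k:ℝ)
        have := ((((hd.comp t h2).mul_const (k:ℝ)).const_mul m).add_const θ).neg
        refine this.congr_deriv ?_
        ring
      · intro t ht
        have := R.sec_lo hN (hrange t ht).1 (hrange t ht).2
        rw [hlam]; gcongr
      · intro t ht
        have := R.sec_hi hN (hrange t ht).1
        rw [hlam, show 256 * (m * k ^ 2 * (H N / N ^ 2 / 16)) = m * k ^ 2 * (16 * H N / N ^ 2) by ring]; gcongr)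
  refine this.trans ?_
  rw [hsq]
  have hs : 0 < √(m * H N) := Real.sqrt_pos.2 hmH
  have e1 : 2 * N / k * (k * √(m * H N) / (4 * N)) = √(m * H N) / 2 := by field_simp; ring
  have e2 : 1 / (k * √(m * H N) / (4 * N)) ≤ 4 * (N / √(m * H N)) := by
    rw [one_div_div, ← mul_div_assoc]
    apply div_le_div_of_nonneg_left (by positivity) hs
    have : (1:ℝ) ≤ k := by exact_mod_cast hk
    nlinarith
  rw [e1]
  have : 0 < N / √(m * H N) := by positivity
  linarith

set_option maxHeartbeats 1000000 in
/-- Type II sums. -/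
lemma expsum2 (R : Reg S γ' φ φ1 H H1 Y0) (hN : 4 * Y0 ≤ N) (s1 s2 : ℕ) (hs : s1 < s2) (hs1 : 1 ≤ s1) (hsN : (s2 : ℝ) ≤ N) (m K : ℝ) (hm : 0 < m) (hK : 1 ≤ K) (a b : ℕ)
    (ha : N ≤ 4 * (s1 * a)) (hb : (s2 : ℝ) * b ≤ 2 * N) (haK : K / 8 ≤ a) (hbK : b ≤ 2 * K) :
    ‖∑ t ∈ Finset.Ico a b, e (m * φ (s1 * t) - m * φ (s2 * t))‖ ≤
     2 ^ 28 * (√K * √((s2 - s1) * (m * H N / N)) + √K / √(m * H N / N)) := by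
  have hY := R.one_le_Y0
  have hN0 : 0 < N := by linarith
  have hK0 : 0 < K := by linarith
  have hH := R.H_pos N (by linarith)
  have hk0 : (0:ℝ) < s1 := by exact_mod_cast hs1
  have hs' : (1:ℝ) ≤ (s2:ℝ) - s1 := by
    have : (s1:ℝ) + 1 ≤ s2 := by exact_mod_cast hs
    linarith
  have hmH : 0 < m * H N / N := by positivity
  set g := m * H N / N with hg
  set D := (s2:ℝ) - s1 with hD
  have hD0 : 0 < D := by linarith
  set lam := D * g / K / 2 ^ 9 with hlam
  have hl0 : 0 < lam := by positivity
  have := vdc (fun t : ℕ => m * φ (s1 * t) - m * φ (s2 * t)) a b lam (2 ^ 19) (2 * K) hl0 (by norm_num)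
    (by have : (0:ℝ) ≤ a := by positivity
        linarith) (by positivity) (by
      intro n hn1 hn2
      have hn1' : (a:ℝ) ≤ n := by exact_mod_cast hn1
      have hn2' : (n:ℝ) + 1 ≤ b := by exact_mod_cast hn2
      have hrange : ∀ t ∈ Set.Icc (n:ℝ) (n + 2), N / 4 ≤ s1 * t ∧ s1 * t ≤ s2 * t ∧ s2 * t ≤ 4 * N ∧ K / 8 ≤ t ∧ t ≤ 4 * K := by
        intro t ht
        have ht1 := ht.1
        have ht2 := ht.2
        have hb0 : (b:ℝ) ≥ 1 := by linarith [(by positivity : (0:ℝ) ≤ n)]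
        refine ⟨?_, ?_, ?_, by linarith, by linarith⟩
        · have : (s1:ℝ) * a ≤ s1 * t := by gcongr; linarith
          linarith
        · have : 0 ≤ t := by linarith
          nlinarith
        · have : (s2:ℝ) * t ≤ s2 * (b + 1) := by gcongr; linarith
          linarith
      have h := second_diff (fun t => m * φ (s1 * t) - m * φ (s2 * t)) (fun t => m * (φ1 (s1 * t) * s1) - m * (φ1 (s2 * t) * s2))
        (fun t => m * (H (s2 * t) - H (s1 * t)) / t ^ 2)
        n lam (2 ^ 19 * lam) ?_ ?_ ?_ ?_
      · push_cast
        exact h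
      · intro t ht
        obtain ⟨r1, r2, r3, r4, r5⟩ := hrange t ht
        have hd := R.d0 (s1 * t) (by linarith)
        have hd' := R.d0 (s2 * t) (by linarith)
        have h2 : HasDerivAt (fun t : ℝ => (s1:ℝ) * t) s1 t := by simpa using (hasDerivAt_id t).const_mul (s1:ℝ)
        have h3 : HasDerivAt (fun t : ℝ => (s2:ℝ) * t) s2 t := by simpa using (hasDerivAt_id t).const_mul (s2:ℝ)
        exact (((hd.comp t h2).const_mul m).sub ((hd'.comp t h3).const_mul m))
      · intro t ht
        obtain ⟨r1, r2, r3, r4, r5⟩ := hrange t ht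
        have hd := R.d1 (s1 * t) (by linarith)
        have hd' := R.d1 (s2 * t) (by linarith)
        have h2 : HasDerivAt (fun t : ℝ => (s1:ℝ) * t) s1 t := by simpa using (hasDerivAt_id t).const_mul (s1:ℝ)
        have h3 : HasDerivAt (fun t : ℝ => (s2:ℝ) * t) s2 t := by simpa using (hasDerivAt_id t).const_mul (s2:ℝ)
        have := (((hd.comp t h2).mul_const (s1:ℝ)).const_mul m).sub (((hd'.comp t h3).mul_const (s2:ℝ)).const_mul m)
        refine this.congr_deriv ?_
        have ht0 : 0 < t := by linarith
        have hs20 : (0:ℝ) < s2 := by linarith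
        field_simp
        ring
      all_goals
        intro t ht
        obtain ⟨r1, r2, r3, r4, r5⟩ := hrange t ht
        have ht0 : 0 < t := by linarith
        have hlt : (s1:ℝ) * t < s2 * t := by nlinarith
        obtain ⟨z, hz, hz2⟩ := exists_hasDerivAt_eq_slope H H1 hlt
          (fun w hw => (R.d2 w (by linarith [hw.1])).continuousAt.continuousWithinAt) (fun w hw => R.d2 w (by linarith [hw.1]))
        have e1 : m * (H (s2 * t) - H (s1 * t)) / t ^ 2 = m * D * H1 z / t := by
          rw [hz2, ← sub_mul, ← hD]
          field_simp
        have z1 := R.H1_lo' hN (show N / 4 ≤ z by linarith [hz.1]) (by linarith [hz.2])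
        have z2 := R.H1_hi' hN (show N / 4 ≤ z by linarith [hz.1]) (by linarith [hz.2])
        have hH1 : 0 < H1 z := lt_of_lt_of_le (by positivity) z1
        rw [e1]
      · calc lam = m * D * (H N / N / 128) / (4 * K) := by rw [hlam, hg]; field_simp; norm_num
          _ ≤ _ := by gcongr
      · calc m * D * H1 z / t ≤ m * D * (128 * H N / N) / (K / 8) := by gcongr
          _ = _ := by rw [hlam, hg]; field_simp; norm_num)
  refine this.trans ?_
  have hsq : √lam ≤ √(D * g) / √K := by
    rw [← Real.sqrt_div (by positivity)]
    apply Real.sqrt_le_sqrt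
    rw [hlam]
    apply div_le_self (by positivity) (by norm_num)
  have hsq2 : √g / √K / 32 ≤ √lam := by
    rw [← Real.sqrt_div (by positivity)]
    apply Real.le_sqrt_of_sq_le
    rw [div_pow, Real.sq_sqrt (by positivity), hlam]
    have : g ≤ D * g := le_mul_of_one_le_left hmH.le hs'
    calc g / K / 32 ^ 2 ≤ D * g / K / 32 ^ 2 := by gcongr
      _ ≤ _ := by gcongr; norm_num
  have hKK : √K * √K = K := Real.mul_self_sqrt hK0.le
  have hsK : 0 < √K := Real.sqrt_pos.2 hK0
  have hsg : 0 < √g := Real.sqrt_pos.2 hmH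
  have e1 : 2 * K * √lam ≤ 2 * (√K * √(D * g)) := by
    calc 2 * K * √lam ≤ 2 * K * (√(D * g) / √K) := by gcongr
      _ = 2 * (√K * √K) * (√(D * g) / √K) := by rw [hKK]
      _ = _ := by field_simp
  have e2 : 1 / √lam ≤ 32 * (√K / √g) := by
    calc 1 / √lam ≤ 1 / (√g / √K / 32) := by gcongr
      _ = _ := by field_simp
  have p1 : 0 ≤ √K * √(D * g) := by positivity
  have p2 : 0 ≤ √K / √g := by positivity
  have h30 : (12 * 2 ^ 19 : ℝ) * (2 * K * √lam + 1 / √lam) ≤ (12 * 2 ^ 19) * (2 * (√K * √(D * g)) + 32 * (√K / √g)) := by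
    gcongr
  refine h30.trans ?_
  generalize √K * √(D * g) = u at *
  generalize √K / √g = v at *
  norm_num
  linarith

end Reg

lemma divisor_bound (ε : ℝ) (hε : 0 < ε) : ∃ C : ℝ, 1 ≤ C ∧ ∀ n : ℕ, 1 ≤ n → (n.divisors.card : ℝ) ≤ C * (n : ℝ) ^ ε := by
  have h2 : (1:ℝ) < 2 ^ ε := Real.one_lt_rpow (by norm_num) hε
  set δ := min 1 ((2:ℝ) ^ ε - 1) with hδ
  have hδ0 : 0 < δ := lt_min one_pos (by linarith)
  have hδ1 : δ ≤ 1 := min_le_left _ _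
  have hδ2 : δ ≤ 2 ^ ε - 1 := min_le_right _ _
  have hA : 1 ≤ 1 / δ := by rw [le_div_iff₀ hδ0]; linarith
  set P0 := ⌈(2:ℝ) ^ (1 / ε)⌉₊ with hP0
  refine ⟨(1 / δ) ^ P0, one_le_pow₀ hA, ?_⟩
  intro n hn
  rw [Nat.card_divisors (by omega)]
  have hn2 : (n:ℝ) ^ ε = ∏ p ∈ n.primeFactors, (((p:ℝ) ^ ε) ^ (n.factorization p)) := by
    conv_lhs => rw [← Nat.prod_factorization_pow_eq_self (show n ≠ 0 by omega)]
    rw [Finsupp.prod, Nat.support_factorization]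
    push_cast
    rw [← Real.finsetProd_rpow _ _ (fun i _ => by positivity)]
    refine Finset.prod_congr rfl fun p hp => ?_
    rw [← Real.rpow_natCast, ← Real.rpow_mul (by positivity), ← Real.rpow_natCast, ← Real.rpow_mul (by positivity), mul_comm]
  rw [hn2]
  push_cast
  have hpt : ∀ p ∈ n.primeFactors, ((n.factorization p : ℝ) + 1) ≤ (if p < P0 then 1 / δ else 1) * (((p:ℝ) ^ ε) ^ (n.factorization p)) := by
    intro p hp
    have hp2 : (2:ℝ) ≤ p := by exact_mod_cast (Nat.prime_of_mem_primeFactors hp).two_le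
    split_ifs with h
    · have h3 : (2:ℝ) ^ ε ≤ p ^ ε := Real.rpow_le_rpow (by norm_num) hp2 hε.le
      have h4 := one_add_mul_le_pow (show (-2:ℝ) ≤ δ by linarith) (n.factorization p)
      have h5 : (1 + δ) ^ (n.factorization p) ≤ ((p:ℝ) ^ ε) ^ (n.factorization p) := by
        gcongr; linarith
      rw [div_mul_eq_mul_div, one_mul, le_div_iff₀ hδ0]
      nlinarith
    · push Not at h
      have h3 : (2:ℝ) ≤ p ^ ε := by
        have : (2:ℝ) ^ (1 / ε) ≤ p := (Nat.le_ceil _).trans (by exact_mod_cast h)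
        calc (2:ℝ) = ((2:ℝ) ^ (1 / ε)) ^ ε := by rw [← Real.rpow_mul (by norm_num)]; field_simp; simp
          _ ≤ _ := Real.rpow_le_rpow (by positivity) this hε.le
      have h4 := one_add_mul_le_pow (show (-2:ℝ) ≤ 1 by norm_num) (n.factorization p)
      have h5 : (1 + 1:ℝ) ^ (n.factorization p) ≤ ((p:ℝ) ^ ε) ^ (n.factorization p) := by
        gcongr; linarith
      linarith
  refine (Finset.prod_le_prod (fun p _ => by positivity) hpt).trans ?_
  rw [Finset.prod_mul_distrib]
  gcongr
  rw [Finset.prod_ite]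
  simp only [Finset.prod_const, one_pow, mul_one]
  refine pow_le_pow_right₀ hA ?_
  calc _ ≤ (Finset.range P0).card := Finset.card_le_card (fun p hp => by
        rw [Finset.mem_range]; exact (Finset.mem_filter.1 hp).2)
    _ = P0 := by simp

lemma sum_normsq_le {ι κ : Type*} (S : Finset ι) (T : Finset κ) (w : ι → κ → ℂ) :
    ∑ t ∈ T, ‖∑ s ∈ S, w s t‖ ^ 2 ≤ ∑ s1 ∈ S, ∑ s2 ∈ S, ‖∑ t ∈ T, w s1 t * (starRingEnd ℂ) (w s2 t)‖ := by
  have h : ((∑ t ∈ T, ‖∑ s ∈ S, w s t‖ ^ 2 : ℝ) : ℂ) = ∑ s1 ∈ S, ∑ s2 ∈ S, ∑ t ∈ T, w s1 t * (starRingEnd ℂ) (w s2 t) := by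
    push_cast
    have h1 : ∀ t ∈ T, ((‖∑ s ∈ S, w s t‖ : ℂ)) ^ 2 = ∑ s1 ∈ S, ∑ s2 ∈ S, w s1 t * (starRingEnd ℂ) (w s2 t) := by
      intro t _
      rw [← Complex.mul_conj', map_sum, Finset.sum_mul_sum]
    rw [Finset.sum_congr rfl h1, Finset.sum_comm]
    refine Finset.sum_congr rfl fun s1 _ => Finset.sum_comm
  have h0 : 0 ≤ ∑ t ∈ T, ‖∑ s ∈ S, w s t‖ ^ 2 := Finset.sum_nonneg fun _ _ => by positivity
  have h2 : ‖((∑ t ∈ T, ‖∑ s ∈ S, w s t‖ ^ 2 : ℝ) : ℂ)‖ = ∑ t ∈ T, ‖∑ s ∈ S, w s t‖ ^ 2 := by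
    rw [Complex.norm_real, Real.norm_of_nonneg h0]
  rw [← h2, h]
  refine (norm_sum_le _ _).trans (Finset.sum_le_sum fun s1 _ => norm_sum_le _ _)

def TypeII (g : ℕ → ℂ) (N Q : ℕ) (I : ℝ) : Prop :=
  ∀ s1 s2 : ℕ, 1 ≤ s1 → s1 < s2 → s2 ≤ N → s2 < s1 + Q → ∀ K : ℝ, 1 ≤ K → ∀ a b : ℕ, N ≤ 4 * (s1 * a) →
    s2 * b ≤ 2 * N → K / 8 ≤ a → (b : ℝ) ≤ 2 * K →
    ‖∑ t ∈ Finset.Ico a b, g (s1 * t) * (starRingEnd ℂ) (g (s2 * t))‖ ≤ I * √K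

lemma mem_range_iff (N s t : ℕ) (hs : 1 ≤ s) : t ∈ Finset.Ico (N / (4 * s) + 1) (N / s + 1) ↔ N < 4 * (s * t) ∧ s * t ≤ N := by
  rw [Finset.mem_Ico, Nat.succ_le_iff, Nat.div_lt_iff_lt_mul (by omega), Nat.lt_succ_iff, Nat.le_div_iff_mul_le (by omega)]
  rw [mul_comm t (4 * s), mul_comm t s, mul_assoc]

lemma segment_bound (g : ℕ → ℂ) (hg : ∀ n, ‖g n‖ ≤ 1) (N Q S0 : ℕ) (hS0 : 1 ≤ S0) (hQS : Q ≤ S0) (hSN : S0 ≤ N) (I : ℝ) (hI : 0 ≤ I)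
    (h2 : TypeII g N Q I) (S : Finset ℕ) (hS : ∀ s ∈ S, S0 ≤ s ∧ s < S0 + Q ∧ s ≤ N)
    (x y : ℕ → ℂ) (A B : ℝ) (hA : 0 ≤ A) (hB : 0 ≤ B) (hx : ∀ n ≤ N, ‖x n‖ ≤ A) (hy : ∀ n ≤ N, ‖y n‖ ≤ B) :
    ‖∑ s ∈ S, ∑ t ∈ Finset.Ico (N / (4 * s) + 1) (N / s + 1), x s * y t * g (s * t)‖ ^ 2 ≤
      (B ^ 2 * (N / S0)) * (A ^ 2 * (Q * (N / S0) + Q ^ 2 * (I * √(N / S0)))) := by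
  have hS0' : (0:ℝ) < S0 := by exact_mod_cast hS0
  set K : ℝ := (N:ℝ) / S0 with hK
  have hK1 : 1 ≤ K := by rw [hK, le_div_iff₀ hS0']; simpa using (by exact_mod_cast hSN : (S0:ℝ) ≤ N)
  set T := Finset.Icc 1 (N / S0) with hT
  set w : ℕ → ℕ → ℂ := fun s t => if N < 4 * (s * t) ∧ s * t ≤ N then x s * g (s * t) else 0 with hw
  have hTsub : ∀ s ∈ S, Finset.Ico (N / (4 * s) + 1) (N / s + 1) ⊆ T := by
    intro s hs t ht
    have h1 := hS s hs
    rw [hT, Finset.mem_Icc]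
    have h3 := (mem_range_iff N s t (by omega)).1 ht
    refine ⟨?_, ?_⟩
    · exact (Nat.succ_pos _).trans_le (Finset.mem_Ico.1 ht).1
    · rw [Nat.le_div_iff_mul_le (by omega)]
      calc t * S0 ≤ t * s := Nat.mul_le_mul_left _ h1.1
        _ = s * t := mul_comm _ _
        _ ≤ N := h3.2
  have hTcard : (T.card : ℝ) ≤ K := by
    rw [hT, Nat.card_Icc, Nat.add_sub_cancel]
    exact Nat.cast_div_le
  have hsum : ∑ s ∈ S, ∑ t ∈ Finset.Ico (N / (4 * s) + 1) (N / s + 1), x s * y t * g (s * t) = ∑ t ∈ T, y t * ∑ s ∈ S, w s t := by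
    simp_rw [Finset.mul_sum]
    rw [Finset.sum_comm (s := T)]
    refine Finset.sum_congr rfl fun s hs => ?_
    have h1 := hS s hs
    rw [← Finset.sum_subset (hTsub s hs)]
    · refine Finset.sum_congr rfl fun t ht => ?_
      simp only [hw]
      rw [if_pos ((mem_range_iff N s t (by omega)).1 ht)]; ring
    · intro t _ ht
      simp only [hw]
      rw [if_neg (fun h => ht ((mem_range_iff N s t (by omega)).2 h)), mul_zero]
  rw [hsum]
  have hT_le : ∀ t ∈ T, t ≤ N := by
    intro t ht
    rw [hT, Finset.mem_Icc] at ht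
    exact ht.2.trans (Nat.div_le_self _ _)
  have hcs : ‖∑ t ∈ T, y t * ∑ s ∈ S, w s t‖ ^ 2 ≤ (∑ t ∈ T, ‖y t‖ ^ 2) * (∑ t ∈ T, ‖∑ s ∈ S, w s t‖ ^ 2) := by
    refine le_trans ?_ (Finset.sum_mul_sq_le_sq_mul_sq T (fun t => ‖y t‖) (fun t => ‖∑ s ∈ S, w s t‖))
    refine pow_le_pow_left₀ (norm_nonneg _) ?_ 2
    refine (norm_sum_le _ _).trans (le_of_eq ?_)
    simp
  refine hcs.trans ?_
  have hy2 : ∑ t ∈ T, ‖y t‖ ^ 2 ≤ B ^ 2 * K := by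
    calc ∑ t ∈ T, ‖y t‖ ^ 2 ≤ ∑ t ∈ T, B ^ 2 := Finset.sum_le_sum fun t ht => pow_le_pow_left₀ (norm_nonneg _) (hy t (hT_le t ht)) 2
      _ = T.card * B ^ 2 := by simp
      _ ≤ K * B ^ 2 := by gcongr
      _ = _ := by ring
  have hlt : ∀ s1 ∈ S, ∀ s2 ∈ S, s1 < s2 → ‖∑ t ∈ T, w s1 t * (starRingEnd ℂ) (w s2 t)‖ ≤ A ^ 2 * (I * √K) := by
    intro s1 hs1 s2 hs2 hlt
    have h1 := hS s1 hs1
    have h3 := hS s2 hs2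
    have hss : s1 ≤ s2 := hlt.le
    have hsum2 : ∑ t ∈ T, w s1 t * (starRingEnd ℂ) (w s2 t) =
        x s1 * (starRingEnd ℂ) (x s2) * ∑ t ∈ Finset.Ico (N / (4 * s1) + 1) (N / s2 + 1), g (s1 * t) * (starRingEnd ℂ) (g (s2 * t)) := by
      have hmem : ∀ t, t ∈ Finset.Ico (N / (4 * s1) + 1) (N / s2 + 1) ↔ (N < 4 * (s1 * t) ∧ s1 * t ≤ N) ∧ (N < 4 * (s2 * t) ∧ s2 * t ≤ N) := by
        intro t
        rw [← mem_range_iff N s1 t (by omega), ← mem_range_iff N s2 t (by omega)]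
        simp only [Finset.mem_Ico]
        have e1 : N / (4 * s2) ≤ N / (4 * s1) := Nat.div_le_div_left (by omega) (by omega)
        have e2 : N / s2 ≤ N / s1 := Nat.div_le_div_left (by omega) (by omega)
        omega
      have hsub : Finset.Ico (N / (4 * s1) + 1) (N / s2 + 1) ⊆ T := by
        intro t ht
        exact hTsub s1 hs1 ((mem_range_iff N s1 t (by omega)).2 ((hmem t).1 ht).1)
      rw [← Finset.sum_subset hsub, Finset.mul_sum]
      · refine Finset.sum_congr rfl fun t ht => ?_
        have := (hmem t).1 ht
        simp only [hw]
        rw [if_pos this.1, if_pos this.2, map_mul]; ring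
      · intro t _ ht
        rw [hmem, not_and_or] at ht
        simp only [hw]
        rcases ht with ht | ht
        · rw [if_neg ht, zero_mul]
        · rw [if_neg ht, map_zero, mul_zero]
    rw [hsum2, norm_mul, norm_mul, RCLike.norm_conj]
    have hb := h2 s1 s2 (by omega) hlt h3.2.2 (by omega) K hK1 (N / (4 * s1) + 1) (N / s2 + 1) (by
        have := Nat.lt_succ_iff.1 (Nat.lt_succ_of_lt (Nat.lt_mul_div_succ N (show 0 < 4 * s1 by omega)))
        calc N ≤ 4 * s1 * (N / (4 * s1) + 1) := this
          _ = _ := by ring) (by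
        have := Nat.mul_div_le N s2
        calc s2 * (N / s2 + 1) = s2 * (N / s2) + s2 := by ring
          _ ≤ 2 * N := by omega) (by
        have h5 : (N:ℝ) / ((4 * s1 : ℕ) : ℝ) < ((N / (4 * s1) + 1 : ℕ) : ℝ) := by
          rw [div_lt_iff₀ (by have : 0 < 4 * s1 := by omega
                              exact_mod_cast this)]
          have := Nat.lt_mul_div_succ N (show 0 < 4 * s1 by omega)
          rw [mul_comm] at this
          exact_mod_cast this
        refine le_trans ?_ h5.le
        rw [hK, div_div]
        apply div_le_div_of_nonneg_left (by positivity)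
        · have : 0 < 4 * s1 := by omega
          exact_mod_cast this
        · have : 4 * s1 ≤ S0 * 8 := by omega
          exact_mod_cast this) (by
        have h6 : ((N / s2 : ℕ) : ℝ) ≤ K := by
          refine (Nat.cast_div_le).trans ?_
          rw [hK]
          apply div_le_div_of_nonneg_left (by positivity) hS0'
          exact_mod_cast h3.1
        push_cast; linarith)
    calc ‖x s1‖ * ‖x s2‖ * _ ≤ A * A * (I * √K) := by
          gcongr
          · exact hx s1 h1.2.2
          · exact hx s2 h3.2.2
      _ = _ := by ring
  have hoff : ∀ s1 ∈ S, ∀ s2 ∈ S, s1 ≠ s2 → ‖∑ t ∈ T, w s1 t * (starRingEnd ℂ) (w s2 t)‖ ≤ A ^ 2 * (I * √K) := by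
    intro s1 hs1 s2 hs2 hne
    rcases lt_or_gt_of_ne hne with h | h
    · exact hlt s1 hs1 s2 hs2 h
    · have := hlt s2 hs2 s1 hs1 h
      rw [← RCLike.norm_conj, map_sum]
      have e : ∑ t ∈ T, (starRingEnd ℂ) (w s1 t * (starRingEnd ℂ) (w s2 t)) = ∑ t ∈ T, w s2 t * (starRingEnd ℂ) (w s1 t) := by
        refine Finset.sum_congr rfl fun t _ => ?_
        rw [map_mul, Complex.conj_conj, mul_comm]
      rw [e]; exact this
  have hdiag : ∀ s ∈ S, ‖∑ t ∈ T, w s t * (starRingEnd ℂ) (w s t)‖ ≤ A ^ 2 * K := by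
    intro s hs
    have hwb : ∀ t, ‖w s t‖ ≤ A := by
      intro t
      simp only [hw]
      split_ifs
      · rw [norm_mul]
        calc ‖x s‖ * ‖g (s * t)‖ ≤ A * 1 := by
              gcongr
              · exact hx s (hS s hs).2.2
              · exact hg _
          _ = A := mul_one _
      · simpa using hA
    refine (norm_sum_le _ _).trans ?_
    calc ∑ t ∈ T, ‖w s t * (starRingEnd ℂ) (w s t)‖ ≤ ∑ t ∈ T, A ^ 2 := Finset.sum_le_sum fun t _ => by
          rw [norm_mul, RCLike.norm_conj, ← sq]
          exact pow_le_pow_left₀ (norm_nonneg _) (hwb t) 2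
      _ = T.card * A ^ 2 := by simp
      _ ≤ K * A ^ 2 := by gcongr
      _ = _ := by ring
  have hScard : (S.card : ℝ) ≤ Q := by
    have : S ⊆ Finset.Ico S0 (S0 + Q) := fun s hs => Finset.mem_Ico.2 ⟨(hS s hs).1, (hS s hs).2.1⟩
    have := Finset.card_le_card this
    rw [Nat.card_Ico, Nat.add_sub_cancel_left] at this
    exact_mod_cast this
  have hw2 : ∑ t ∈ T, ‖∑ s ∈ S, w s t‖ ^ 2 ≤ A ^ 2 * (Q * K + Q ^ 2 * (I * √K)) := by
    refine (sum_normsq_le S T w).trans ?_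
    calc _ ≤ ∑ s1 ∈ S, ∑ s2 ∈ S, ((if s1 = s2 then A ^ 2 * K else 0) + A ^ 2 * (I * √K)) := by
          refine Finset.sum_le_sum fun s1 hs1 => Finset.sum_le_sum fun s2 hs2 => ?_
          have hnn : 0 ≤ A ^ 2 * (I * √K) := by positivity
          split_ifs with h
          · subst h; linarith [hdiag s1 hs1]
          · linarith [hoff s1 hs1 s2 hs2 h]
      _ = ∑ s1 ∈ S, (A ^ 2 * K + S.card * (A ^ 2 * (I * √K))) := by
          refine Finset.sum_congr rfl fun s1 hs1 => ?_
          rw [Finset.sum_add_distrib, Finset.sum_ite_eq, if_pos hs1]; simp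
      _ = S.card * (A ^ 2 * K) + S.card * (S.card * (A ^ 2 * (I * √K))) := by
          rw [Finset.sum_const, nsmul_eq_mul]; ring
      _ ≤ Q * (A ^ 2 * K) + Q * (Q * (A ^ 2 * (I * √K))) := by gcongr
      _ = _ := by ring
  exact mul_le_mul hy2 hw2 (Finset.sum_nonneg fun _ _ => by positivity) (by positivity)

lemma harmonic_sum_le (J : ℕ) : ∑ j ∈ Finset.Icc 1 J, (1 / (j:ℝ)) ≤ 1 + Real.log J := by
  have := harmonic_le_one_add_log J
  rw [harmonic_eq_sum_Icc] at this
  push_cast at this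
  simpa using this

lemma bilinear_short (g : ℕ → ℂ) (hg : ∀ n, ‖g n‖ ≤ 1) (N Q : ℕ) (hQ : 1 ≤ Q) (hN : 1 ≤ N) (I : ℝ) (hI : 0 ≤ I)
    (h2 : TypeII g N Q I)
    (x y : ℕ → ℂ) (A B : ℝ) (hA : 0 ≤ A) (hB : 0 ≤ B) (hx : ∀ n ≤ N, ‖x n‖ ≤ A) (hy : ∀ n ≤ N, ‖y n‖ ≤ B) :
    ‖∑ s ∈ Finset.Ioc Q (Nat.sqrt N), ∑ t ∈ Finset.Ico (N / (4 * s) + 1) (N / s + 1), x s * y t * g (s * t)‖ ≤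
      A * B * N * √(1 / Q + I / √(√N)) * (1 + Real.log N) := by
  set η := √(1 / (Q:ℝ) + I / √(√(N:ℝ))) with hη
  have hQ0 : (0:ℝ) < Q := by exact_mod_cast hQ
  have hN0 : (0:ℝ) < N := by exact_mod_cast hN
  have hmaps : ∀ s ∈ Finset.Ioc Q (Nat.sqrt N), s / Q ∈ Finset.Icc 1 N := by
    intro s hs
    rw [Finset.mem_Ioc] at hs
    rw [Finset.mem_Icc]
    refine ⟨(Nat.one_le_div_iff (by omega)).2 hs.1.le, (Nat.div_le_self _ _).trans (hs.2.trans (Nat.sqrt_le_self N))⟩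
  rw [← Finset.sum_fiberwise_of_maps_to hmaps]
  have hseg : ∀ j ∈ Finset.Icc 1 N, ‖∑ s ∈ Finset.Ioc Q (Nat.sqrt N) with s / Q = j, ∑ t ∈ Finset.Ico (N / (4 * s) + 1) (N / s + 1), x s * y t * g (s * t)‖
      ≤ A * B * N * η * (1 / (j:ℝ)) := by
    intro j hj
    rw [Finset.mem_Icc] at hj
    have hj0 : (0:ℝ) < j := by exact_mod_cast hj.1
    rcases Finset.eq_empty_or_nonempty ((Finset.Ioc Q (Nat.sqrt N)).filter (fun s => s / Q = j)) with he | ⟨s0, hs0⟩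
    · rw [he, Finset.sum_empty, norm_zero]; positivity
    rw [Finset.mem_filter, Finset.mem_Ioc] at hs0
    have hSle : Q * j ≤ Nat.sqrt N := by
      rw [← hs0.2]; exact (Nat.mul_div_le s0 Q).trans hs0.1.2
    have hseg := segment_bound g hg N Q (Q * j) (Nat.mul_pos hQ hj.1) (Nat.le_mul_of_pos_right Q hj.1)
      (hSle.trans (Nat.sqrt_le_self N)) I hI h2 ((Finset.Ioc Q (Nat.sqrt N)).filter (fun s => s / Q = j)) (by
        intro s hs
        rw [Finset.mem_filter, Finset.mem_Ioc] at hs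
        have e1 := Nat.mul_div_le s Q
        have e2 := Nat.lt_mul_div_succ s (show 0 < Q by omega)
        rw [hs.2] at e1 e2
        refine ⟨e1, by rw [mul_add, mul_one] at e2; exact e2, hs.1.2.trans (Nat.sqrt_le_self N)⟩) x y A B hA hB hx hy
    refine (pow_le_pow_iff_left₀ (norm_nonneg _) (by positivity) two_ne_zero).1 ?_
    refine hseg.trans ?_
    push_cast
    set K := (N:ℝ) / (Q * j) with hK
    have hK0 : 0 < K := by positivity
    have hKN : √(N:ℝ) ≤ K := by
      rw [hK, le_div_iff₀ (by positivity)]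
      have h5 : ((Q * j : ℕ) : ℝ) ≤ √(N:ℝ) := by
        apply Real.le_sqrt_of_sq_le
        have := Nat.sqrt_le' N
        have h6 : (Q * j) ^ 2 ≤ N := (Nat.pow_le_pow_left hSle 2).trans this
        exact_mod_cast h6
      push_cast at h5
      calc √(N:ℝ) * (Q * j) ≤ √N * √N := by gcongr
        _ = N := Real.mul_self_sqrt hN0.le
    have hη2 : η ^ 2 = 1 / (Q:ℝ) + I / √(√(N:ℝ)) := by rw [hη]; exact Real.sq_sqrt (by positivity)
    have hsN : 0 < √(√(N:ℝ)) := by positivity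
    have hIK : I / √K ≤ I / √(√(N:ℝ)) := by
      apply div_le_div_of_nonneg_left hI hsN (Real.sqrt_le_sqrt hKN)
    have hKK : √K * √K = K := Real.mul_self_sqrt hK0.le
    have hsK : 0 < √K := Real.sqrt_pos.2 hK0
    have e1 : B ^ 2 * K * (A ^ 2 * (Q * K + Q ^ 2 * (I * √K))) = (A * B * (Q * K)) ^ 2 * (1 / Q + I / √K) := by
      have : I * √K = I / √K * K := by
        rw [div_mul_eq_mul_div, eq_div_iff hsK.ne', mul_assoc, hKK]
      rw [this]; field_simp
    rw [e1]
    have e2 : Q * K = N * (1 / j) := by rw [hK]; field_simp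
    rw [e2]
    calc (A * B * (N * (1 / (j:ℝ)))) ^ 2 * (1 / Q + I / √K) ≤ (A * B * (N * (1 / (j:ℝ)))) ^ 2 * η ^ 2 := by
          rw [hη2]; gcongr
      _ = _ := by ring
  refine (norm_sum_le _ _).trans ((Finset.sum_le_sum hseg).trans ?_)
  rw [← Finset.mul_sum]
  exact mul_le_mul_of_nonneg_left (harmonic_sum_le N) (by positivity)

/-- general bilinear sum, both variables `> Q`. -/
lemma bilinear (g : ℕ → ℂ) (hg : ∀ n, ‖g n‖ ≤ 1) (N Q : ℕ) (hQ : 1 ≤ Q) (hN : 1 ≤ N) (I : ℝ) (hI : 0 ≤ I)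
    (h2 : TypeII g N Q I)
    (x y : ℕ → ℂ) (A B : ℝ) (hA : 0 ≤ A) (hB : 0 ≤ B) (hx : ∀ n ≤ N, ‖x n‖ ≤ A) (hy : ∀ n ≤ N, ‖y n‖ ≤ B)
    (hx0 : ∀ n ≤ Q, x n = 0) (hy0 : ∀ n ≤ Q, y n = 0) :
    ‖∑ s ∈ Finset.Icc 1 N, ∑ t ∈ Finset.Ico (N / (4 * s) + 1) (N / s + 1), x s * y t * g (s * t)‖ ≤
      2 * (A * B * N * √(1 / Q + I / √(√N)) * (1 + Real.log N)) := by
  -- indicator form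
  set P : ℕ → ℕ → Prop := fun s t => N < 4 * (s * t) ∧ s * t ≤ N with hP
  have hform : ∀ (U : Finset ℕ) (hU : U ⊆ Finset.Icc 1 N) (x y : ℕ → ℂ), ∑ s ∈ U, ∑ t ∈ Finset.Ico (N / (4 * s) + 1) (N / s + 1), x s * y t * g (s * t) =
      ∑ s ∈ U, ∑ t ∈ Finset.Icc 1 N, if P s t then x s * y t * g (s * t) else 0 := by
    intro U hU x y
    refine Finset.sum_congr rfl fun s hs => ?_
    have hs1 := (Finset.mem_Icc.1 (hU hs))
    rw [← Finset.sum_filter]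
    refine Finset.sum_congr ?_ fun _ _ => rfl
    ext t
    rw [mem_range_iff N s t hs1.1, Finset.mem_filter, Finset.mem_Icc]
    constructor
    · intro h
      refine ⟨⟨?_, ?_⟩, h⟩
      · rcases Nat.eq_zero_or_pos t with h0 | h0
        · subst h0; simp at h
        · exact h0
      · exact (Nat.le_mul_of_pos_left t hs1.1).trans h.2
    · exact fun h => h.2
  have hsub : Finset.Ioc Q (Nat.sqrt N) ⊆ Finset.Icc 1 N := by
    intro s hs
    rw [Finset.mem_Ioc] at hs
    rw [Finset.mem_Icc]
    exact ⟨by omega, hs.2.trans (Nat.sqrt_le_self N)⟩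
  have b1 := bilinear_short g hg N Q hQ hN I hI h2 x y A B hA hB hx hy
  have b2 := bilinear_short g hg N Q hQ hN I hI h2 y (fun n => if Nat.sqrt N < n then x n else 0) B A hB hA hy (by
    intro n hn
    split_ifs
    · exact hx n hn
    · simpa using hA)
  have hsplit : ∑ s ∈ Finset.Icc 1 N, ∑ t ∈ Finset.Ico (N / (4 * s) + 1) (N / s + 1), x s * y t * g (s * t) =
    (∑ s ∈ Finset.Ioc Q (Nat.sqrt N), ∑ t ∈ Finset.Ico (N / (4 * s) + 1) (N / s + 1), x s * y t * g (s * t)) +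
    ∑ s ∈ Finset.Ioc Q (Nat.sqrt N), ∑ t ∈ Finset.Ico (N / (4 * s) + 1) (N / s + 1), y s * (if Nat.sqrt N < t then x t else 0) * g (s * t) := by
    rw [hform _ (Finset.Subset.refl _) x y, hform _ hsub x y, hform _ hsub y (fun n => if Nat.sqrt N < n then x n else 0)]
    have hfull : ∀ (z : ℕ → ℕ → ℂ), (∀ s t, s ∉ Finset.Ioc Q (Nat.sqrt N) → s ∈ Finset.Icc 1 N → t ∈ Finset.Icc 1 N → z s t = 0) →
        ∑ s ∈ Finset.Ioc Q (Nat.sqrt N), ∑ t ∈ Finset.Icc 1 N, z s t = ∑ s ∈ Finset.Icc 1 N, ∑ t ∈ Finset.Icc 1 N, z s t := by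
      intro z hz
      refine Finset.sum_subset hsub fun s hs hs' => Finset.sum_eq_zero fun t ht => hz s t hs' hs ht
    have e1 : ∑ s ∈ Finset.Ioc Q (Nat.sqrt N), ∑ t ∈ Finset.Icc 1 N, (if P s t then x s * y t * g (s * t) else 0)
        = ∑ s ∈ Finset.Icc 1 N, ∑ t ∈ Finset.Icc 1 N, (if P s t ∧ s ≤ Nat.sqrt N then x s * y t * g (s * t) else 0) := by
      rw [← hfull]
      · refine Finset.sum_congr rfl fun s hs => Finset.sum_congr rfl fun t ht => ?_
        rw [Finset.mem_Ioc] at hs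
        simp [hs.2]
      · intro s t hs _ _
        rw [Finset.mem_Ioc, not_and_or] at hs
        rcases hs with h | h
        · rw [hx0 s (by omega)]; simp
        · simp [h]
    have e2 : ∑ s ∈ Finset.Ioc Q (Nat.sqrt N), ∑ t ∈ Finset.Icc 1 N, (if P s t then y s * (if Nat.sqrt N < t then x t else 0) * g (s * t) else 0)
        = ∑ s ∈ Finset.Icc 1 N, ∑ t ∈ Finset.Icc 1 N, (if P s t ∧ Nat.sqrt N < s then x s * y t * g (s * t) else 0) := by
      rw [hfull, Finset.sum_comm]
      · refine Finset.sum_congr rfl fun s hs => Finset.sum_congr rfl fun t ht => ?_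
        simp only [hP]
        rw [mul_comm t s]
        by_cases h1 : N < 4 * (s * t) ∧ s * t ≤ N <;> by_cases h3 : Nat.sqrt N < s <;> simp [h1, h3, mul_comm]
      · intro s t hs _ _
        rw [Finset.mem_Ioc, not_and_or] at hs
        rcases hs with h | h
        · rw [hy0 s (by omega)]; simp
        · by_cases h1 : P s t
          · rw [if_pos h1]
            by_cases h3 : Nat.sqrt N < t
            · exfalso
              have h4 : N < (Nat.sqrt N + 1) * (Nat.sqrt N + 1) := Nat.lt_succ_sqrt N
              have h5 : (Nat.sqrt N + 1) * (Nat.sqrt N + 1) ≤ s * t := Nat.mul_le_mul (by omega) (by omega)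
              have := h1.2
              omega
            · simp [h3]
          · rw [if_neg h1]
    rw [e1, e2, ← Finset.sum_add_distrib]
    refine Finset.sum_congr rfl fun s hs => ?_
    rw [← Finset.sum_add_distrib]
    refine Finset.sum_congr rfl fun t ht => ?_
    by_cases h1 : P s t <;> by_cases h3 : s ≤ Nat.sqrt N <;> simp [h1, h3, not_lt.2, not_le.1]
  rw [hsplit]
  refine (norm_add_le _ _).trans ?_
  have hcomm : B * A * N * √(1 / Q + I / √(√N)) * (1 + Real.log N) = A * B * N * √(1 / Q + I / √(√N)) * (1 + Real.log N) := by ring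
  rw [hcomm] at b2
  linarith

lemma sum_conv (N : ℕ) (F : ℕ → ℕ → ℂ) :
    ∑ n ∈ Finset.Ico (N / 4 + 1) (N + 1), ∑ x ∈ n.divisorsAntidiagonal, F x.1 x.2 =
      ∑ k ∈ Finset.Icc 1 N, ∑ l ∈ Finset.Ico (N / (4 * k) + 1) (N / k + 1), F k l := by
  rw [Finset.sum_sigma', Finset.sum_sigma']
  refine Finset.sum_bij' (fun x _ => ⟨x.2.1, x.2.2⟩) (fun x _ => ⟨x.1 * x.2, (x.1, x.2)⟩) ?_ ?_ ?_ ?_ ?_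
  · rintro ⟨n, k, l⟩ h
    simp only [Finset.mem_sigma, Nat.mem_divisorsAntidiagonal, Finset.mem_Icc] at h ⊢
    obtain ⟨h1, h2, h3⟩ := h
    have hk : 1 ≤ k := by
      rcases Nat.eq_zero_or_pos k with h | h
      · subst h; simp at h2; omega
      · exact h
    have hl : 1 ≤ l := by
      rcases Nat.eq_zero_or_pos l with h | h
      · subst h; simp at h2; omega
      · exact h
    rw [Finset.mem_Ico] at h1
    rw [mem_range_iff N k l hk, h2]
    refine ⟨⟨hk, ?_⟩, by omega, by omega⟩
    have := Nat.le_mul_of_pos_right k hl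
    omega
  · rintro ⟨k, l⟩ h
    simp only [Finset.mem_sigma, Nat.mem_divisorsAntidiagonal, Finset.mem_Icc] at h ⊢
    obtain ⟨h1, h2⟩ := h
    rw [mem_range_iff N k l h1.1] at h2
    rw [Finset.mem_Ico]
    refine ⟨⟨by omega, by omega⟩, trivial, ?_⟩
    intro h0
    rw [h0] at h2; omega
  · rintro ⟨n, k, l⟩ h
    simp only [Finset.mem_sigma, Nat.mem_divisorsAntidiagonal] at h
    obtain ⟨_, rfl, _⟩ := h
    rfl
  · rintro ⟨k, l⟩ h
    rfl
  · rintro ⟨n, k, l⟩ h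
    rfl

lemma abel_Ico (L : ℕ → ℂ) (G : ℕ → ℂ) (a b : ℕ) (hab : a ≤ b) :
    ∑ l ∈ Finset.Ico a b, L l * (G l - G (l + 1)) = L a * G a - L b * G b +
      ∑ j ∈ Finset.Ico a b, (L (j + 1) - L j) * G (j + 1) := by
  induction b, hab using Nat.le_induction with
  | base => simp
  | succ b hb ih =>
    rw [Finset.sum_Ico_succ_top hb, Finset.sum_Ico_succ_top hb, ih]; ring

lemma log_weight (g : ℕ → ℂ) (a b : ℕ) (ha : 1 ≤ a) (T : ℝ) (hT0 : 0 ≤ T)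
    (hT : ∀ a', a ≤ a' → ‖∑ l ∈ Finset.Ico a' b, g l‖ ≤ T) :
    ‖∑ l ∈ Finset.Ico a b, (Real.log l : ℂ) * g l‖ ≤ T * Real.log b := by
  rcases le_total b a with h | hab
  · rw [Finset.Ico_eq_empty_of_le h, Finset.sum_empty, norm_zero]
    exact mul_nonneg hT0 (Real.log_natCast_nonneg b)
  have h1 : ∑ l ∈ Finset.Ico a b, (Real.log l : ℂ) * g l = ∑ l ∈ Finset.Ico a b, (Real.log l : ℂ) *
      ((∑ j ∈ Finset.Ico l b, g j) - (∑ j ∈ Finset.Ico (l+1) b, g j)) := by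
    refine Finset.sum_congr rfl fun l hl => ?_
    rw [Finset.mem_Ico] at hl
    rw [Finset.sum_eq_sum_Ico_succ_bot hl.2]; ring
  rw [h1, abel_Ico (fun l => (Real.log l : ℂ)) (fun l => ∑ j ∈ Finset.Ico l b, g j) a b hab]
  simp only [Finset.Ico_self, Finset.sum_empty, mul_zero, sub_zero]
  have hstep : ∀ j ∈ Finset.Ico a b, ‖((Real.log ((j+1:ℕ):ℝ) : ℂ) - (Real.log j : ℂ)) * ∑ j ∈ Finset.Ico (j+1) b, g j‖ ≤
      (Real.log ((j+1:ℕ):ℝ) - Real.log j) * T := by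
    intro j hj
    rw [Finset.mem_Ico] at hj
    have hmono : Real.log j ≤ Real.log ((j+1:ℕ):ℝ) := by
      apply Real.log_le_log
      · exact_mod_cast (by omega : 0 < j)
      · push_cast; linarith
    rw [norm_mul, ← Complex.ofReal_sub, Complex.norm_real, Real.norm_of_nonneg (by linarith)]
    exact mul_le_mul_of_nonneg_left (hT _ (by omega)) (by linarith)
  refine (norm_add_le _ _).trans ?_
  have h2 := (norm_sum_le _ _).trans (Finset.sum_le_sum hstep)
  rw [← Finset.sum_mul, Finset.sum_Ico_sub (fun j : ℕ => Real.log (j:ℝ)) hab] at h2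
  have h3 : ‖(Real.log a : ℂ) * ∑ j ∈ Finset.Ico a b, g j‖ ≤ Real.log a * T := by
    rw [norm_mul, Complex.norm_real, Real.norm_of_nonneg (Real.log_natCast_nonneg a)]
    exact mul_le_mul_of_nonneg_left (hT _ le_rfl) (Real.log_natCast_nonneg a)
  linarith

open ArithmeticFunction in
lemma vaughan_identity (L1 L2 M1 M2 : ArithmeticFunction ℝ) (hL : L1 + L2 = vonMangoldt) (hM : M1 + M2 = ((moebius : ArithmeticFunction ℤ) : ArithmeticFunction ℝ)) :
    L2 = M1 * ArithmeticFunction.log - (M1 * L1) * ((zeta : ArithmeticFunction ℕ) : ArithmeticFunction ℝ) + L2 * (((zeta : ArithmeticFunction ℕ) : ArithmeticFunction ℝ) * M2) := by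
  have h1 : vonMangoldt * ((zeta : ArithmeticFunction ℕ) : ArithmeticFunction ℝ) = ArithmeticFunction.log := vonMangoldt_mul_zeta
  have h2 : ((moebius : ArithmeticFunction ℤ) : ArithmeticFunction ℝ) * ((zeta : ArithmeticFunction ℕ) : ArithmeticFunction ℝ) = 1 := coe_moebius_mul_coe_zeta
  rw [← hL] at h1
  rw [← hM] at h2
  rw [← h1]
  calc L2 = L2 * 1 := (mul_one _).symm
    _ = _ := by rw [← h2]; ring

/-- truncation -/
noncomputable def truncLe (f : ArithmeticFunction ℝ) (Q : ℕ) : ArithmeticFunction ℝ :=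
  ⟨fun n => if n ≤ Q then f n else 0, by simp⟩
noncomputable def truncGt (f : ArithmeticFunction ℝ) (Q : ℕ) : ArithmeticFunction ℝ :=
  ⟨fun n => if Q < n then f n else 0, by simp⟩

lemma truncLe_apply (f : ArithmeticFunction ℝ) (Q n : ℕ) : truncLe f Q n = if n ≤ Q then f n else 0 := rfl
lemma truncGt_apply (f : ArithmeticFunction ℝ) (Q n : ℕ) : truncGt f Q n = if Q < n then f n else 0 := rfl
lemma trunc_add (f : ArithmeticFunction ℝ) (Q : ℕ) : truncLe f Q + truncGt f Q = f := by
  ext n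
  rw [ArithmeticFunction.add_apply, truncLe_apply, truncGt_apply]
  by_cases h : n ≤ Q
  · rw [if_pos h, if_neg (not_lt.2 h), add_zero]
  · rw [if_neg h, if_pos (not_le.1 h), zero_add]

lemma sum_conv_af (N : ℕ) (f h : ArithmeticFunction ℝ) (g : ℕ → ℂ) :
    ∑ n ∈ Finset.Ico (N / 4 + 1) (N + 1), (((f * h) n : ℝ) : ℂ) * g n =
      ∑ k ∈ Finset.Icc 1 N, ∑ l ∈ Finset.Ico (N / (4 * k) + 1) (N / k + 1), (f k : ℂ) * (h l : ℂ) * g (k * l) := by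
  rw [← sum_conv N (fun k l => (f k : ℂ) * (h l : ℂ) * g (k * l))]
  refine Finset.sum_congr rfl fun n _ => ?_
  rw [ArithmeticFunction.mul_apply]
  push_cast
  rw [Finset.sum_mul]
  refine Finset.sum_congr rfl fun x hx => ?_
  rw [(Nat.mem_divisorsAntidiagonal.1 hx).1]

lemma sum_norm_le_of_supp (N Q : ℕ) (L T : ℝ) (hL : 0 ≤ L) (hT : 0 ≤ T) (c : ℕ → ℝ) (w : ℕ → ℂ)
    (hc : ∀ k ∈ Finset.Icc 1 N, |c k| ≤ if k ≤ Q then L else 0) (hw : ∀ k ∈ Finset.Icc 1 N, ‖w k‖ ≤ T) :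
    ‖∑ k ∈ Finset.Icc 1 N, (c k : ℂ) * w k‖ ≤ Q * (L * T) := by
  refine (norm_sum_le _ _).trans ?_
  calc ∑ k ∈ Finset.Icc 1 N, ‖(c k : ℂ) * w k‖ ≤ ∑ k ∈ Finset.Icc 1 N, if k ≤ Q then L * T else 0 := by
        refine Finset.sum_le_sum fun k hk => ?_
        rw [norm_mul, Complex.norm_real, Real.norm_eq_abs]
        have h1 := hc k hk
        have h2 := hw k hk
        split_ifs at h1 ⊢ with h
        · exact mul_le_mul h1 h2 (norm_nonneg _) hL
        · have : |c k| = 0 := le_antisymm h1 (abs_nonneg _)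
          rw [this, zero_mul]
    _ = ((Finset.Icc 1 N).filter (fun k => k ≤ Q)).card * (L * T) := by
        rw [← Finset.sum_filter, Finset.sum_const, nsmul_eq_mul]
    _ ≤ Q * (L * T) := by
        have : (Finset.Icc 1 N).filter (fun k => k ≤ Q) ⊆ Finset.Icc 1 Q := by
          intro k hk
          rw [Finset.mem_filter, Finset.mem_Icc] at hk
          rw [Finset.mem_Icc]; omega
        have h := Finset.card_le_card this
        rw [Nat.card_Icc, Nat.add_sub_cancel] at h
        have h' : (((Finset.Icc 1 N).filter (fun k => k ≤ Q)).card : ℝ) ≤ Q := by exact_mod_cast h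
        gcongr

open ArithmeticFunction in
lemma vaughan (g : ℕ → ℂ) (hg : ∀ n, ‖g n‖ ≤ 1) (N Q : ℕ) (hQ : 1 ≤ Q) (hQN : 4 * Q ≤ N) (I T B : ℝ) (hI : 0 ≤ I) (hT : 0 ≤ T)
    (h1 : ∀ k, 1 ≤ k → k ≤ N → ∀ a b, N ≤ 4 * (k * a) → k * b ≤ 2 * N → ‖∑ l ∈ Finset.Ico a b, g (k * l)‖ ≤ T)
    (h2 : TypeII g N Q I)
    (hB : ∀ n, 1 ≤ n → n ≤ N → (n.divisors.card : ℝ) ≤ B) :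
    ‖∑ n ∈ Finset.Ico (N / 4 + 1) (N + 1), (vonMangoldt n : ℂ) * g n‖ ≤
      2 * (Q:ℝ) ^ 2 * T * (1 + Real.log N) + 2 * (Real.log N * B * N * √(1 / Q + I / √(√N)) * (1 + Real.log N)) := by
  have hN1 : 1 ≤ N := by omega
  have hN0 : (0:ℝ) < N := by exact_mod_cast hN1
  have hlogN : 0 ≤ Real.log N := Real.log_natCast_nonneg N
  have hlogle : ∀ n : ℕ, 1 ≤ n → n ≤ N → Real.log n ≤ Real.log N := fun n hn hnN =>
    Real.log_le_log (by exact_mod_cast hn) (by exact_mod_cast hnN)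
  have hB0 : 0 ≤ B := le_trans (by positivity) (hB 1 le_rfl hN1)
  set L1 := truncLe vonMangoldt Q with hL1
  set L2 := truncGt vonMangoldt Q with hL2
  set M1 := truncLe ((moebius : ArithmeticFunction ℤ) : ArithmeticFunction ℝ) Q with hM1
  set M2 := truncGt ((moebius : ArithmeticFunction ℤ) : ArithmeticFunction ℝ) Q with hM2
  set Z := ((zeta : ArithmeticFunction ℕ) : ArithmeticFunction ℝ) with hZ
  have hid := vaughan_identity L1 L2 M1 M2 (trunc_add _ _) (trunc_add _ _)
  have hmob : ∀ n, |((moebius : ArithmeticFunction ℤ) : ArithmeticFunction ℝ) n| ≤ 1 := by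
    intro n
    rw [ArithmeticFunction.intCoe_apply]
    exact_mod_cast (abs_moebius_le_one (n := n))
  have hM1b : ∀ n, |M1 n| ≤ if n ≤ Q then 1 else 0 := by
    intro n
    rw [hM1, truncLe_apply]
    split_ifs
    · exact hmob n
    · simp
  have hM2b : ∀ n, |M2 n| ≤ if Q < n then 1 else 0 := by
    intro n
    rw [hM2, truncGt_apply]
    split_ifs
    · exact hmob n
    · simp
  have hL1b : ∀ n, 0 ≤ L1 n ∧ L1 n ≤ vonMangoldt n := by
    intro n
    rw [hL1, truncLe_apply]
    split_ifs
    · exact ⟨vonMangoldt_nonneg, le_rfl⟩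
    · exact ⟨le_rfl, vonMangoldt_nonneg⟩
  have hZb : ∀ n, n ≠ 0 → Z n = 1 := by
    intro n hn
    rw [hZ, natCoe_apply, zeta_apply_ne hn]; simp
  -- the split
  have hsum : ∑ n ∈ Finset.Ico (N / 4 + 1) (N + 1), (vonMangoldt n : ℂ) * g n =
      (∑ n ∈ Finset.Ico (N / 4 + 1) (N + 1), (((M1 * ArithmeticFunction.log) n : ℝ) : ℂ) * g n)
      - (∑ n ∈ Finset.Ico (N / 4 + 1) (N + 1), ((((M1 * L1) * Z) n : ℝ) : ℂ) * g n)
      + ∑ n ∈ Finset.Ico (N / 4 + 1) (N + 1), (((L2 * (Z * M2)) n : ℝ) : ℂ) * g n := by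
    rw [← Finset.sum_sub_distrib, ← Finset.sum_add_distrib]
    refine Finset.sum_congr rfl fun n hn => ?_
    rw [Finset.mem_Ico] at hn
    have e1 : vonMangoldt n = L2 n := by
      rw [hL2, truncGt_apply, if_pos (by omega)]
    have e2 : L2 n = (M1 * ArithmeticFunction.log) n - ((M1 * L1) * Z) n + (L2 * (Z * M2)) n := by
      conv_lhs => rw [hid]
      rw [ArithmeticFunction.add_apply, sub_eq_add_neg, ArithmeticFunction.add_apply, ArithmeticFunction.neg_apply, sub_eq_add_neg]
    rw [e1, e2]
    push_cast; ring
  have hrng : ∀ k ∈ Finset.Icc 1 N, 1 ≤ k ∧ k ≤ N ∧ N ≤ 4 * (k * (N / (4 * k) + 1)) ∧ k * (N / k + 1) ≤ 2 * N := by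
    intro k hk
    rw [Finset.mem_Icc] at hk
    refine ⟨hk.1, hk.2, ?_, ?_⟩
    · have := (Nat.lt_mul_div_succ N (show 0 < 4 * k by omega)).le
      calc N ≤ 4 * k * (N / (4 * k) + 1) := this
        _ = _ := by ring
    · have := Nat.mul_div_le N k
      calc k * (N / k + 1) = k * (N / k) + k := by ring
        _ ≤ 2 * N := by omega
  -- first
  have b1 : ‖∑ n ∈ Finset.Ico (N / 4 + 1) (N + 1), (((M1 * ArithmeticFunction.log) n : ℝ) : ℂ) * g n‖ ≤ Q * (1 * (T * (1 + Real.log N))) := by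
    rw [sum_conv_af]
    have : ∀ k ∈ Finset.Icc 1 N, ∑ l ∈ Finset.Ico (N / (4 * k) + 1) (N / k + 1), (M1 k : ℂ) * ((ArithmeticFunction.log l : ℝ) : ℂ) * g (k * l)
        = (M1 k : ℂ) * ∑ l ∈ Finset.Ico (N / (4 * k) + 1) (N / k + 1), (Real.log l : ℂ) * g (k * l) := by
      intro k _
      rw [Finset.mul_sum]
      refine Finset.sum_congr rfl fun l _ => ?_
      rw [ArithmeticFunction.log_apply, mul_assoc]
    rw [Finset.sum_congr rfl this]
    refine sum_norm_le_of_supp N Q 1 _ zero_le_one (by positivity) _ _ (fun k _ => hM1b k) ?_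
    intro k hk
    obtain ⟨hk1, hkN, ha, hb⟩ := hrng k hk
    refine (log_weight (fun l => g (k * l)) _ _ (Nat.succ_pos _) T hT ?_).trans ?_
    · intro a' ha'
      refine h1 k hk1 hkN a' _ (ha.trans ?_) hb
      gcongr
    · refine mul_le_mul_of_nonneg_left ?_ hT
      have hb2 : ((N / k + 1 : ℕ) : ℝ) ≤ 2 * N := by
        have : N / k ≤ N := Nat.div_le_self _ _
        have : N / k + 1 ≤ 2 * N := by omega
        exact_mod_cast this
      calc Real.log ((N / k + 1 : ℕ) : ℝ) ≤ Real.log (2 * N) := Real.log_le_log (by positivity) hb2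
        _ = Real.log 2 + Real.log N := Real.log_mul (by norm_num) hN0.ne'
        _ ≤ _ := by linarith [Real.log_two_lt_d9]
  have hcb : ∀ k ∈ Finset.Icc 1 N, |(M1 * L1) k| ≤ if k ≤ Q ^ 2 then Real.log N else 0 := by
    intro k hk
    rw [Finset.mem_Icc] at hk
    rw [ArithmeticFunction.mul_apply]
    have : ∀ x ∈ k.divisorsAntidiagonal, |M1 x.1 * L1 x.2| ≤ if k ≤ Q ^ 2 then vonMangoldt x.2 else 0 := by
      intro x hx
      have hxk := (Nat.mem_divisorsAntidiagonal.1 hx).1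
      split_ifs with h
      · rw [abs_mul, abs_of_nonneg (hL1b _).1]
        have : |M1 x.1| ≤ 1 := (hM1b x.1).trans (by split_ifs <;> norm_num)
        calc |M1 x.1| * L1 x.2 ≤ 1 * vonMangoldt x.2 := mul_le_mul this (hL1b _).2 (hL1b _).1 zero_le_one
          _ = _ := one_mul _
      · by_cases h3 : x.1 ≤ Q
        · have h4 : ¬ x.2 ≤ Q := by
            intro h4
            have := Nat.mul_le_mul h3 h4
            rw [hxk, ← sq] at this
            exact h this
          rw [hL1, truncLe_apply _ _ x.2, if_neg h4]; simp
        · rw [hM1, truncLe_apply _ _ x.1, if_neg h3]; simp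
    refine (Finset.abs_sum_le_sum_abs _ _).trans ((Finset.sum_le_sum this).trans ?_)
    split_ifs
    · rw [Nat.sum_divisorsAntidiagonal' (f := fun _ d => vonMangoldt d), vonMangoldt_sum]
      exact hlogle k hk.1 hk.2
    · simp
  have b2 : ‖∑ n ∈ Finset.Ico (N / 4 + 1) (N + 1), ((((M1 * L1) * Z) n : ℝ) : ℂ) * g n‖ ≤ (Q ^ 2 : ℕ) * (Real.log N * T) := by
    rw [sum_conv_af]
    have : ∀ k ∈ Finset.Icc 1 N, ∑ l ∈ Finset.Ico (N / (4 * k) + 1) (N / k + 1), ((M1 * L1) k : ℂ) * ((Z l : ℝ) : ℂ) * g (k * l)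
        = ((M1 * L1) k : ℂ) * ∑ l ∈ Finset.Ico (N / (4 * k) + 1) (N / k + 1), g (k * l) := by
      intro k _
      rw [Finset.mul_sum]
      refine Finset.sum_congr rfl fun l hl => ?_
      rw [Finset.mem_Ico] at hl
      rw [hZb l (Nat.pos_iff_ne_zero.1 ((Nat.succ_pos _).trans_le hl.1))]; simp
    rw [Finset.sum_congr rfl this]
    refine sum_norm_le_of_supp N (Q ^ 2) (Real.log N) T hlogN hT _ _ hcb ?_
    intro k hk
    obtain ⟨hk1, hkN, ha, hb⟩ := hrng k hk
    exact h1 k hk1 hkN _ _ ha hb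
  have b3 : ‖∑ n ∈ Finset.Ico (N / 4 + 1) (N + 1), (((L2 * (Z * M2)) n : ℝ) : ℂ) * g n‖ ≤ 2 * (Real.log N * B * N * √(1 / Q + I / √(√N)) * (1 + Real.log N)) := by
    rw [sum_conv_af]
    refine bilinear g hg N Q hQ hN1 I hI h2 (fun n => (L2 n : ℂ)) (fun n => ((Z * M2) n : ℂ)) _ B hlogN hB0 ?_ ?_ ?_ ?_
    · intro n hn
      rw [Complex.norm_real, Real.norm_eq_abs, hL2, truncGt_apply]
      split_ifs with h
      · rw [abs_of_nonneg vonMangoldt_nonneg]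
        exact vonMangoldt_le_log.trans (hlogle n (by omega) hn)
      · simpa using hlogN
    · intro n hn
      rw [Complex.norm_real, Real.norm_eq_abs]
      rcases Nat.eq_zero_or_pos n with h0 | h0
      · subst h0; simpa using hB0
      refine le_trans ?_ (hB n h0 hn)
      rw [ArithmeticFunction.mul_apply]
      refine (Finset.abs_sum_le_sum_abs _ _).trans ?_
      calc ∑ x ∈ n.divisorsAntidiagonal, |Z x.1 * M2 x.2| ≤ ∑ x ∈ n.divisorsAntidiagonal, (1:ℝ) := by
            refine Finset.sum_le_sum fun x hx => ?_
            have hx1 : x.1 ≠ 0 := fun h => by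
              have := (Nat.mem_divisorsAntidiagonal.1 hx).1
              rw [h, zero_mul] at this; omega
            rw [hZb _ hx1, one_mul]
            exact (hM2b x.2).trans (by split_ifs <;> norm_num)
        _ = (n.divisors.card : ℝ) := by
            rw [Nat.sum_divisorsAntidiagonal (f := fun _ _ => (1:ℝ))]; simp
    · intro n hn
      simp only [hL2]
      rw [truncGt_apply, if_neg (not_lt.2 hn)]; simp
    · intro n hn
      have : (Z * M2) n = 0 := by
        rw [ArithmeticFunction.mul_apply]
        refine Finset.sum_eq_zero fun x hx => ?_
        have hxk := (Nat.mem_divisorsAntidiagonal.1 hx)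
        have : x.2 ≤ n := Nat.le_of_dvd (by omega) ⟨x.1, by rw [← hxk.1, mul_comm]⟩
        rw [hM2, truncGt_apply, if_neg (by omega), mul_zero]
      simp only [this]; simp
  rw [hsum]
  refine (norm_add_le _ _).trans (add_le_add ((norm_sub_le _ _).trans ?_) b3)
  have hQ1 : (1:ℝ) ≤ Q := by exact_mod_cast hQ
  have hQQ : (Q:ℝ) ≤ Q ^ 2 := by nlinarith
  have e1 : (Q:ℝ) * (1 * (T * (1 + Real.log N))) ≤ (Q:ℝ) ^ 2 * (T * (1 + Real.log N)) := by
    rw [one_mul]; gcongr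
  have e2 : ((Q ^ 2 : ℕ) : ℝ) * (Real.log N * T) ≤ (Q:ℝ) ^ 2 * (T * (1 + Real.log N)) := by
    push_cast
    have : Real.log N * T ≤ T * (1 + Real.log N) := by nlinarith
    gcongr
  linarith

lemma sqrt_le_of_rpow {x w p : ℝ} (hx : 0 < x) (h : x ^ (2 * p) ≤ w) : x ^ p ≤ √w := by
  apply Real.le_sqrt_of_sq_le
  rw [← Real.rpow_natCast, ← Real.rpow_mul hx.le]
  convert h using 2; push_cast; ring

lemma T_bound {N w C1 : ℝ} (hN : 1 ≤ N) (hC : 1 ≤ C1) (h1 : N ^ (15/16:ℝ) ≤ w) (h2 : w ≤ C1 * N) :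
    √w + N / √w ≤ 2 * C1 * N ^ (17/32:ℝ) := by
  have hN0 : 0 < N := by linarith
  have a1 : N ^ (15/32:ℝ) ≤ √w := sqrt_le_of_rpow hN0 (by convert h1 using 2; norm_num)
  have a0 : 0 < N ^ (15/32:ℝ) := Real.rpow_pos_of_pos hN0 _
  have a2 : N / √w ≤ N ^ (17/32:ℝ) := by
    rw [div_le_iff₀ (by linarith)]
    calc N = N ^ (17/32:ℝ) * N ^ (15/32:ℝ) := by rw [← Real.rpow_add hN0]; norm_num
      _ ≤ _ := by gcongr
  have a3 : √w ≤ C1 * N ^ (17/32:ℝ) := by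
    rw [Real.sqrt_le_left (by positivity)]
    calc w ≤ C1 * N := h2
      _ ≤ C1 ^ 2 * N ^ (17/16:ℝ) := by
          have : N ≤ N ^ (17/16:ℝ) := by
            conv_lhs => rw [← Real.rpow_one N]
            exact Real.rpow_le_rpow_of_exponent_le hN (by norm_num)
          have h3 : C1 ≤ C1 ^ 2 := by nlinarith
          gcongr
      _ = _ := by
          rw [mul_pow, ← Real.rpow_natCast (N ^ (17/32:ℝ)), ← Real.rpow_mul hN0.le]; norm_num
  have a4 : 0 < N ^ (17/32:ℝ) := Real.rpow_pos_of_pos hN0 _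
  nlinarith

lemma one_add_log_le {x ε : ℝ} (hx : 1 ≤ x) (hε : 0 < ε) : 1 + Real.log x ≤ (1 + 1 / ε) * x ^ ε := by
  have h1 := Real.log_le_rpow_div (by linarith : 0 ≤ x) hε
  have h2 : 1 ≤ x ^ ε := Real.one_le_rpow hx hε.le
  have : (1 + 1 / ε) * x ^ ε = x ^ ε + x ^ ε / ε := by ring
  linarith

namespace Reg
variable {S : Set ℕ} {γ' : ℝ} {φ φ1 H H1 : ℝ → ℝ} {Y0 : ℝ}

lemma mH_bounds (R : Reg S γ' φ φ1 H H1 Y0) (hγ : 15/16 ≤ γ') {N m C1 : ℝ} (hN : Y0 ≤ N) (hm : 1 ≤ m) (hmC : m * φ N ≤ C1 * N) :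
    N ^ (15/16:ℝ) ≤ m * H N ∧ m * H N ≤ C1 * N := by
  have hY := R.one_le_Y0
  have h1 := R.growth N hN
  have h2 := R.H_pos N hN
  constructor
  · calc N ^ (15/16:ℝ) ≤ N ^ γ' := Real.rpow_le_rpow_of_exponent_le (by linarith) hγ
      _ ≤ H N := h1
      _ ≤ m * H N := by nlinarith
  · refine le_trans ?_ hmC
    have := R.H_le N hN
    gcongr

lemma expsum_T (R : Reg S γ' φ φ1 H H1 Y0) (hγ : 15/16 ≤ γ') {N C1 : ℝ} (hC : 1 ≤ C1) (hN : 4 * Y0 ≤ N) (m θ : ℝ) (hm : 1 ≤ m)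
    (hmC : m * φ N ≤ C1 * N) (k : ℕ) (hk : 1 ≤ k) (hkN : (k : ℝ) ≤ N) (a b : ℕ)
    (ha : N ≤ 4 * (k * a)) (hb : (k : ℝ) * b ≤ 2 * N) :
    ‖∑ l ∈ Finset.Ico a b, e (m * φ (k * l) + θ * l)‖ ≤ 49152 * C1 * N ^ (17/32:ℝ) := by
  have hY := R.one_le_Y0
  refine (R.expsum1 hN k hk hkN m θ (by linarith) a b ha hb).trans ?_
  have := R.mH_bounds hγ (by linarith : Y0 ≤ N) hm hmC
  have := T_bound (by linarith) hC this.1 this.2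
  linarith

lemma expsum_I (R : Reg S γ' φ φ1 H H1 Y0) (hγ : 15/16 ≤ γ') {N C1 : ℝ} (hC : 1 ≤ C1) (hN : 4 * Y0 ≤ N) (m : ℝ) (hm : 1 ≤ m)
    (hmC : m * φ N ≤ C1 * N)
    (s1 s2 : ℕ) (hs : s1 < s2) (hs1 : 1 ≤ s1) (hsN : (s2 : ℝ) ≤ N) (hss : (s2:ℝ) - s1 ≤ N ^ (1/8:ℝ)) (K : ℝ) (hK : 1 ≤ K) (a b : ℕ)
    (ha : N ≤ 4 * (s1 * a)) (hb : (s2 : ℝ) * b ≤ 2 * N) (haK : K / 8 ≤ a) (hbK : b ≤ 2 * K) :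
    ‖∑ t ∈ Finset.Ico a b, e (m * φ (s1 * t) - m * φ (s2 * t))‖ ≤ 2 ^ 29 * C1 * N ^ (1/16:ℝ) * √K := by
  have hY := R.one_le_Y0
  have hN1 : 1 ≤ N := by linarith
  have hN0 : 0 < N := by linarith
  refine (R.expsum2 hN s1 s2 hs hs1 hsN m K (by linarith) hK a b ha hb haK hbK).trans ?_
  obtain ⟨h1, h2⟩ := R.mH_bounds hγ (by linarith : Y0 ≤ N) hm hmC
  set w := m * H N with hw
  have hsK : 0 < √K := Real.sqrt_pos.2 (by linarith)
  have hp : 0 < N ^ (1/16:ℝ) := Real.rpow_pos_of_pos hN0 _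
  have hss0 : (0:ℝ) ≤ (s2:ℝ) - s1 := by
    have : (s1:ℝ) < s2 := by exact_mod_cast hs
    linarith
  have hwN : w / N ≤ C1 := by rw [div_le_iff₀ hN0]; exact h2
  have hwN2 : N ^ (2 * (-1/32:ℝ)) ≤ w / N := by
    rw [le_div_iff₀ hN0]
    calc N ^ (2 * (-1/32:ℝ)) * N = N ^ (15/16:ℝ) := by
          conv_lhs => rw [← Real.rpow_add_one hN0.ne']
          norm_num
      _ ≤ w := h1
  have b1 : √(((s2:ℝ) - s1) * (w / N)) ≤ C1 * N ^ (1/16:ℝ) := by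
    rw [Real.sqrt_le_left (by positivity)]
    calc ((s2:ℝ) - s1) * (w / N) ≤ N ^ (1/8:ℝ) * C1 := mul_le_mul hss hwN (le_trans (Real.rpow_nonneg hN0.le _) hwN2) (by positivity)
      _ ≤ N ^ (1/8:ℝ) * C1 ^ 2 := by
          have h3 : C1 ≤ C1 ^ 2 := by nlinarith
          gcongr
      _ = _ := by
          rw [mul_pow, ← Real.rpow_natCast (N ^ (1/16:ℝ)), ← Real.rpow_mul hN0.le]; norm_num [mul_comm]
  have b2 : √K / √(w / N) ≤ N ^ (1/16:ℝ) * √K := by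
    have h3 := sqrt_le_of_rpow hN0 hwN2
    have h4 : 0 < N ^ (-1/32:ℝ) := Real.rpow_pos_of_pos hN0 _
    rw [div_le_iff₀ (by linarith)]
    have h5 : 1 ≤ N ^ (1/16:ℝ) * √(w / N) := by
      calc (1:ℝ) ≤ N ^ (1/32:ℝ) := Real.one_le_rpow hN1 (by norm_num)
        _ = N ^ (1/16:ℝ) * N ^ (-1/32:ℝ) := by rw [← Real.rpow_add hN0]; norm_num
        _ ≤ _ := by gcongr
    nlinarith
  calc 2 ^ 28 * (√K * √(((s2:ℝ) - s1) * (w / N)) + √K / √(w / N)) ≤ 2 ^ 28 * (√K * (C1 * N ^ (1/16:ℝ)) + N ^ (1/16:ℝ) * √K) := by gcongr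
    _ ≤ 2 ^ 28 * (√K * (C1 * N ^ (1/16:ℝ)) + C1 * N ^ (1/16:ℝ) * √K) := by
        have : 1 * N ^ (1/16:ℝ) ≤ C1 * N ^ (1/16:ℝ) := by gcongr
        rw [one_mul] at this
        gcongr
    _ = _ := by ring

lemma mangoldt_sum (R : Reg S γ' φ φ1 H H1 Y0) (hγ : 15/16 ≤ γ') {C1 : ℝ} (hC : 1 ≤ C1) {ε : ℝ} (hε : 0 < ε) :
    ∃ C : ℝ, 0 < C ∧ ∃ N0 : ℕ, ∀ N : ℕ, N0 ≤ N → ∀ m : ℕ, 1 ≤ m → m * φ N ≤ C1 * N →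
      ‖∑ n ∈ Finset.Ico (N / 4 + 1) (N + 1), (ArithmeticFunction.vonMangoldt n : ℂ) * e (m * φ n)‖ ≤ C * (N:ℝ) ^ (15/16 + ε) := by
  have hY := R.one_le_Y0
  obtain ⟨Cd, hCd1, hCd⟩ := divisor_bound (ε / 3) (by positivity)
  set D := 1 + 1 / (ε / 3) with hD
  have hD0 : 0 < D := by positivity
  refine ⟨2 * (49152 * C1) * D + 2 * (D * Cd * √(2 + 2 ^ 29 * C1) * D), by positivity, max 16 ⌈4 * Y0⌉₊, ?_⟩
  intro N hN m hm hmC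
  have hN16 : 16 ≤ N := (le_max_left _ _).trans hN
  have hNY : 4 * Y0 ≤ N := (Nat.le_ceil _).trans (by exact_mod_cast (le_max_right _ _).trans hN)
  have hN1 : (1:ℝ) ≤ N := by exact_mod_cast (by omega : 1 ≤ N)
  have hN0 : (0:ℝ) < N := by linarith
  have hm1 : (1:ℝ) ≤ m := by exact_mod_cast hm
  obtain ⟨x, hx⟩ : ∃ x : ℝ, x = (N:ℝ) := ⟨_, rfl⟩
  rw [← hx] at hN1 hN0 hNY hmC ⊢
  set Q := ⌊x ^ (1/8:ℝ)⌋₊ with hQ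
  have hp8 : 1 ≤ x ^ (1/8:ℝ) := Real.one_le_rpow hN1 (by norm_num)
  have hQ1 : 1 ≤ Q := Nat.le_floor (by simpa using hp8)
  have hQle : (Q:ℝ) ≤ x ^ (1/8:ℝ) := Nat.floor_le (by linarith)
  have hQ1' : (1:ℝ) ≤ Q := by exact_mod_cast hQ1
  have hQge : x ^ (1/8:ℝ) ≤ 2 * Q := by
    have := Nat.lt_floor_add_one (x ^ (1/8:ℝ)); rw [← hQ] at this; linarith
  have hQN : 4 * Q ≤ N := by
    have h1 : (Q:ℝ) ≤ x ^ (1/2:ℝ) := hQle.trans (Real.rpow_le_rpow_of_exponent_le hN1 (by norm_num))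
    rw [← Real.sqrt_eq_rpow] at h1
    have h2 : (4:ℝ) ≤ √x := by
      apply Real.le_sqrt_of_sq_le
      have : (16:ℝ) ≤ x := by rw [hx]; exact_mod_cast hN16
      linarith
    have h3 : √x * √x = x := Real.mul_self_sqrt hN0.le
    have : (4:ℝ) * Q ≤ N := by rw [← hx]; nlinarith
    exact_mod_cast this
  have hT0 : 0 ≤ 49152 * C1 * x ^ (17/32:ℝ) := by positivity
  have hI0 : 0 ≤ 2 ^ 29 * C1 * x ^ (1/16:ℝ) := by positivity
  have hv := vaughan (fun n => e (m * φ n)) (fun n => (norm_e _).le) N Q hQ1 hQN (2 ^ 29 * C1 * x ^ (1/16:ℝ)) (49152 * C1 * x ^ (17/32:ℝ)) (Cd * x ^ (ε/3)) hI0 hT0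
    (by
      intro k hk hkN a b ha hb
      have := R.expsum_T hγ hC hNY m 0 hm1 hmC k hk (by rw [hx]; exact_mod_cast hkN) a b (by rw [hx]; exact_mod_cast ha) (by rw [hx]; exact_mod_cast hb)
      simpa using this)
    (by
      intro s1 s2 hs1 hs hsN hss K hK a b ha hb haK hbK
      have h5 : (s2:ℝ) - s1 ≤ x ^ (1/8:ℝ) := by
        have : (s2:ℝ) < s1 + Q := by exact_mod_cast hss
        linarith
      have := R.expsum_I hγ hC hNY m hm1 hmC s1 s2 hs hs1 (by rw [hx]; exact_mod_cast hsN) h5 K hK a b (by rw [hx]; exact_mod_cast ha) (by rw [hx]; exact_mod_cast hb) haK hbK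
      simp only [e_sub] at this
      simpa using this)
    (by
      intro n hn hnN
      refine (hCd n hn).trans ?_
      have : (n:ℝ) ≤ x := by rw [hx]; exact_mod_cast hnN
      gcongr)
  rw [← hx] at hv
  refine hv.trans ?_
  have hlog := one_add_log_le hN1 (by positivity : 0 < ε / 3)
  rw [← hD] at hlog
  have hlog0 : 0 ≤ Real.log x := Real.log_nonneg hN1
  have hpε : 0 < x ^ (ε/3) := Real.rpow_pos_of_pos hN0 _
  have t1 : 2 * (Q:ℝ) ^ 2 * (49152 * C1 * x ^ (17/32:ℝ)) * (1 + Real.log x) ≤ 2 * (49152 * C1) * D * x ^ (15/16 + ε) := by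
    calc 2 * (Q:ℝ) ^ 2 * (49152 * C1 * x ^ (17/32:ℝ)) * (1 + Real.log x)
        ≤ 2 * (x ^ (1/8:ℝ)) ^ 2 * (49152 * C1 * x ^ (17/32:ℝ)) * (D * x ^ (ε/3)) := by gcongr
      _ = 2 * (49152 * C1) * D * (x ^ (1/4 + 17/32 + ε/3 : ℝ)) := by
          rw [Real.rpow_add hN0, Real.rpow_add hN0, ← Real.rpow_natCast (x ^ (1/8:ℝ)), ← Real.rpow_mul hN0.le]
          norm_num; ring
      _ ≤ _ := by
          refine mul_le_mul_of_nonneg_left (Real.rpow_le_rpow_of_exponent_le hN1 (by linarith)) (by positivity)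
  have hsq : √(1 / (Q:ℝ) + 2 ^ 29 * C1 * x ^ (1/16:ℝ) / √(√x)) ≤ √(2 + 2 ^ 29 * C1) * x ^ (-1/16:ℝ) := by
    have e1 : x ^ (-1/16:ℝ) = √(x ^ (-1/8:ℝ)) := by
      rw [Real.sqrt_eq_rpow, ← Real.rpow_mul hN0.le]; norm_num
    rw [e1, ← Real.sqrt_mul (by positivity)]
    apply Real.sqrt_le_sqrt
    have e2 : √(√x) = x ^ (1/4:ℝ) := by
      rw [Real.sqrt_eq_rpow, Real.sqrt_eq_rpow, ← Real.rpow_mul hN0.le]; norm_num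
    have e3 : 1 / (Q:ℝ) ≤ 2 * x ^ (-1/8:ℝ) := by
      rw [div_le_iff₀ (by linarith)]
      calc (1:ℝ) = x ^ (-1/8:ℝ) * x ^ (1/8:ℝ) := by rw [← Real.rpow_add hN0]; norm_num
        _ ≤ x ^ (-1/8:ℝ) * (2 * Q) := by gcongr
        _ = _ := by ring
    have e4 : x ^ (1/16:ℝ) / x ^ (1/4:ℝ) ≤ x ^ (-1/8:ℝ) := by
      rw [← Real.rpow_sub hN0]
      exact Real.rpow_le_rpow_of_exponent_le hN1 (by norm_num)
    rw [e2]
    calc 1 / (Q:ℝ) + 2 ^ 29 * C1 * x ^ (1/16:ℝ) / x ^ (1/4:ℝ) = 1 / (Q:ℝ) + 2 ^ 29 * C1 * (x ^ (1/16:ℝ) / x ^ (1/4:ℝ)) := by ring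
      _ ≤ 2 * x ^ (-1/8:ℝ) + 2 ^ 29 * C1 * x ^ (-1/8:ℝ) := by gcongr
      _ = _ := by ring
  have t2 : 2 * (Real.log x * (Cd * x ^ (ε/3)) * x * √(1 / (Q:ℝ) + 2 ^ 29 * C1 * x ^ (1/16:ℝ) / √(√x)) * (1 + Real.log x)) ≤
      2 * (D * Cd * √(2 + 2 ^ 29 * C1) * D) * x ^ (15/16 + ε) := by
    have hl : Real.log x ≤ D * x ^ (ε/3) := by linarith
    calc 2 * (Real.log x * (Cd * x ^ (ε/3)) * x * √(1 / (Q:ℝ) + 2 ^ 29 * C1 * x ^ (1/16:ℝ) / √(√x)) * (1 + Real.log x))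
        ≤ 2 * (D * x ^ (ε/3) * (Cd * x ^ (ε/3)) * x * (√(2 + 2 ^ 29 * C1) * x ^ (-1/16:ℝ)) * (D * x ^ (ε/3))) := by gcongr
      _ = 2 * (D * Cd * √(2 + 2 ^ 29 * C1) * D) * (x ^ (ε/3) * x ^ (ε/3) * x ^ (ε/3) * x ^ (-1/16:ℝ) * x ^ (1:ℝ)) := by rw [Real.rpow_one]; ring
      _ = _ := by
          rw [← Real.rpow_add hN0, ← Real.rpow_add hN0, ← Real.rpow_add hN0, ← Real.rpow_add hN0]
          congr 2; ring
  linarith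

end Reg

lemma offdiag_bound (B : Finset ℕ) (w t : ℕ → ℝ) (J : ℕ) (E : ℝ)
    (hE : ∀ k : ℕ, 1 ≤ k → k < J → ‖∑ n ∈ B, (w n : ℂ) * e (k * t n)‖ ≤ E) (m m' : ℕ) (hm : m < J) (hm' : m' < J) (hne : m ≠ m') :
    ‖∑ n ∈ B, (w n : ℂ) * (e (m * t n) * (starRingEnd ℂ) (e (m' * t n)))‖ ≤ E := by
  have key : ∀ m m' : ℕ, m < J → m' < m → ‖∑ n ∈ B, (w n : ℂ) * (e (m * t n) * (starRingEnd ℂ) (e (m' * t n)))‖ ≤ E := by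
    intro m m' hm hlt
    have := hE (m - m') (by omega) (by omega)
    convert this using 4 with n _
    rw [← e_sub]
    congr 1
    rw [Nat.cast_sub hlt.le]; ring
  rcases lt_or_gt_of_ne hne with h | h
  · have := key m' m hm' h
    rw [← RCLike.norm_conj, map_sum]
    have e1 : ∑ n ∈ B, (starRingEnd ℂ) ((w n : ℂ) * (e (m * t n) * (starRingEnd ℂ) (e (m' * t n)))) =
        ∑ n ∈ B, (w n : ℂ) * (e (m' * t n) * (starRingEnd ℂ) (e (m * t n))) := by
      refine Finset.sum_congr rfl fun n _ => ?_
      rw [map_mul, map_mul, Complex.conj_conj, Complex.conj_ofReal]; ring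
    rw [e1]; exact this
  · exact key m m' hm h

lemma quad_expand (B : Finset ℕ) (w t : ℕ → ℝ) (J : ℕ) (c : ℕ → ℝ) (E : ℝ) 
    (hE : ∀ k : ℕ, 1 ≤ k → k < J → ‖∑ n ∈ B, (w n : ℂ) * e (k * t n)‖ ≤ E) (hE0 : 0 ≤ E) :
    |∑ n ∈ B, w n * ‖∑ m ∈ Finset.range J, (c m : ℂ) * e (m * t n)‖ ^ 2 - (∑ n ∈ B, w n) * ∑ m ∈ Finset.range J, c m ^ 2|
      ≤ E * (∑ m ∈ Finset.range J, |c m|) ^ 2 := by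
  set V := ∑ n ∈ B, w n with hV
  have h1 : ((∑ n ∈ B, w n * ‖∑ m ∈ Finset.range J, (c m : ℂ) * e (m * t n)‖ ^ 2 : ℝ) : ℂ) =
      ∑ m ∈ Finset.range J, ∑ m' ∈ Finset.range J, (c m : ℂ) * (c m' : ℂ) * ∑ n ∈ B, (w n : ℂ) * (e (m * t n) * (starRingEnd ℂ) (e (m' * t n))) := by
    push_cast
    have : ∀ n ∈ B, (w n : ℂ) * (‖∑ m ∈ Finset.range J, (c m : ℂ) * e (m * t n)‖ : ℂ) ^ 2 =
        ∑ m ∈ Finset.range J, ∑ m' ∈ Finset.range J, (c m : ℂ) * (c m' : ℂ) * ((w n : ℂ) * (e (m * t n) * (starRingEnd ℂ) (e (m' * t n)))) := by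
      intro n _
      rw [← Complex.mul_conj', map_sum, Finset.sum_mul_sum, Finset.mul_sum]
      refine Finset.sum_congr rfl fun m _ => ?_
      rw [Finset.mul_sum]
      refine Finset.sum_congr rfl fun m' _ => ?_
      rw [map_mul, Complex.conj_ofReal]; ring
    rw [Finset.sum_congr rfl this, Finset.sum_comm]
    refine Finset.sum_congr rfl fun m _ => ?_
    rw [Finset.sum_comm]
    refine Finset.sum_congr rfl fun m' _ => ?_
    rw [Finset.mul_sum]
  have h2 : ((V * ∑ m ∈ Finset.range J, c m ^ 2 : ℝ) : ℂ) =
      ∑ m ∈ Finset.range J, ∑ m' ∈ Finset.range J, if m = m' then (c m : ℂ) * (c m' : ℂ) * V else 0 := by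
    push_cast
    rw [Finset.mul_sum]
    refine Finset.sum_congr rfl fun m hm => ?_
    rw [Finset.sum_ite_eq, if_pos hm]; ring
  rw [← Real.norm_eq_abs, ← Complex.norm_real, Complex.ofReal_sub, h1, h2, ← Finset.sum_sub_distrib]
  have h3 : E * (∑ m ∈ Finset.range J, |c m|) ^ 2 = ∑ m ∈ Finset.range J, ∑ m' ∈ Finset.range J, |c m| * |c m'| * E := by
    rw [sq, Finset.sum_mul_sum, Finset.mul_sum]
    refine Finset.sum_congr rfl fun m _ => ?_
    rw [Finset.mul_sum]
    refine Finset.sum_congr rfl fun m' _ => by ring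
  rw [h3]
  refine (norm_sum_le _ _).trans (Finset.sum_le_sum fun m hm => ?_)
  rw [← Finset.sum_sub_distrib]
  refine (norm_sum_le _ _).trans (Finset.sum_le_sum fun m' hm' => ?_)
  rw [Finset.mem_range] at hm hm'
  split_ifs with h
  · subst h
    have : ∑ n ∈ B, (w n : ℂ) * (e (m * t n) * (starRingEnd ℂ) (e (m * t n))) = (V : ℂ) := by
      rw [hV]; push_cast
      refine Finset.sum_congr rfl fun n _ => ?_
      rw [Complex.mul_conj', norm_e]; simp
    rw [this, sub_self, norm_zero]; positivity
  · rw [sub_zero, norm_mul, norm_mul, Complex.norm_real, Complex.norm_real, Real.norm_eq_abs, Real.norm_eq_abs]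
    exact mul_le_mul_of_nonneg_left (offdiag_bound B w t J E hE m m' hm hm' h) (by positivity)

lemma tent_shift (K : ℕ) (b : ℕ → ℝ) (hb0 : b 0 = 0) (hbK : b K = 0) (t : ℝ) :
    ‖∑ m ∈ Finset.range K, ((b m - b (m+1) : ℝ) : ℂ) * e (m * t)‖ ^ 2 =
      ‖∑ m ∈ Finset.range K, (b m : ℂ) * e (m * t)‖ ^ 2 * (2 - 2 * Real.cos (2 * π * t)) := by
  set D := ∑ m ∈ Finset.range K, (b m : ℂ) * e (m * t) with hD
  have h1 : (∑ m ∈ Finset.range K, ((b m - b (m+1) : ℝ) : ℂ) * e (m * t)) * e t = (e t - 1) * D := by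
    have h2 : D = ∑ m ∈ Finset.range K, (b (m+1) : ℂ) * e ((m+1 : ℕ) * t) := by
      have e1 := Finset.sum_range_succ (fun m : ℕ => (b m : ℂ) * e (m * t)) K
      have e2 := Finset.sum_range_succ' (fun m : ℕ => (b m : ℂ) * e (m * t)) K
      rw [e1] at e2
      simp only [hb0, hbK, Complex.ofReal_zero, zero_mul, add_zero] at e2
      rw [hD, e2]
    have h3 : (e t - 1) * D = e t * D - D := by ring
    rw [h3]
    conv_rhs => rw [h2, ← h2]
    nth_rewrite 2 [h2]
    rw [hD, Finset.mul_sum, ← Finset.sum_sub_distrib, Finset.sum_mul]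
    refine Finset.sum_congr rfl fun m _ => ?_
    have : e ((m+1:ℕ) * t) = e (m * t) * e t := by rw [← e_add]; congr 1; push_cast; ring
    rw [this]; push_cast; ring
  have h4 : ‖∑ m ∈ Finset.range K, ((b m - b (m+1) : ℝ) : ℂ) * e (m * t)‖ = ‖e t - 1‖ * ‖D‖ := by
    rw [← norm_mul, ← h1, norm_mul, norm_e, mul_one]
  have h5 : ‖e t - 1‖ ^ 2 = 2 - 2 * Real.cos (2 * π * t) := by
    rw [← Complex.normSq_eq_norm_sq, Complex.normSq_apply]
    simp only [Complex.sub_re, Complex.sub_im, Complex.one_re, Complex.one_im, e_re, e_im]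
    nlinarith [Real.sin_sq_add_cos_sq (2 * π * t)]
  rw [h4, mul_pow, h5]; ring

lemma minorant (B : Finset ℕ) (w t : ℕ → ℝ) (hw : ∀ n ∈ B, 0 ≤ w n) (K : ℕ) (δ E : ℝ) (hδ : 0 < δ) (hδ1 : δ ≤ 1)
    (hK : 1 ≤ K * δ) (hK2 : K * δ ≤ 2) (hE0 : 0 ≤ E)
    (hE : ∀ k : ℕ, 1 ≤ k → k < 4 * K → ‖∑ n ∈ B, (w n : ℂ) * e (k * t n)‖ ≤ E)
    (A : ℕ → Prop) (hA : ∀ n ∈ B, Real.cos (π * δ) < Real.cos (2 * π * t n) → A n) :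
    (∑ n ∈ B, w n) / (640 * K) - 2 * E ≤ ∑ n ∈ B with A n, w n := by
  have hK0 : (0:ℝ) < K := by
    by_contra h
    have : (K:ℝ) * δ ≤ 0 := mul_nonpos_of_nonpos_of_nonneg (not_lt.1 h) hδ.le
    linarith
  set b : ℕ → ℝ := fun m => min (m:ℝ) (4 * K - m) with hb
  set κ := 1 - Real.cos (π * δ) with hκ
  have hV0 : 0 ≤ ∑ n ∈ B, w n := Finset.sum_nonneg hw
  set V := ∑ n ∈ B, w n with hV
  have hκ1 : 2 * δ ^ 2 ≤ κ := by
    have h1 : Real.cos (π * δ) = 1 - 2 * Real.sin (π * δ / 2) ^ 2 := by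
      have := Real.cos_two_mul (π * δ / 2)
      rw [show 2 * (π * δ / 2) = π * δ by ring] at this
      have h2 := Real.sin_sq_add_cos_sq (π * δ / 2)
      linarith
    have h2 : δ ≤ Real.sin (π * δ / 2) := by
      have := Real.mul_le_sin (x := π * δ / 2) (by positivity) (by nlinarith [Real.pi_pos])
      calc δ = 2 / π * (π * δ / 2) := by field_simp
        _ ≤ _ := this
    have h3 : δ ^ 2 ≤ Real.sin (π * δ / 2) ^ 2 := pow_le_pow_left₀ hδ.le h2 2
    linarith
  have hκ2 : κ ≤ 5 * δ ^ 2 := by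
    have := Real.one_sub_sq_div_two_le_cos (x := π * δ)
    have hpi : π ^ 2 ≤ 10 := by nlinarith [Real.pi_lt_d2, Real.pi_pos]
    nlinarith [sq_nonneg δ]
  have hb_le : ∀ m ∈ Finset.range (4 * K), |b m| ≤ 2 * K := by
    intro m hm
    rw [Finset.mem_range] at hm
    have hm' : (m:ℝ) ≤ 4 * K := by exact_mod_cast hm.le
    have h1 : 0 ≤ b m := by simp only [hb]; exact le_min (by positivity) (by linarith)
    rw [abs_of_nonneg h1]
    simp only [hb]
    rcases le_total (m:ℝ) (2 * K) with h | h
    · exact (min_le_left _ _).trans h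
    · exact (min_le_right _ _).trans (by linarith)
  have hsumb : ∑ m ∈ Finset.range (4 * K), |b m| ≤ 8 * K ^ 2 := by
    calc _ ≤ ∑ m ∈ Finset.range (4 * K), (2 * K : ℝ) := Finset.sum_le_sum hb_le
      _ = _ := by rw [Finset.sum_const, Finset.card_range, nsmul_eq_mul]; push_cast; ring
  have hd : ∀ m ∈ Finset.range (4 * K), |b m - b (m + 1)| ≤ 1 := by
    intro m _
    have := abs_min_sub_min_le_max (m:ℝ) (4 * K - m) ((m+1:ℕ):ℝ) (4 * K - (m+1:ℕ))
    refine this.trans (max_le ?_ ?_)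
    · rw [abs_le]; push_cast; constructor <;> linarith
    · rw [abs_le]; push_cast; constructor <;> linarith
  have hsumd : ∑ m ∈ Finset.range (4 * K), |b m - b (m + 1)| ≤ 4 * K := by
    calc _ ≤ ∑ m ∈ Finset.range (4 * K), (1 : ℝ) := Finset.sum_le_sum hd
      _ = _ := by simp
  have hsumd2 : ∑ m ∈ Finset.range (4 * K), (b m - b (m + 1)) ^ 2 ≤ 4 * K := by
    calc _ ≤ ∑ m ∈ Finset.range (4 * K), (1 : ℝ) := Finset.sum_le_sum fun m hm => by
          rw [sq_le_one_iff_abs_le_one]; exact hd m hm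
      _ = _ := by simp
  have hsumb2 : 2 * (K:ℝ) ^ 3 ≤ ∑ m ∈ Finset.range (4 * K), b m ^ 2 := by
    calc 2 * (K:ℝ) ^ 3 = ∑ m ∈ Finset.Ico K (3 * K), (K:ℝ) ^ 2 := by
          rw [Finset.sum_const, Nat.card_Ico, nsmul_eq_mul, show 3 * K - K = 2 * K by omega]; push_cast; ring
      _ ≤ ∑ m ∈ Finset.Ico K (3 * K), b m ^ 2 := by
          refine Finset.sum_le_sum fun m hm => ?_
          rw [Finset.mem_Ico] at hm
          refine pow_le_pow_left₀ hK0.le ?_ 2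
          have h1 : (K:ℝ) ≤ m := by exact_mod_cast hm.1
          have h2 : (m:ℝ) ≤ 3 * K := by exact_mod_cast hm.2.le
          exact le_min h1 (by linarith)
      _ ≤ _ := by
          refine Finset.sum_le_sum_of_subset_of_nonneg ?_ fun _ _ _ => by positivity
          intro m hm
          rw [Finset.mem_Ico] at hm
          rw [Finset.mem_range]; omega
  have q1 := (abs_le.1 (quad_expand B w t (4 * K) b E hE hE0)).1
  have q2 := (abs_le.1 (quad_expand B w t (4 * K) (fun m => b m - b (m+1)) E hE hE0)).2
  have hsh : ∀ s : ℝ, _ := fun s => tent_shift (4 * K) b (by simp [hb]) (by simp [hb]) s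
  simp only [hsh] at q2
  rw [← hV] at q1 q2
  -- combine
  have hG : ∑ n ∈ B, w n * (‖∑ m ∈ Finset.range (4 * K), (b m : ℂ) * e (m * t n)‖ ^ 2 * (Real.cos (2 * π * t n) - Real.cos (π * δ)))
      = κ * ∑ n ∈ B, w n * ‖∑ m ∈ Finset.range (4 * K), (b m : ℂ) * e (m * t n)‖ ^ 2
        - 1 / 2 * ∑ n ∈ B, w n * (‖∑ m ∈ Finset.range (4 * K), (b m : ℂ) * e (m * t n)‖ ^ 2 * (2 - 2 * Real.cos (2 * π * t n))) := by
    rw [Finset.mul_sum, Finset.mul_sum, ← Finset.sum_sub_distrib]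
    refine Finset.sum_congr rfl fun n _ => ?_
    rw [hκ]; ring
  have hup : ∑ n ∈ B, w n * (‖∑ m ∈ Finset.range (4 * K), (b m : ℂ) * e (m * t n)‖ ^ 2 * (Real.cos (2 * π * t n) - Real.cos (π * δ)))
      ≤ (1280 * K ^ 2) * ∑ n ∈ B with A n, w n := by
    rw [Finset.sum_filter, Finset.mul_sum]
    refine Finset.sum_le_sum fun n hn => ?_
    have hDn : ‖∑ m ∈ Finset.range (4 * K), (b m : ℂ) * e (m * t n)‖ ≤ 8 * K ^ 2 := by
      refine (norm_sum_le _ _).trans (le_trans (Finset.sum_le_sum fun m _ => ?_) hsumb)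
      rw [norm_mul, norm_e, mul_one, Complex.norm_real, Real.norm_eq_abs]
    have hD2 := pow_le_pow_left₀ (norm_nonneg _) hDn 2
    set D2 := ‖∑ m ∈ Finset.range (4 * K), (b m : ℂ) * e (m * t n)‖ ^ 2 with hD2'
    have hD0 : 0 ≤ D2 := by positivity
    rcases lt_or_ge (Real.cos (π * δ)) (Real.cos (2 * π * t n)) with h | h
    · rw [if_pos (hA n hn h)]
      have h1 : Real.cos (2 * π * t n) - Real.cos (π * δ) ≤ 5 * δ ^ 2 := by
        have := Real.cos_le_one (2 * π * t n)
        rw [hκ] at hκ2; linarith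
      have h2 : D2 * (Real.cos (2 * π * t n) - Real.cos (π * δ)) ≤ (8 * K ^ 2) ^ 2 * (5 * δ ^ 2) :=
        mul_le_mul hD2 h1 (by linarith) (by positivity)
      have h3 : (8 * (K:ℝ) ^ 2) ^ 2 * (5 * δ ^ 2) ≤ 1280 * K ^ 2 := by
        have h4 : ((K:ℝ) * δ) ^ 2 ≤ 2 ^ 2 := pow_le_pow_left₀ (by positivity) hK2 2
        calc (8 * (K:ℝ) ^ 2) ^ 2 * (5 * δ ^ 2) = 320 * (K:ℝ) ^ 2 * ((K:ℝ) * δ) ^ 2 := by ring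
          _ ≤ 320 * (K:ℝ) ^ 2 * 2 ^ 2 := by gcongr
          _ = _ := by ring
      rw [mul_comm (1280 * (K:ℝ) ^ 2)]
      exact mul_le_mul_of_nonneg_left (h2.trans h3) (hw n hn)
    · have : w n * (D2 * (Real.cos (2 * π * t n) - Real.cos (π * δ))) ≤ 0 :=
        mul_nonpos_of_nonneg_of_nonpos (hw n hn) (mul_nonpos_of_nonneg_of_nonpos hD0 (by linarith))
      refine this.trans ?_
      split_ifs
      · exact mul_nonneg (by positivity) (hw n hn)
      · simp
  rw [hG] at hup
  have hκ0 : 0 ≤ κ := le_trans (by positivity) hκ1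
  set X1 := ∑ n ∈ B, w n * ‖∑ m ∈ Finset.range (4 * K), (b m : ℂ) * e (m * t n)‖ ^ 2 with hX1
  set X2 := ∑ n ∈ B, w n * (‖∑ m ∈ Finset.range (4 * K), (b m : ℂ) * e (m * t n)‖ ^ 2 * (2 - 2 * Real.cos (2 * π * t n))) with hX2
  have sb0 : 0 ≤ ∑ m ∈ Finset.range (4 * K), |b m| := Finset.sum_nonneg fun _ _ => abs_nonneg _
  have sd0 : 0 ≤ ∑ m ∈ Finset.range (4 * K), |b m - b (m + 1)| := Finset.sum_nonneg fun _ _ => abs_nonneg _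
  have p1 : V * (2 * K ^ 3) - E * (8 * K ^ 2) ^ 2 ≤ X1 := by
    have h1 : V * (2 * K ^ 3) ≤ V * ∑ m ∈ Finset.range (4 * K), b m ^ 2 := mul_le_mul_of_nonneg_left hsumb2 hV0
    have h2 : E * (∑ m ∈ Finset.range (4 * K), |b m|) ^ 2 ≤ E * (8 * K ^ 2) ^ 2 := by gcongr
    linarith
  have p2 : X2 ≤ V * (4 * K) + E * (4 * K) ^ 2 := by
    have h1 : V * ∑ m ∈ Finset.range (4 * K), (b m - b (m + 1)) ^ 2 ≤ V * (4 * K) := mul_le_mul_of_nonneg_left hsumd2 hV0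
    have h2 : E * (∑ m ∈ Finset.range (4 * K), |b m - b (m + 1)|) ^ 2 ≤ E * (4 * K) ^ 2 := by gcongr
    linarith
  have p3 : κ * (V * (2 * K ^ 3)) - κ * (E * (8 * K ^ 2) ^ 2) ≤ κ * X1 := by
    have := mul_le_mul_of_nonneg_left p1 hκ0
    linarith
  have p4 : 4 * K * V ≤ κ * (V * (2 * K ^ 3)) := by
    have h4 : 1 ≤ (K * δ) ^ 2 := one_le_pow₀ hK
    have h5 : 2 * δ ^ 2 * (V * (2 * K ^ 3)) ≤ κ * (V * (2 * K ^ 3)) := mul_le_mul_of_nonneg_right hκ1 (by positivity)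
    have h6 : 2 * δ ^ 2 * (V * (2 * K ^ 3)) = 4 * K * V * (K * δ) ^ 2 := by ring
    have h7 : 4 * K * V * 1 ≤ 4 * K * V * (K * δ) ^ 2 := mul_le_mul_of_nonneg_left h4 (by positivity)
    linarith
  have p5 : κ * (E * (8 * K ^ 2) ^ 2) ≤ 1280 * K ^ 2 * E := by
    have h4 : (K * δ) ^ 2 ≤ 2 ^ 2 := pow_le_pow_left₀ (by positivity) hK2 2
    calc κ * (E * (8 * K ^ 2) ^ 2) ≤ 5 * δ ^ 2 * (E * (8 * K ^ 2) ^ 2) := by gcongr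
      _ = 320 * K ^ 2 * E * (K * δ) ^ 2 := by ring
      _ ≤ 320 * K ^ 2 * E * 2 ^ 2 := by gcongr
      _ = _ := by ring
  have p6 : 2 * K * V - 1288 * K ^ 2 * E ≤ 1280 * K ^ 2 * ∑ n ∈ B with A n, w n := by nlinarith
  have p7 : (1280 * (K:ℝ) ^ 2) * (V / (640 * K) - 2 * E) = 2 * K * V - 2560 * K ^ 2 * E := by field_simp; ring
  have p8 : 0 ≤ (K:ℝ) ^ 2 * E := by positivity
  refine le_of_mul_le_mul_left ?_ (show (0:ℝ) < 1280 * K ^ 2 by positivity)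
  rw [p7]; linarith

lemma ev_pow (C α β : ℝ) (h : α < β) : ∀ᶠ x : ℝ in atTop, C * x ^ α ≤ x ^ β := by
  have h1 : Tendsto (fun x : ℝ => x ^ (β - α)) atTop atTop := tendsto_rpow_atTop (by linarith)
  filter_upwards [h1.eventually_ge_atTop C, eventually_gt_atTop (0:ℝ)] with x hx hx0
  have : x ^ β = x ^ (β - α) * x ^ α := by rw [← Real.rpow_add hx0]; congr 1; ring
  rw [this]
  exact mul_le_mul_of_nonneg_right hx (by positivity)

lemma ev_sqrt_log (C : ℝ) (hC : 0 ≤ C) (β : ℝ) (h : 1 / 2 < β) : ∀ᶠ x : ℝ in atTop, C * (√x * Real.log x) ≤ x ^ β := by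
  have h1 := ev_pow (C * (1 / ((β - 1 / 2) / 2))) (1 / 2 + (β - 1 / 2) / 2) β (by linarith)
  filter_upwards [h1, eventually_ge_atTop (1:ℝ)] with x hx hx1
  have hl := Real.log_le_rpow_div (by linarith : (0:ℝ) ≤ x) (show 0 < (β - 1 / 2) / 2 by linarith)
  have hx0 : 0 < x := by linarith
  rw [Real.rpow_add hx0] at hx
  rw [Real.sqrt_eq_rpow]
  refine le_trans ?_ hx
  calc C * (x ^ (1 / 2 : ℝ) * Real.log x) ≤ C * (x ^ (1 / 2 : ℝ) * (x ^ ((β - 1 / 2) / 2) / ((β - 1 / 2) / 2))) := by gcongr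
    _ = _ := by ring

lemma cos_near (t δ : ℝ) (hδ : 0 < δ) (h : Real.cos (π * δ) < Real.cos (2 * π * t)) : ∃ k : ℤ, |t - k| < δ / 2 := by
  refine ⟨round t, ?_⟩
  by_contra hc
  push Not at hc
  have h1 := abs_sub_round t
  have h2 : Real.cos (2 * π * t) = Real.cos (2 * π * |t - round t|) := by
    have : Real.cos (2 * π * t) = Real.cos (2 * π * (t - round t)) := by
      rw [← Real.cos_sub_int_mul_two_pi _ (round t)]; congr 1; ring
    rw [this, ← Real.cos_abs, abs_mul, abs_of_pos (by positivity : 0 < 2 * π)]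
  rw [h2] at h
  have := Real.cos_le_cos_of_nonneg_of_le_pi (x := π * δ) (y := 2 * π * |t - round t|) (by positivity)
    (by nlinarith [Real.pi_pos]) (by nlinarith [Real.pi_pos])
  linarith

lemma psi_block (N : ℕ) : ∑ n ∈ Finset.Ico (N / 4 + 1) (N + 1), ArithmeticFunction.vonMangoldt n = Chebyshev.psi N - Chebyshev.psi ((N:ℝ) / 4) := by
  have h4 : ⌊(N:ℝ) / 4⌋₊ = N / 4 := by
    have := Nat.floor_div_eq_div (K := ℝ) N 4
    simpa using this
  rw [Chebyshev.psi, Chebyshev.psi, h4, Nat.floor_natCast]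
  have e1 : Finset.Ioc 0 N = Finset.Ico 1 (N + 1) := by ext; simp; omega
  have e2 : Finset.Ioc 0 (N / 4) = Finset.Ico 1 (N / 4 + 1) := by ext; simp; omega
  rw [e1, e2, ← Finset.sum_Ico_consecutive (m := 1) (n := N / 4 + 1) (k := N + 1) _ (by omega) (by omega)]
  ring

lemma psi_block_lower : ∃ N0 : ℕ, ∀ N : ℕ, N0 ≤ N → (N:ℝ) / 4 ≤ ∑ n ∈ Finset.Ico (N / 4 + 1) (N + 1), ArithmeticFunction.vonMangoldt n := by
  have h := ((ev_sqrt_log 100 (by norm_num) 1 (by norm_num)).and (eventually_ge_atTop (100:ℝ)))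
  obtain ⟨N0, hN0⟩ := eventually_atTop.1 (tendsto_natCast_atTop_atTop.eventually h)
  refine ⟨N0, fun N hN => ?_⟩
  obtain ⟨h1, h2⟩ := hN0 N hN
  rw [psi_block]
  have a1 := Chebyshev.psi_ge N
  have a2 := Chebyshev.psi_le (x := (N:ℝ) / 4) (by linarith)
  rw [Real.rpow_one] at h1
  have l2 := Real.log_two_gt_d9
  have l4 : Real.log 4 = 2 * Real.log 2 := by
    rw [show (4:ℝ) = 2 ^ 2 by norm_num, Real.log_pow]; norm_num
  rw [l4] at a2
  obtain ⟨x, hx⟩ : ∃ x : ℝ, x = (N:ℝ) := ⟨_, rfl⟩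
  rw [← hx] at h1 h2 a1 a2 ⊢
  have hx0 : 0 < x := by linarith
  have b1 : Real.log (x / 4) ≤ Real.log x := Real.log_le_log (by positivity) (by linarith)
  have b2 : √(x / 4) ≤ √x := Real.sqrt_le_sqrt (by linarith)
  have b3 : 0 ≤ Real.log (x / 4) := Real.log_nonneg (by linarith)
  have b4 : √(x / 4) * Real.log (x / 4) ≤ √x * Real.log x := by gcongr
  have b5 : Real.log (x + 1) ≤ 2 * Real.log x := by
    rw [← Real.log_rpow hx0]; apply Real.log_le_log (by positivity)
    norm_num; nlinarith
  have b6 : 1 ≤ √x := Real.one_le_sqrt.2 (by linarith)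
  have b7 : Real.log x ≤ √x * Real.log x := by
    have : 0 ≤ Real.log x := b3.trans b1
    nlinarith
  nlinarith

namespace Reg
variable {S : Set ℕ} {γ' : ℝ} {φ φ1 H H1 : ℝ → ℝ} {Y0 : ℝ}

lemma growth' (R : Reg S γ' φ φ1 H H1 Y0) {y : ℝ} (hy : Y0 ≤ y) : y ^ γ' ≤ φ y :=
  (R.growth y hy).trans (R.H_le y hy)

theorem count_lower (R : Reg S γ' φ φ1 H H1 Y0) (hγ : 15 / 16 < γ') : ∃ c > 0, ∃ N0 : ℕ, ∀ N : ℕ, N0 ≤ N →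
    c * (φ N / Real.log N) ≤ ((Finset.Ico (N / 4 + 1) (N + 1)).filter (fun p => p ∈ S)).card := by
  obtain ⟨C, hC, N1, hmain⟩ := R.mangoldt_sum hγ.le (C1 := 40) (by norm_num) (ε := (γ' - 15 / 16) / 2) (by linarith)
  obtain ⟨N2, hpsi⟩ := psi_block_lower
  refine ⟨1 / 51200, by norm_num, ?_⟩
  have hev : ∀ᶠ x : ℝ in atTop, (4 * Y0 ≤ x ∧ φ x / x ≤ 1 ∧ 8 ≤ x) ∧ (102400 * 2 * C) * x ^ (15 / 16 + (γ' - 15 / 16) / 2) ≤ x ^ γ' ∧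
      (204800 : ℝ) * (√x * Real.log x) ≤ x ^ γ' := by
    refine ((eventually_ge_atTop _).and ((R.small.eventually_le_const (by norm_num)).and (eventually_ge_atTop 8))).and ((ev_pow _ _ _ (by linarith)).and (ev_sqrt_log _ (by norm_num) _ (by linarith)))
  obtain ⟨N3, hN3⟩ := eventually_atTop.1 (tendsto_natCast_atTop_atTop.eventually hev)
  refine ⟨max N1 (max N2 N3), fun N hN => ?_⟩
  have hNN1 : N1 ≤ N := (le_max_left _ _).trans hN
  have hNN2 : N2 ≤ N := ((le_max_left _ _).trans (le_max_right _ _)).trans hN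
  have hNN3 : N3 ≤ N := ((le_max_right _ _).trans (le_max_right _ _)).trans hN
  obtain ⟨⟨h4, hs, h8⟩, hp, hl⟩ := hN3 N hNN3
  have hY := R.one_le_Y0
  have hN0 : (0:ℝ) < N := by linarith
  have hg := R.growth' (y := N) (by linarith)
  have hφ : 1 ≤ φ N := R.one_le N (by show Y0 ≤ (N:ℝ); linarith)
  set B := Finset.Ico (N / 4 + 1) (N + 1) with hB
  have hBn : ∀ n ∈ B, (N:ℝ) / 4 ≤ n ∧ n ≤ N := by
    intro n hn
    rw [hB, Finset.mem_Ico] at hn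
    refine ⟨?_, by omega⟩
    have : N ≤ 4 * n := by omega
    have : (N:ℝ) ≤ 4 * n := by exact_mod_cast this
    linarith
  set δ := φ N / N / 5 with hδ
  have hδ0 : 0 < δ := by positivity
  have hδ1 : δ ≤ 1 / 5 := by rw [hδ]; linarith
  set K := ⌈1 / δ⌉₊ with hK
  have hK1 : 1 / δ ≤ K := Nat.le_ceil _
  have hK2 : (K:ℝ) < 1 / δ + 1 := Nat.ceil_lt_add_one (by positivity)
  have hKδ1 : 1 ≤ K * δ := by rwa [div_le_iff₀ hδ0] at hK1
  have hKδ2 : K * δ ≤ 2 := by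
    have : K * δ ≤ (1 / δ + 1) * δ := by gcongr
    have e1 : (1 / δ + 1) * δ = 1 + δ := by field_simp
    linarith
  have hδN : φ N = 5 * N * δ := by rw [hδ]; field_simp
  set E := C * (N:ℝ) ^ (15 / 16 + (γ' - 15 / 16) / 2) with hE
  have hE0 : 0 ≤ E := by positivity
  have key := minorant B (fun n => ArithmeticFunction.vonMangoldt n) (fun n => φ n + δ / 2) (fun n _ => ArithmeticFunction.vonMangoldt_nonneg) K δ E hδ0 (by linarith)
    hKδ1 hKδ2 hE0 (by
      intro k hk1 hk2
      have hk3 : (k:ℝ) ≤ 4 * K := by exact_mod_cast hk2.le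
      have hb := hmain N hNN1 k hk1 (by
        rw [hδN]
        have : (k:ℝ) * δ ≤ 8 := by nlinarith
        nlinarith)
      have e1 : ∑ n ∈ B, ((ArithmeticFunction.vonMangoldt n : ℝ) : ℂ) * e (k * (φ n + δ / 2)) =
        (∑ n ∈ B, ((ArithmeticFunction.vonMangoldt n : ℝ) : ℂ) * e (k * φ n)) * e (k * (δ / 2)) := by
        rw [Finset.sum_mul]
        refine Finset.sum_congr rfl fun n _ => ?_
        rw [mul_add, e_add]; ring
      rw [e1, norm_mul, norm_e, mul_one]
      exact hb) (fun n => ∃ k : ℕ, φ n ≤ k ∧ (k:ℝ) < φ (n + 1)) (by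
      intro n hn hcos
      obtain ⟨k, hk⟩ := cos_near _ _ hδ0 hcos
      rw [abs_lt] at hk
      obtain ⟨hn1, hn2⟩ := hBn n hn
      have hn2' : (n:ℝ) ≤ N := by exact_mod_cast hn2
      have h1 : 1 ≤ φ n := R.one_le n (by show Y0 ≤ (n:ℝ); linarith)
      have h2 := R.phi_diff_lo h4 hn1 (by linarith)
      have hk0 : 0 ≤ k := by
        have : (0:ℝ) < k := by linarith
        exact_mod_cast this.le
      lift k to ℕ using hk0
      push_cast at hk
      refine ⟨k, by linarith, ?_⟩
      rw [← hδ] at h2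
      linarith)
  have hW := hpsi N hNN2
  rw [← hB] at hW
  have hlN : 0 < Real.log N := Real.log_pos (by linarith)
  have hup : ∑ n ∈ B with (∃ k : ℕ, φ (n:ℕ) ≤ k ∧ (k:ℝ) < φ ((n:ℕ) + 1)), ArithmeticFunction.vonMangoldt n ≤
      Real.log N * (B.filter (fun p => p ∈ S)).card + 2 * √N * Real.log N := by
    rw [← Finset.sum_filter_add_sum_filter_not _ (fun n => n.Prime)]
    refine add_le_add ?_ ?_
    · rw [Finset.filter_filter]
      have : (B.filter (fun p => p ∈ S)) = B.filter (fun n : ℕ => (∃ k : ℕ, φ n ≤ k ∧ (k:ℝ) < φ (n + 1)) ∧ n.Prime) := by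
        refine Finset.filter_congr fun n hn => ?_
        rw [R.mem n (by have := (hBn n hn).1; linarith)]
        tauto
      rw [this, mul_comm, ← nsmul_eq_mul]
      refine Finset.sum_le_card_nsmul _ _ _ fun n hn => ?_
      rw [Finset.mem_filter] at hn
      refine ArithmeticFunction.vonMangoldt_le_log.trans (Real.log_le_log ?_ ?_)
      · exact_mod_cast hn.2.2.pos
      · exact_mod_cast (hBn n hn.1).2
    · refine le_trans ?_ (Chebyshev.psi_sub_theta_le (x := N) (by linarith))
      rw [Chebyshev.psi_sub_theta_eq_sum_not_prime, Nat.floor_natCast]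
      refine Finset.sum_le_sum_of_subset_of_nonneg ?_ fun _ _ _ => ArithmeticFunction.vonMangoldt_nonneg
      intro n hn
      simp only [Finset.mem_filter, hB, Finset.mem_Ico, Finset.mem_Ioc] at hn ⊢
      exact ⟨by omega, hn.2⟩
  have hfin := key.trans hup
  have hWK : φ N / 25600 ≤ (∑ n ∈ B, ArithmeticFunction.vonMangoldt n) / (640 * K) := by
    have hKp : (0:ℝ) < K := by
      have := one_div_pos.2 hδ0
      linarith
    rw [div_le_div_iff₀ (by norm_num) (by positivity), hδN]
    nlinarith
  have hX : 1 / 51200 * φ N ≤ Real.log N * (B.filter (fun p => p ∈ S)).card := by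
    have : 2 * √N * Real.log N = 2 * (√N * Real.log N) := by ring
    rw [this] at hfin
    have hE2 : 102400 * 2 * E ≤ φ N := by
      rw [hE]; calc _ = (102400 * 2 * C) * (N:ℝ) ^ (15 / 16 + (γ' - 15 / 16) / 2) := by ring
        _ ≤ _ := hp.trans hg
    linarith
  rw [mul_div_assoc', div_le_iff₀ hlN, mul_comm (((B.filter (fun p => p ∈ S)).card : ℝ))]
  exact hX

end Reg

noncomputable def sL (z R : ℕ) : Finset ℕ :=
  (Finset.Icc 1 R).filter (fun l => Squarefree l ∧ ∀ p : ℕ, p.Prime → p ∣ l → z ≤ p)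

noncomputable def sG (z R : ℕ) : ℝ := ∑ l ∈ sL z R, (1:ℝ) / l

lemma mem_sL {z R l : ℕ} : l ∈ sL z R ↔ (1 ≤ l ∧ l ≤ R) ∧ Squarefree l ∧ ∀ p : ℕ, p.Prime → p ∣ l → z ≤ p := by
  simp [sL]

lemma sL_dvd_sum (z R p : ℕ) (hp : p.Prime) :
    ∑ l ∈ (sL z R).filter (fun l => p ∣ l), (1:ℝ) / l ≤ 1 / p * ∑ l ∈ (sL z R).filter (fun l => ¬ p ∣ l), (1:ℝ) / l := by
  rw [Finset.mul_sum]
  have hsub : (sL z R).filter (fun l => p ∣ l) ⊆ ((sL z R).filter (fun l => ¬ p ∣ l)).image (fun l => p * l) := by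
    intro l hl
    rw [Finset.mem_filter, mem_sL] at hl
    obtain ⟨⟨⟨h1, h2⟩, h3, h4⟩, k, rfl⟩ := hl
    rw [Finset.mem_image]
    refine ⟨k, ?_, rfl⟩
    rw [Finset.mem_filter, mem_sL]
    have hp1 := hp.pos
    have hk : 1 ≤ k := Nat.pos_of_ne_zero (by rintro rfl; simp at h1)
    refine ⟨⟨⟨hk, ?_⟩, h3.of_mul_right, fun q hq hd => h4 q hq (hd.mul_left p)⟩, ?_⟩
    · exact le_trans (Nat.le_mul_of_pos_left k hp1) h2
    · rintro ⟨j, rfl⟩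
      have := h3 p ⟨j, by ring⟩
      exact hp.one_lt.ne' (Nat.isUnit_iff.1 this)
  refine (Finset.sum_le_sum_of_subset_of_nonneg hsub fun _ _ _ => by positivity).trans ?_
  refine (Finset.sum_image_le_of_nonneg fun _ _ => by positivity).trans (le_of_eq ?_)
  refine Finset.sum_congr rfl fun l _ => ?_
  push_cast
  rw [one_div_mul_one_div]

lemma sL_dvd_sum_le (z R p : ℕ) (hp : p.Prime) :
    ∑ l ∈ (sL z R).filter (fun l => p ∣ l), (1:ℝ) / l ≤ sG z R / p := by
  refine (sL_dvd_sum z R p hp).trans ?_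
  rw [div_eq_mul_one_div (sG z R), mul_comm]
  refine mul_le_mul_of_nonneg_right ?_ (by positivity)
  exact Finset.sum_le_sum_of_subset_of_nonneg (Finset.filter_subset _ _) fun _ _ _ => by positivity

lemma sG_nonneg (z R : ℕ) : 0 ≤ sG z R := Finset.sum_nonneg fun _ _ => by positivity

lemma one_le_sG (z R : ℕ) (hR : 1 ≤ R) : 1 ≤ sG z R := by
  have : (1:ℕ) ∈ sL z R := by
    rw [mem_sL]
    refine ⟨⟨le_rfl, hR⟩, squarefree_one, fun p hp hd => ?_⟩
    exact absurd (Nat.dvd_one.1 hd) hp.one_lt.ne'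
  have h := Finset.single_le_sum (f := fun l : ℕ => (1:ℝ) / l) (fun _ _ => by positivity) this
  simpa [sG] using h

lemma sG_step (z R : ℕ) (hz : z.Prime) : sG z R ≤ (1 + 1 / z) * sG (z + 1) R := by
  have h1 := sL_dvd_sum z R z hz
  have h2 : ∑ l ∈ (sL z R).filter (fun l => ¬ z ∣ l), (1:ℝ) / l ≤ sG (z + 1) R := by
    refine Finset.sum_le_sum_of_subset_of_nonneg ?_ fun _ _ _ => by positivity
    intro l hl
    rw [Finset.mem_filter, mem_sL] at hl
    rw [mem_sL]
    refine ⟨hl.1.1, hl.1.2.1, fun p hp hd => ?_⟩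
    rcases (hl.1.2.2 p hp hd).lt_or_eq with h | h
    · exact h
    · exact absurd (h ▸ hd) hl.2
  have h3 : sG z R = ∑ l ∈ (sL z R).filter (fun l => z ∣ l), (1:ℝ) / l + ∑ l ∈ (sL z R).filter (fun l => ¬ z ∣ l), (1:ℝ) / l :=
    (Finset.sum_filter_add_sum_filter_not _ _ _).symm
  have hz0 : (0:ℝ) ≤ 1 / z := by positivity
  rw [h3]
  nlinarith

lemma sG_step' (z R : ℕ) (hz : ¬ z.Prime) : sG z R ≤ sG (z + 1) R := by
  refine Finset.sum_le_sum_of_subset_of_nonneg ?_ fun _ _ _ => by positivity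
  intro l hl
  rw [mem_sL] at hl ⊢
  refine ⟨hl.1, hl.2.1, fun p hp hd => ?_⟩
  rcases (hl.2.2 p hp hd).lt_or_eq with h | h
  · exact h
  · exact absurd (h ▸ hp) hz

lemma sG_zero_le (z R : ℕ) : sG 0 R ≤ Real.exp (∑ p ∈ (Finset.range z).filter Nat.Prime, (1:ℝ) / p) * sG z R := by
  induction z with
  | zero => simp
  | succ z ih =>
    rw [Finset.range_add_one, Finset.filter_insert]
    split_ifs with hz
    · rw [Finset.sum_insert (by simp), Real.exp_add]
      have h1 := sG_step z R hz
      have h2 : 1 + (1:ℝ) / z ≤ Real.exp (1 / z) := by linarith [Real.add_one_le_exp ((1:ℝ) / z)]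
      have h3 := sG_nonneg (z + 1) R
      calc sG 0 R ≤ _ := ih
        _ ≤ Real.exp (∑ p ∈ (Finset.range z).filter Nat.Prime, (1:ℝ) / p) * (Real.exp (1 / z) * sG (z + 1) R) := by
            gcongr
            exact h1.trans (mul_le_mul_of_nonneg_right h2 h3)
        _ = _ := by ring
    · refine ih.trans ?_
      gcongr
      exact sG_step' z R hz

lemma sum_inv_sq_le (n : ℕ) : ∑ d ∈ Finset.Icc 1 n, (1:ℝ) / (d:ℝ) ^ 2 ≤ 2 := by
  have : ∀ n : ℕ, ∑ d ∈ Finset.Icc 1 (n + 1), (1:ℝ) / (d:ℝ) ^ 2 ≤ 2 - 1 / (n + 1 : ℝ) := by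
    intro n
    induction n with
    | zero => norm_num
    | succ n ih =>
      rw [Finset.sum_Icc_succ_top (by omega)]
      have : (1:ℝ) / ((n + 1 + 1 : ℕ) : ℝ) ^ 2 ≤ 1 / (n + 1 : ℝ) - 1 / (n + 1 + 1 : ℝ) := by
        rw [div_sub_div _ _ (by positivity) (by positivity), div_le_div_iff₀ (by positivity) (by positivity)]
        push_cast; nlinarith [(Nat.cast_nonneg n : (0:ℝ) ≤ n)]
      push_cast at this ih ⊢
      linarith
  rcases n with _ | n
  · simp
  · have h := this n
    have : (0:ℝ) ≤ 1 / (n + 1 : ℝ) := by positivity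
    linarith

lemma log_le_sG_zero (R : ℕ) : Real.log R ≤ 2 * sG 0 R := by
  rcases Nat.eq_zero_or_pos R with rfl | hR
  · simp [sG_nonneg]
  have h1 : Real.log R ≤ ∑ m ∈ Finset.Icc 1 R, (1:ℝ) / m := by
    have h := log_add_one_le_harmonic R
    rw [harmonic_eq_sum_Icc] at h
    push_cast at h
    have h2 : Real.log R ≤ Real.log (R + 1) := Real.log_le_log (by exact_mod_cast hR) (by linarith)
    simp only [one_div]
    linarith
  refine h1.trans ?_
  have hsub : Finset.Icc 1 R ⊆ ((Finset.Icc 1 R) ×ˢ (sL 0 R)).image (fun x : ℕ × ℕ => x.1 ^ 2 * x.2) := by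
    intro m hm
    obtain ⟨a, b, hab, ha⟩ := Nat.sq_mul_squarefree m
    rw [Finset.mem_Icc] at hm
    have hb : 1 ≤ b := Nat.pos_of_ne_zero (by rintro rfl; simp at hab; omega)
    have ha0 : 1 ≤ a := Nat.pos_of_ne_zero (by rintro rfl; simp at hab; omega)
    rw [Finset.mem_image]
    refine ⟨(b, a), ?_, hab⟩
    rw [Finset.mem_product, Finset.mem_Icc, mem_sL]
    have e1 : b ≤ b ^ 2 * a := by nlinarith [Nat.mul_le_mul (Nat.mul_le_mul hb hb) ha0]
    have e2 : a ≤ b ^ 2 * a := Nat.le_mul_of_pos_left a (by positivity)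
    exact ⟨⟨hb, by simp only; omega⟩, ⟨ha0, by simp only; omega⟩, ha, fun _ _ _ => Nat.zero_le _⟩
  refine (Finset.sum_le_sum_of_subset_of_nonneg hsub fun _ _ _ => by positivity).trans ?_
  refine (Finset.sum_image_le_of_nonneg fun _ _ => by positivity).trans ?_
  have : ∑ u ∈ (Finset.Icc 1 R) ×ˢ (sL 0 R), (1:ℝ) / ((u.1 ^ 2 * u.2 : ℕ) : ℝ) = (∑ d ∈ Finset.Icc 1 R, (1:ℝ) / (d:ℝ) ^ 2) * sG 0 R := by
    rw [sG, Finset.sum_mul_sum, Finset.sum_product]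
    refine Finset.sum_congr rfl fun d _ => Finset.sum_congr rfl fun l _ => ?_
    push_cast
    rw [one_div_mul_one_div]
  rw [this]
  exact mul_le_mul_of_nonneg_right (sum_inv_sq_le R) (sG_nonneg _ _)

lemma sum_log_div_prime (z : ℕ) (hz : 1 ≤ z) : ∑ p ∈ (Finset.Ioc 0 z).filter Nat.Prime, Real.log p / p ≤ Real.log z + Real.log 4 := by
  have hz0 : (0:ℝ) < z := by exact_mod_cast hz
  -- log z! type identity
  have h1 : ∑ n ∈ Finset.Ioc 0 z, Real.log n = ∑ d ∈ Finset.Ioc 0 z, ArithmeticFunction.vonMangoldt d * ((z / d : ℕ) : ℝ) := by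
    have : ∀ n ∈ Finset.Ioc 0 z, Real.log n = ∑ d ∈ Finset.Ioc 0 z, if d ∣ n then ArithmeticFunction.vonMangoldt d else 0 := by
      intro n hn
      rw [Finset.mem_Ioc] at hn
      rw [← ArithmeticFunction.vonMangoldt_sum, ← Finset.sum_filter]
      refine Finset.sum_congr ?_ fun _ _ => rfl
      ext d
      simp only [Nat.mem_divisors, Finset.mem_filter, Finset.mem_Ioc]
      constructor
      · rintro ⟨h, _⟩
        have := Nat.le_of_dvd hn.1 h
        exact ⟨⟨Nat.pos_of_dvd_of_pos h hn.1, by omega⟩, h⟩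
      · rintro ⟨_, h⟩; exact ⟨h, by omega⟩
    rw [Finset.sum_congr rfl this, Finset.sum_comm]
    refine Finset.sum_congr rfl fun d _ => ?_
    rw [← Finset.sum_filter, Finset.sum_const, Nat.Ioc_filter_dvd_card_eq_div, nsmul_eq_mul, mul_comm]
  have h2 : ∑ n ∈ Finset.Ioc 0 z, Real.log n ≤ z * Real.log z := by
    have := Finset.sum_le_card_nsmul (Finset.Ioc 0 z) (fun n : ℕ => Real.log n) (Real.log z) (by
      intro n hn
      rw [Finset.mem_Ioc] at hn
      exact Real.log_le_log (by exact_mod_cast hn.1) (by exact_mod_cast hn.2))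
    simpa using this
  have h3 : ∑ p ∈ (Finset.Ioc 0 z).filter Nat.Prime, Real.log p * ((z / p : ℕ) : ℝ) ≤
      ∑ d ∈ Finset.Ioc 0 z, ArithmeticFunction.vonMangoldt d * ((z / d : ℕ) : ℝ) := by
    have : ∑ p ∈ (Finset.Ioc 0 z).filter Nat.Prime, Real.log p * ((z / p : ℕ) : ℝ) = ∑ p ∈ (Finset.Ioc 0 z).filter Nat.Prime, ArithmeticFunction.vonMangoldt p * ((z / p : ℕ) : ℝ) := by
      refine Finset.sum_congr rfl fun p hp => ?_
      rw [ArithmeticFunction.vonMangoldt_apply_prime (Finset.mem_filter.1 hp).2]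
    rw [this]
    exact Finset.sum_le_sum_of_subset_of_nonneg (Finset.filter_subset _ _) fun _ _ _ => mul_nonneg ArithmeticFunction.vonMangoldt_nonneg (by positivity)
  have h4 : ∑ p ∈ (Finset.Ioc 0 z).filter Nat.Prime, (Real.log p * (z / p) - Real.log p) ≤ ∑ p ∈ (Finset.Ioc 0 z).filter Nat.Prime, Real.log p * ((z / p : ℕ) : ℝ) := by
    refine Finset.sum_le_sum fun p hp => ?_
    have hpp := (Finset.mem_filter.1 hp).2
    have hl : 0 ≤ Real.log p := Real.log_natCast_nonneg p
    have hp0 : (0:ℝ) < p := by exact_mod_cast hpp.pos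
    have : (z:ℝ) / p ≤ ((z / p : ℕ) : ℝ) + 1 := by
      rw [div_le_iff₀ hp0]
      have h := Nat.lt_div_mul_add (a := z) hpp.pos
      have : z ≤ (z / p + 1) * p := by rw [add_mul]; omega
      exact_mod_cast this
    nlinarith
  have h5 : ∑ p ∈ (Finset.Ioc 0 z).filter Nat.Prime, Real.log p ≤ Real.log 4 * z := by
    have := Chebyshev.theta_le_log4_mul_x (x := (z:ℝ)) hz0.le
    rwa [Chebyshev.theta, Nat.floor_natCast] at this
  rw [Finset.sum_sub_distrib] at h4
  have h6 : ∑ p ∈ (Finset.Ioc 0 z).filter Nat.Prime, Real.log p * (z / p) = z * ∑ p ∈ (Finset.Ioc 0 z).filter Nat.Prime, Real.log p / p := by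
    rw [Finset.mul_sum]; refine Finset.sum_congr rfl fun p _ => by ring
  rw [h6] at h4
  have h7 : (z:ℝ) * ∑ p ∈ (Finset.Ioc 0 z).filter Nat.Prime, Real.log p / p ≤ z * (Real.log z + Real.log 4) := by linarith
  exact le_of_mul_le_mul_left h7 hz0

lemma sum_inv_prime (κ : ℝ) (hκ : 0 < κ) : ∃ C : ℝ, ∀ z : ℕ, 1 ≤ z →
    ∑ p ∈ (Finset.range z).filter Nat.Prime, (1:ℝ) / p ≤ κ * Real.log z + C := by
  obtain ⟨y, hy⟩ : ∃ y : ℕ, 2 ≤ y ∧ 1 / κ ≤ Real.log y := by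
    have h := (Real.tendsto_log_atTop.comp tendsto_natCast_atTop_atTop).eventually_ge_atTop (1 / κ)
    obtain ⟨y, hy⟩ := ((eventually_ge_atTop 2).and h).exists
    exact ⟨y, hy.1, hy.2⟩
  obtain ⟨hy2, hyk⟩ := hy
  refine ⟨y + κ * Real.log 4, fun z hz => ?_⟩
  have hly : 0 < Real.log y := lt_of_lt_of_le (by positivity) hyk
  have hk1 : 1 ≤ κ * Real.log y := by rwa [div_le_iff₀' hκ] at hyk
  have hm := sum_log_div_prime z hz
  have hpt : ∀ p ∈ (Finset.Ioc 0 z).filter Nat.Prime, (1:ℝ) / p ≤ (if p < y then 1 else 0) + κ * (Real.log p / p) := by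
    intro p hp
    have hpp := (Finset.mem_filter.1 hp).2
    have hp1 : (1:ℝ) ≤ p := by exact_mod_cast hpp.one_le
    have hl : 0 ≤ Real.log p := Real.log_natCast_nonneg p
    split_ifs with h
    · have : (1:ℝ) / p ≤ 1 := by rw [div_le_one (by linarith)]; exact hp1
      have : 0 ≤ κ * (Real.log p / p) := by positivity
      linarith
    · push Not at h
      have : Real.log y ≤ Real.log p := Real.log_le_log (by positivity) (by exact_mod_cast h)
      rw [zero_add, mul_div_assoc']
      apply div_le_div_of_nonneg_right _ (by linarith)
      nlinarith
  have h1 : ∑ p ∈ (Finset.range z).filter Nat.Prime, (1:ℝ) / p ≤ ∑ p ∈ (Finset.Ioc 0 z).filter Nat.Prime, (1:ℝ) / p := by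
    refine Finset.sum_le_sum_of_subset_of_nonneg ?_ fun _ _ _ => by positivity
    intro p hp
    simp only [Finset.mem_filter, Finset.mem_range, Finset.mem_Ioc] at hp ⊢
    exact ⟨⟨hp.2.pos, hp.1.le⟩, hp.2⟩
  refine h1.trans ((Finset.sum_le_sum hpt).trans ?_)
  rw [Finset.sum_add_distrib, ← Finset.mul_sum]
  have h2 : ∑ p ∈ (Finset.Ioc 0 z).filter Nat.Prime, (if p < y then (1:ℝ) else 0) ≤ y := by
    rw [← Finset.sum_filter, Finset.sum_const, nsmul_eq_mul, mul_one]
    have : (((Finset.Ioc 0 z).filter Nat.Prime).filter (fun p => p < y)).card ≤ (Finset.range y).card := by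
      apply Finset.card_le_card
      intro p hp
      rw [Finset.mem_filter] at hp
      exact Finset.mem_range.2 hp.2
    rw [Finset.card_range] at this
    exact_mod_cast this
  nlinarith

theorem sG_lower (κ : ℝ) (hκ : 0 < κ) : ∃ C > 0, ∀ z R : ℕ, 1 ≤ z → Real.log R ≤ C * (z:ℝ) ^ κ * sG z R := by
  obtain ⟨C, hC⟩ := sum_inv_prime κ hκ
  refine ⟨2 * Real.exp C, by positivity, fun z R hz => ?_⟩
  have hz0 : (0:ℝ) < z := by exact_mod_cast hz
  have h1 := log_le_sG_zero R
  have h2 := sG_zero_le z R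
  have h3 : Real.exp (∑ p ∈ (Finset.range z).filter Nat.Prime, (1:ℝ) / p) ≤ Real.exp C * (z:ℝ) ^ κ := by
    rw [Real.rpow_def_of_pos hz0, ← Real.exp_add]
    apply Real.exp_le_exp.2
    have := hC z hz
    linarith
  have h4 := mul_le_mul_of_nonneg_right h3 (sG_nonneg z R)
  linarith

lemma e_eq_one_iff (t : ℝ) : e t = 1 ↔ ∃ k : ℤ, t = k := by
  rw [e, Complex.exp_eq_one_iff]
  refine exists_congr fun k => ?_
  have h : (2 * (π:ℂ) * Complex.I) ≠ 0 := Complex.two_pi_I_ne_zero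
  constructor
  · intro hk
    have : (2 * (π:ℂ) * Complex.I) * t = (2 * (π:ℂ) * Complex.I) * k := by rw [hk]; ring
    exact_mod_cast mul_left_cancel₀ h this
  · rintro rfl
    push_cast; ring

noncomputable def rS (p l : ℕ) : ℂ := ∑ a ∈ (Finset.range l).filter (fun a => l.Coprime a), e ((p:ℝ) * ((a:ℝ) / l))

lemma sum_rS (p l : ℕ) (hl : 0 < l) : ∑ d ∈ l.divisors, rS p d = ∑ a ∈ Finset.range l, e ((p:ℝ) * ((a:ℝ) / l)) := by
  simp only [rS]
  rw [Finset.sum_sigma']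
  refine Finset.sum_bij' (fun x _ => x.2 * (l / x.1)) (fun a _ => ⟨l / Nat.gcd l a, a / Nat.gcd l a⟩) ?_ ?_ ?_ ?_ ?_
  · rintro ⟨d, b⟩ h
    simp only [Finset.mem_sigma, Nat.mem_divisors, Finset.mem_filter, Finset.mem_range] at h ⊢
    obtain ⟨⟨⟨k, rfl⟩, h2⟩, h3, h4⟩ := h
    have hd : 0 < d := by omega
    have hk : 0 < k := Nat.pos_of_ne_zero (by rintro rfl; simp at hl)
    rw [Nat.mul_div_cancel_left _ hd]
    exact Nat.mul_lt_mul_of_pos_right h3 hk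
  · intro a h
    simp only [Finset.mem_sigma, Nat.mem_divisors, Finset.mem_filter, Finset.mem_range] at h ⊢
    have hg : 0 < Nat.gcd l a := Nat.gcd_pos_of_pos_left _ hl
    refine ⟨⟨Nat.div_dvd_of_dvd (Nat.gcd_dvd_left l a), hl.ne'⟩, ?_, Nat.coprime_div_gcd_div_gcd hg⟩
    exact Nat.div_lt_div_of_lt_of_dvd (Nat.gcd_dvd_left l a) h
  · rintro ⟨d, b⟩ h
    simp only [Finset.mem_sigma, Nat.mem_divisors, Finset.mem_filter, Finset.mem_range] at h ⊢
    obtain ⟨⟨⟨k, rfl⟩, h2⟩, h3, h4⟩ := h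
    have hd : 0 < d := by omega
    have hk : 0 < k := Nat.pos_of_ne_zero (by rintro rfl; simp at hl)
    have hg : Nat.gcd (d * k) (b * (d * k / d)) = k := by
      rw [Nat.mul_div_cancel_left _ hd, Nat.gcd_mul_right, h4, one_mul]
    rw [hg, Nat.mul_div_cancel_left _ hd, Nat.mul_div_cancel _ hk, Nat.mul_div_cancel _ hk]
  · intro a h
    have hg : 0 < Nat.gcd l a := Nat.gcd_pos_of_pos_left _ hl
    simp only
    rw [Nat.div_div_self (Nat.gcd_dvd_left l a) hl.ne', Nat.div_mul_cancel (Nat.gcd_dvd_right l a)]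
  · rintro ⟨d, b⟩ h
    simp only [Finset.mem_sigma, Nat.mem_divisors, Finset.mem_filter, Finset.mem_range] at h ⊢
    obtain ⟨⟨⟨k, rfl⟩, h2⟩, h3, h4⟩ := h
    have hd : 0 < d := by omega
    have hk : 0 < k := Nat.pos_of_ne_zero (by rintro rfl; simp at hl)
    rw [Nat.mul_div_cancel_left _ hd]
    congr 2
    push_cast
    have : (k:ℝ) ≠ 0 := by exact_mod_cast hk.ne'
    field_simp

lemma geom_root (p l : ℕ) (hl : 0 < l) (h : Nat.Coprime p l) :
    ∑ a ∈ Finset.range l, e ((p:ℝ) * ((a:ℝ) / l)) = if l = 1 then 1 else 0 := by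
  split_ifs with h1
  · subst h1; simp [e_zero]
  · have e1 : ∀ a : ℕ, e ((p:ℝ) * ((a:ℝ) / l)) = e ((p:ℝ) / l) ^ a := by
      intro a
      rw [← e_nat_mul]; congr 1; ring
    simp only [e1]
    have hl0 : (l:ℝ) ≠ 0 := by exact_mod_cast hl.ne'
    have hne : e ((p:ℝ) / l) ≠ 1 := by
      rw [Ne, e_eq_one_iff]
      rintro ⟨k, hk⟩
      rw [div_eq_iff hl0] at hk
      have hk2 : (p:ℤ) = k * l := by exact_mod_cast hk
      have : (l:ℤ) ∣ p := ⟨k, by rw [hk2]; ring⟩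
      have : l ∣ p := by exact_mod_cast this
      exact h1 (Nat.Coprime.eq_one_of_dvd h.symm this)
    rw [geom_sum_eq hne, ← e_nat_mul, mul_div_cancel₀ _ hl0, e_nat, sub_self, zero_div]

theorem rS_eq (p l : ℕ) (hl : 0 < l) (h : Nat.Coprime p l) : rS p l = (ArithmeticFunction.moebius l : ℂ) := by
  have := (ArithmeticFunction.sum_eq_iff_sum_mul_moebius_eq_on (R := ℂ) (f := rS p) (g := fun l => if l = 1 then 1 else 0)
    {l | Nat.Coprime p l} (fun m n hmn hn => Nat.Coprime.coprime_dvd_right hmn hn)).1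
    (fun n hn hc => by rw [sum_rS p n hn, geom_root p n hn hc]) l hl h
  rw [← this]
  rw [Finset.sum_eq_single (l, 1)]
  · simp
  · rintro ⟨a, b⟩ hab hne
    rw [Nat.mem_divisorsAntidiagonal] at hab
    have : b ≠ 1 := by
      rintro rfl
      apply hne
      simp at hab
      simp [hab.1]
    simp [this]
  · intro h'
    exfalso; apply h'
    rw [Nat.mem_divisorsAntidiagonal]
    exact ⟨by simp, hl.ne'⟩


noncomputable def sI (z R : ℕ) : Finset (Σ _ : ℕ, ℕ) := (sL z R).sigma (fun l => (Finset.range l).filter (fun a => l.Coprime a))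

noncomputable def sx (i : Σ _ : ℕ, ℕ) : ℝ := (i.2 : ℝ) / i.1

noncomputable def sb (i : Σ _ : ℕ, ℕ) : ℝ := (ArithmeticFunction.moebius i.1 : ℝ) / i.1

noncomputable def sA (z R : ℕ) (n : ℕ) : ℂ := ∑ i ∈ sI z R, (sb i : ℂ) * e ((n:ℝ) * sx i)

lemma mem_sI {z R : ℕ} {i : Σ _ : ℕ, ℕ} : i ∈ sI z R ↔ i.1 ∈ sL z R ∧ i.2 < i.1 ∧ Nat.Coprime i.1 i.2 := by
  rw [sI, Finset.mem_sigma, Finset.mem_filter, Finset.mem_range]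

lemma sA_prime (z R p : ℕ) (hp : p.Prime) (hR : R < p) : sA z R p = (sG z R : ℂ) := by
  rw [sA, sI, Finset.sum_sigma, sG]
  push_cast
  refine Finset.sum_congr rfl fun l hl => ?_
  rw [mem_sL] at hl
  have hc : Nat.Coprime p l := (Nat.coprime_of_lt_prime (n := l) (p := p) (by omega) (by omega) hp)
  have h := rS_eq p l hl.1.1 hc
  have hm : ((ArithmeticFunction.moebius l : ℂ)) * (ArithmeticFunction.moebius l : ℂ) = 1 := by
    have := ArithmeticFunction.moebius_sq_eq_one_of_squarefree hl.2.1
    have h2 : ((ArithmeticFunction.moebius l : ℤ) : ℂ) ^ 2 = 1 := by exact_mod_cast congrArg (Int.cast : ℤ → ℂ) this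
    rw [← sq]; exact h2
  simp only [sb, sx]
  rw [← Finset.mul_sum]
  change _ * rS p l = _
  rw [h]
  push_cast
  rw [div_mul_eq_mul_div, hm]

lemma abs_sb_le (i : Σ _ : ℕ, ℕ) : |sb i| ≤ 1 / i.1 := by
  rw [sb, abs_div, Nat.abs_cast]
  apply div_le_div_of_nonneg_right _ (by positivity)
  have := ArithmeticFunction.abs_moebius_le_one (n := i.1)
  exact_mod_cast this

lemma sum_sb_sq (z R : ℕ) (Q : ℕ → Prop) [DecidablePred Q] : ∑ i ∈ (sI z R).filter (fun i => Q i.1), sb i ^ 2 ≤ ∑ l ∈ (sL z R).filter Q, (1:ℝ) / l := by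
  have e1 : (sI z R).filter (fun i => Q i.1) = ((sL z R).filter Q).sigma (fun l => (Finset.range l).filter (fun a => l.Coprime a)) := by
    ext i; simp only [sI, Finset.mem_filter, Finset.mem_sigma]; tauto
  rw [e1, Finset.sum_sigma]
  refine Finset.sum_le_sum fun l hl => ?_
  rw [Finset.mem_filter, mem_sL] at hl
  have hl0 : (0:ℝ) < l := by exact_mod_cast hl.1.1.1
  have : ∀ a ∈ (Finset.range l).filter (fun a => l.Coprime a), sb ⟨l, a⟩ ^ 2 ≤ 1 / (l:ℝ) ^ 2 := by
    intro a _
    have := abs_sb_le ⟨l, a⟩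
    rw [← sq_abs, ← one_div_pow]
    exact pow_le_pow_left₀ (abs_nonneg _) this 2
  refine (Finset.sum_le_card_nsmul _ _ _ this).trans ?_
  rw [nsmul_eq_mul]
  have hc : (((Finset.range l).filter (fun a => l.Coprime a)).card : ℝ) ≤ l := by
    have := Finset.card_filter_le (Finset.range l) (fun a => l.Coprime a)
    rw [Finset.card_range] at this
    exact_mod_cast this
  calc _ ≤ (l:ℝ) * (1 / (l:ℝ) ^ 2) := by gcongr
    _ = _ := by field_simp

lemma sum_abs_sb (z R : ℕ) : ∑ i ∈ sI z R, |sb i| ≤ R := by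
  rw [sI, Finset.sum_sigma]
  have : ∀ l ∈ sL z R, ∑ a ∈ (Finset.range l).filter (fun a => l.Coprime a), |sb ⟨l, a⟩| ≤ 1 := by
    intro l hl
    rw [mem_sL] at hl
    have hl0 : (0:ℝ) < l := by exact_mod_cast hl.1.1
    refine (Finset.sum_le_card_nsmul _ _ (1 / (l:ℝ)) fun a _ => abs_sb_le ⟨l, a⟩).trans ?_
    rw [nsmul_eq_mul]
    have hc : (((Finset.range l).filter (fun a => l.Coprime a)).card : ℝ) ≤ l := by
      have := Finset.card_filter_le (Finset.range l) (fun a => l.Coprime a)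
      rw [Finset.card_range] at this
      exact_mod_cast this
    calc _ ≤ (l:ℝ) * (1 / (l:ℝ)) := by gcongr
      _ = _ := by field_simp
  refine (Finset.sum_le_card_nsmul _ _ 1 this).trans ?_
  rw [nsmul_eq_mul, mul_one]
  have hc := Finset.card_filter_le (Finset.Icc 1 R) (fun l => Squarefree l ∧ ∀ p : ℕ, p.Prime → p ∣ l → z ≤ p)
  rw [Nat.card_Icc, Nat.add_sub_cancel] at hc
  exact_mod_cast hc

lemma sx_inj {z R : ℕ} {i j : Σ _ : ℕ, ℕ} (hi : i ∈ sI z R) (hj : j ∈ sI z R) (k : ℤ) (h : sx i = sx j + k) : i = j := by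
  rw [mem_sI, mem_sL] at hi hj
  obtain ⟨l, a⟩ := i
  obtain ⟨l', a'⟩ := j
  simp only [sx] at *
  obtain ⟨⟨⟨h1, -⟩, -⟩, h2, h3⟩ := hi
  obtain ⟨⟨⟨h1', -⟩, -⟩, h2', h3'⟩ := hj
  have l0 : (0:ℝ) < l := by exact_mod_cast h1
  have l0' : (0:ℝ) < l' := by exact_mod_cast h1'
  have b1 : (a:ℝ) / l < 1 := by rw [div_lt_one l0]; exact_mod_cast h2
  have b2 : (a':ℝ) / l' < 1 := by rw [div_lt_one l0']; exact_mod_cast h2'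
  have b3 : 0 ≤ (a:ℝ) / l := by positivity
  have b4 : 0 ≤ (a':ℝ) / l' := by positivity
  have k0 : k = 0 := by
    have u1 : (k:ℝ) < 1 := by linarith
    have u2 : (-1:ℝ) < k := by linarith
    have u1' : k < 1 := by exact_mod_cast u1
    have u2' : -1 < k := by exact_mod_cast u2
    omega
  subst k0
  rw [Int.cast_zero, add_zero, div_eq_div_iff l0.ne' l0'.ne'] at h
  have h' : a * l' = a' * l := by exact_mod_cast h
  have d1 : l ∣ l' := (Nat.Coprime.dvd_of_dvd_mul_left h3 (Dvd.intro_left a' h'.symm))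
  have d2 : l' ∣ l := (Nat.Coprime.dvd_of_dvd_mul_left h3' (Dvd.intro_left a h'))
  have el := Nat.dvd_antisymm d1 d2
  subst el
  have := Nat.eq_of_mul_eq_mul_right h1 h'
  rw [this]

lemma near_same {z R : ℕ} {i j i' j' : Σ _ : ℕ, ℕ} (hi : i ∈ sI z R) (hj : j ∈ sI z R) (hi' : i' ∈ sI z R) (hj' : j' ∈ sI z R)
    (θ : ℝ) (k k' : ℤ) (h : |sx i - sx j + θ - k| < 1 / (2 * (R:ℝ) ^ 4)) (h' : |sx i' - sx j' + θ - k'| < 1 / (2 * (R:ℝ) ^ 4)) :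
    sx i - sx j = sx i' - sx j' + ((k - k' : ℤ) : ℝ) := by
  rw [mem_sI, mem_sL] at hi hj hi' hj'
  obtain ⟨l1, a1⟩ := i
  obtain ⟨l2, a2⟩ := j
  obtain ⟨l3, a3⟩ := i'
  obtain ⟨l4, a4⟩ := j'
  simp only [sx] at *
  obtain ⟨⟨⟨p1, q1⟩, -⟩, -⟩ := hi
  obtain ⟨⟨⟨p2, q2⟩, -⟩, -⟩ := hj
  obtain ⟨⟨⟨p3, q3⟩, -⟩, -⟩ := hi'
  obtain ⟨⟨⟨p4, q4⟩, -⟩, -⟩ := hj'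
  have hD : (l1 * l2 * l3 * l4 : ℝ) ≤ (R:ℝ) ^ 4 := by
    have : l1 * l2 * l3 * l4 ≤ R * R * R * R := by gcongr
    have : l1 * l2 * l3 * l4 ≤ R ^ 4 := by linarith [this, (by ring : R * R * R * R = R ^ 4)]
    exact_mod_cast this
  have c1 : (0:ℝ) < l1 := by exact_mod_cast p1
  have c2 : (0:ℝ) < l2 := by exact_mod_cast p2
  have c3 : (0:ℝ) < l3 := by exact_mod_cast p3
  have c4 : (0:ℝ) < l4 := by exact_mod_cast p4
  set y := (a1:ℝ) / l1 - a2 / l2 - (a3 / l3 - a4 / l4) - ((k - k' : ℤ) : ℝ) with hy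
  have hR : (0:ℝ) < (R:ℝ) ^ 4 := lt_of_lt_of_le (by positivity) hD
  have hyl : |y| < 1 / (R:ℝ) ^ 4 := by
    have e1 : y = ((a1:ℝ) / l1 - a2 / l2 + θ - k) - (a3 / l3 - a4 / l4 + θ - k') := by
      rw [hy]; push_cast; ring
    rw [e1]
    have e2 : 1 / (R:ℝ) ^ 4 = 1 / (2 * (R:ℝ) ^ 4) + 1 / (2 * (R:ℝ) ^ 4) := by field_simp; norm_num
    rw [e2]
    exact lt_of_le_of_lt (abs_sub _ _) (add_lt_add h h')
  have hyint : y * (l1 * l2 * l3 * l4) = (((a1:ℤ) * l2 * l3 * l4 - a2 * l1 * l3 * l4 - (a3 * l1 * l2 * l4 - a4 * l1 * l2 * l3) - (k - k') * (l1 * l2 * l3 * l4) : ℤ) : ℝ) := by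
    rw [hy]; push_cast; field_simp
  have hlt : |y * (l1 * l2 * l3 * l4)| < 1 := by
    rw [abs_mul, abs_of_pos (by positivity : (0:ℝ) < l1 * l2 * l3 * l4)]
    calc |y| * (l1 * l2 * l3 * l4) ≤ |y| * (R:ℝ) ^ 4 := by gcongr
      _ < 1 / (R:ℝ) ^ 4 * (R:ℝ) ^ 4 := by gcongr
      _ = 1 := div_mul_cancel₀ _ hR.ne'
  rw [hyint] at hlt
  have hz : ((a1:ℤ) * l2 * l3 * l4 - a2 * l1 * l3 * l4 - (a3 * l1 * l2 * l4 - a4 * l1 * l2 * l3) - (k - k') * (l1 * l2 * l3 * l4) : ℤ) = 0 := by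
    have : |((a1:ℤ) * l2 * l3 * l4 - a2 * l1 * l3 * l4 - (a3 * l1 * l2 * l4 - a4 * l1 * l2 * l3) - (k - k') * (l1 * l2 * l3 * l4) : ℤ)| < 1 := by
      exact_mod_cast hlt
    exact Int.abs_lt_one_iff.1 this
  rw [hz, Int.cast_zero] at hyint
  have hy0 : y = 0 := by
    rcases mul_eq_zero.1 hyint with h | h
    · exact h
    · exact absurd h (by positivity)
  rw [hy] at hy0
  linarith

lemma den_dvd_pair {i j : Σ _ : ℕ, ℕ} (hi : 1 ≤ i.1) (hj : 1 ≤ j.1) (q : ℚ) (h : sx i - sx j = (q:ℝ)) : q.den ∣ i.1 * j.1 := by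
  obtain ⟨l1, a1⟩ := i
  obtain ⟨l2, a2⟩ := j
  simp only [sx] at *
  have c1 : (l1:ℚ) ≠ 0 := by positivity
  have c2 : (l2:ℚ) ≠ 0 := by positivity
  have hq : q = (((a1:ℤ) * l2 - a2 * l1 : ℤ) : ℚ) / ((l1 * l2 : ℤ) : ℚ) := by
    have : ((a1:ℝ) / l1 - a2 / l2) = (((a1:ℚ) / l1 - a2 / l2 : ℚ) : ℝ) := by push_cast; rfl
    rw [this] at h
    have h' : (a1:ℚ) / l1 - a2 / l2 = q := by exact_mod_cast h
    rw [← h']; push_cast; field_simp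
  have := Rat.den_dvd ((a1:ℤ) * l2 - a2 * l1) (l1 * l2 : ℤ)
  rw [hq]
  exact_mod_cast this

lemma near_half (s : Finset ((Σ _ : ℕ, ℕ) × (Σ _ : ℕ, ℕ))) (I J : Finset (Σ _ : ℕ, ℕ)) (t U V : ℝ) (ht : 0 < t)
    (h1 : ∀ x ∈ s, x.1 ∈ I) (h2 : ∀ x ∈ s, x.2 ∈ J) (i1 : Set.InjOn Prod.fst (s : Set ((Σ _ : ℕ, ℕ) × (Σ _ : ℕ, ℕ))))
    (i2 : Set.InjOn Prod.snd (s : Set ((Σ _ : ℕ, ℕ) × (Σ _ : ℕ, ℕ)))) (hU : ∑ i ∈ I, sb i ^ 2 ≤ U) (hV : ∑ i ∈ J, sb i ^ 2 ≤ V) :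
    ∑ x ∈ s, |sb x.1| * |sb x.2| ≤ (t * U + V / t) / 2 := by
  have key : ∀ x ∈ s, |sb x.1| * |sb x.2| ≤ t / 2 * sb x.1 ^ 2 + 1 / (2 * t) * sb x.2 ^ 2 := by
    intro x _
    have h := sq_nonneg (t * |sb x.1| - |sb x.2|)
    rw [← sq_abs (sb x.1), ← sq_abs (sb x.2)]
    have e : t / 2 * |sb x.1| ^ 2 + 1 / (2 * t) * |sb x.2| ^ 2 - |sb x.1| * |sb x.2| = (t * |sb x.1| - |sb x.2|) ^ 2 / (2 * t) := by
      field_simp; ring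
    have : 0 ≤ (t * |sb x.1| - |sb x.2|) ^ 2 / (2 * t) := by positivity
    linarith
  refine (Finset.sum_le_sum key).trans ?_
  rw [Finset.sum_add_distrib, ← Finset.mul_sum, ← Finset.mul_sum]
  have b1 : ∑ x ∈ s, sb x.1 ^ 2 ≤ U := by
    rw [← Finset.sum_image (f := fun i => sb i ^ 2) (g := Prod.fst) i1]
    refine (Finset.sum_le_sum_of_subset_of_nonneg ?_ fun _ _ _ => by positivity).trans hU
    intro i hi
    obtain ⟨x, hx, rfl⟩ := Finset.mem_image.1 hi
    exact h1 x hx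
  have b2 : ∑ x ∈ s, sb x.2 ^ 2 ≤ V := by
    rw [← Finset.sum_image (f := fun i => sb i ^ 2) (g := Prod.snd) i2]
    refine (Finset.sum_le_sum_of_subset_of_nonneg ?_ fun _ _ _ => by positivity).trans hV
    intro i hi
    obtain ⟨x, hx, rfl⟩ := Finset.mem_image.1 hi
    exact h2 x hx
  calc _ ≤ t / 2 * U + 1 / (2 * t) * V := by gcongr
    _ = _ := by field_simp

noncomputable def sNear (z R : ℕ) (θ : ℝ) : Finset ((Σ _ : ℕ, ℕ) × (Σ _ : ℕ, ℕ)) :=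
  ((sI z R) ×ˢ (sI z R)).filter (fun x => x.1 ≠ x.2 ∧ ∃ k : ℤ, |sx x.1 - sx x.2 + θ - k| < 1 / (2 * (R:ℝ) ^ 4))

theorem near_sum (z R : ℕ) (θ : ℝ) (hz : 1 ≤ z) : ∑ x ∈ sNear z R θ, |sb x.1| * |sb x.2| ≤ 2 * sG z R / √z := by
  have hz0 : (0:ℝ) < z := by exact_mod_cast hz
  have hG := sG_nonneg z R
  rcases (sNear z R θ).eq_empty_or_nonempty with he | ⟨x0, hx0⟩
  · rw [he, Finset.sum_empty]; positivity
  have hmem : ∀ x ∈ sNear z R θ, x.1 ∈ sI z R ∧ x.2 ∈ sI z R ∧ x.1 ≠ x.2 ∧ ∃ k : ℤ, |sx x.1 - sx x.2 + θ - k| < 1 / (2 * (R:ℝ) ^ 4) := by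
    intro x hx
    rw [sNear, Finset.mem_filter, Finset.mem_product] at hx
    exact ⟨hx.1.1, hx.1.2, hx.2⟩
  have hsame : ∀ x ∈ sNear z R θ, ∀ y ∈ sNear z R θ, ∃ k : ℤ, sx x.1 - sx x.2 = sx y.1 - sx y.2 + k := by
    intro x hx y hy
    obtain ⟨a1, a2, -, k, hk⟩ := hmem x hx
    obtain ⟨b1, b2, -, k', hk'⟩ := hmem y hy
    exact ⟨k - k', near_same a1 a2 b1 b2 θ k k' hk hk'⟩
  have i1 : Set.InjOn Prod.fst (sNear z R θ : Set ((Σ _ : ℕ, ℕ) × (Σ _ : ℕ, ℕ))) := by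
    intro x hx y hy hxy
    rw [Finset.mem_coe] at hx hy
    obtain ⟨k, hk⟩ := hsame x hx y hy
    have := sx_inj (hmem x hx).2.1 (hmem y hy).2.1 (-k) (by rw [hxy] at hk; push_cast; linarith)
    exact Prod.ext hxy this
  have i2 : Set.InjOn Prod.snd (sNear z R θ : Set ((Σ _ : ℕ, ℕ) × (Σ _ : ℕ, ℕ))) := by
    intro x hx y hy hxy
    rw [Finset.mem_coe] at hx hy
    obtain ⟨k, hk⟩ := hsame x hx y hy
    have := sx_inj (hmem x hx).1 (hmem y hy).1 k (by rw [hxy] at hk; linarith)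
    exact Prod.ext this hxy
  obtain ⟨a1, a2, hne, -⟩ := hmem x0 hx0
  set q : ℚ := (x0.1.2 : ℚ) / x0.1.1 - (x0.2.2 : ℚ) / x0.2.1 with hq
  have hq0 : sx x0.1 - sx x0.2 = (q:ℝ) := by rw [hq, sx, sx]; push_cast; rfl
  have hqden : q.den ≠ 1 := by
    intro h1
    have hqi : q = (q.num : ℚ) := ((Rat.den_eq_one_iff q).1 h1).symm
    apply hne
    refine sx_inj a1 a2 q.num ?_
    have : (q:ℝ) = (q.num : ℝ) := by exact_mod_cast congrArg (Rat.cast : ℚ → ℝ) hqi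
    linarith
  obtain ⟨p, hp, hpd⟩ := Nat.exists_prime_and_dvd hqden
  have hpair : ∀ x ∈ sNear z R θ, p ∣ x.1.1 ∨ p ∣ x.2.1 := by
    intro x hx
    obtain ⟨k, hk⟩ := hsame x hx x0 hx0
    have c1 := mem_sL.1 (mem_sI.1 (hmem x hx).1).1
    have c2 := mem_sL.1 (mem_sI.1 (hmem x hx).2.1).1
    have h := den_dvd_pair c1.1.1 c2.1.1 (q + k) (by rw [hk, hq0]; push_cast; rfl)
    rw [Rat.add_intCast_den] at h
    exact (Nat.Prime.dvd_mul hp).1 (hpd.trans h)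
  have hpz : (z:ℝ) ≤ p := by
    rcases hpair x0 hx0 with h | h
    · exact_mod_cast (mem_sL.1 (mem_sI.1 a1).1).2.2 p hp h
    · exact_mod_cast (mem_sL.1 (mem_sI.1 a2).1).2.2 p hp h
  have hsplit : ∑ x ∈ sNear z R θ, |sb x.1| * |sb x.2| ≤ ∑ x ∈ (sNear z R θ).filter (fun x => p ∣ x.1.1), |sb x.1| * |sb x.2| +
      ∑ x ∈ (sNear z R θ).filter (fun x => p ∣ x.2.1), |sb x.1| * |sb x.2| := by
    rw [Finset.sum_filter, Finset.sum_filter, ← Finset.sum_add_distrib]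
    refine Finset.sum_le_sum fun x hx => ?_
    have h0 : 0 ≤ |sb x.1| * |sb x.2| := by positivity
    rcases hpair x hx with h | h
    · rw [if_pos h]; split_ifs <;> linarith
    · rw [if_pos h]; split_ifs <;> linarith
  have hall : ∑ i ∈ sI z R, sb i ^ 2 ≤ sG z R := by
    have := sum_sb_sq z R (fun _ => True)
    simpa [sG] using this
  have hpI : ∑ i ∈ (sI z R).filter (fun i => p ∣ i.1), sb i ^ 2 ≤ sG z R / z := by
    have h2 := sum_sb_sq z R (fun l => p ∣ l)
    have h3 : sG z R / p ≤ sG z R / z := by gcongr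
    exact h2.trans ((sL_dvd_sum_le z R p hp).trans h3)
  have hs : 0 < √(z:ℝ) := Real.sqrt_pos.2 hz0
  have hss : √(z:ℝ) * √(z:ℝ) = z := Real.mul_self_sqrt hz0.le
  have p1 := near_half ((sNear z R θ).filter (fun x => p ∣ x.1.1)) ((sI z R).filter (fun i => p ∣ i.1)) (sI z R) (√z) _ _ hs
    (fun x hx => by
      rw [Finset.mem_filter] at hx ⊢
      exact ⟨(hmem x hx.1).1, hx.2⟩)
    (fun x hx => (hmem x (Finset.mem_filter.1 hx).1).2.1)
    (i1.mono (Finset.coe_subset.2 (Finset.filter_subset _ _)))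
    (i2.mono (Finset.coe_subset.2 (Finset.filter_subset _ _))) hpI hall
  have p2 := near_half ((sNear z R θ).filter (fun x => p ∣ x.2.1)) (sI z R) ((sI z R).filter (fun i => p ∣ i.1)) (1 / √z) _ _ (by positivity)
    (fun x hx => (hmem x (Finset.mem_filter.1 hx).1).1)
    (fun x hx => by
      rw [Finset.mem_filter] at hx ⊢
      exact ⟨(hmem x hx.1).2.1, hx.2⟩)
    (i1.mono (Finset.coe_subset.2 (Finset.filter_subset _ _)))
    (i2.mono (Finset.coe_subset.2 (Finset.filter_subset _ _))) hall hpI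
  have e1 : (√(z:ℝ) * (sG z R / z) + sG z R / √z) / 2 = sG z R / √z := by
    rw [show sG z R / (z:ℝ) = sG z R / (√z * √z) by rw [hss]]; field_simp; norm_num
  have e2 : (1 / √(z:ℝ) * sG z R + sG z R / z / (1 / √z)) / 2 = sG z R / √z := by
    rw [show sG z R / (z:ℝ) = sG z R / (√z * √z) by rw [hss]]; field_simp; norm_num
  rw [e1] at p1
  rw [e2] at p2
  calc _ ≤ _ := hsplit
    _ ≤ sG z R / √z + sG z R / √z := add_le_add p1 p2
    _ = _ := by ring

noncomputable def sV (B : Finset ℕ) (t : ℕ → ℝ) (k : ℤ) (θ : ℝ) : ℂ := ∑ n ∈ B, e (k * t n + n * θ)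

noncomputable def sD (M : ℕ) (t : ℝ) : ℂ := ∑ m ∈ Finset.range M, e ((m:ℝ) * t)

lemma sD_normsq (M : ℕ) (t : ℝ) : ((‖sD M t‖ ^ 2 : ℝ) : ℂ) = ∑ y ∈ Finset.range M ×ˢ Finset.range M, e ((((y.1:ℤ) - (y.2:ℤ) : ℤ) : ℝ) * t) := by
  push_cast
  rw [← Complex.mul_conj', sD, map_sum, Finset.sum_mul_sum, ← Finset.sum_product']
  refine Finset.sum_congr rfl fun y _ => ?_
  rw [← e_sub]; congr 1; ring

lemma sA_normsq (z R n : ℕ) : ((‖sA z R n‖ ^ 2 : ℝ) : ℂ) = ∑ x ∈ sI z R ×ˢ sI z R, (sb x.1 : ℂ) * (sb x.2 : ℂ) * e (n * (sx x.1 - sx x.2)) := by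
  push_cast
  rw [← Complex.mul_conj', sA, map_sum, Finset.sum_mul_sum, ← Finset.sum_product']
  refine Finset.sum_congr rfl fun x _ => ?_
  rw [map_mul, Complex.conj_ofReal, mul_sub, e_sub]; ring

lemma maj_expand (B : Finset ℕ) (t : ℕ → ℝ) (M z R : ℕ) (θ : ℝ) :
    ∑ n ∈ B, ((‖sD M (t n)‖ ^ 2 * ‖sA z R n‖ ^ 2 : ℝ) : ℂ) * e (n * θ) =
      ∑ y ∈ Finset.range M ×ˢ Finset.range M, ∑ x ∈ sI z R ×ˢ sI z R, (sb x.1 : ℂ) * (sb x.2 : ℂ) * sV B t ((y.1:ℤ) - (y.2:ℤ)) (sx x.1 - sx x.2 + θ) := by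
  have : ∀ n ∈ B, ((‖sD M (t n)‖ ^ 2 * ‖sA z R n‖ ^ 2 : ℝ) : ℂ) * e (n * θ) =
      ∑ y ∈ Finset.range M ×ˢ Finset.range M, ∑ x ∈ sI z R ×ˢ sI z R, (sb x.1 : ℂ) * (sb x.2 : ℂ) * e ((((y.1:ℤ) - (y.2:ℤ) : ℤ) : ℝ) * t n + n * (sx x.1 - sx x.2 + θ)) := by
    intro n _
    rw [Complex.ofReal_mul, sD_normsq, sA_normsq, Finset.sum_mul_sum, Finset.sum_mul]
    refine Finset.sum_congr rfl fun y _ => ?_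
    rw [Finset.sum_mul]
    refine Finset.sum_congr rfl fun x _ => ?_
    rw [mul_add, e_add, e_add]; ring
  rw [Finset.sum_congr rfl this, Finset.sum_comm]
  refine Finset.sum_congr rfl fun y _ => ?_
  rw [Finset.sum_comm]
  refine Finset.sum_congr rfl fun x _ => ?_
  rw [sV, Finset.mul_sum]

lemma sum_abs_sb_sq (z R : ℕ) : ∑ x ∈ sI z R ×ˢ sI z R, |sb x.1| * |sb x.2| ≤ (R:ℝ) ^ 2 := by
  have : ∑ x ∈ sI z R ×ˢ sI z R, |sb x.1| * |sb x.2| = (∑ i ∈ sI z R, |sb i|) * ∑ i ∈ sI z R, |sb i| := by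
    rw [Finset.sum_mul_sum, ← Finset.sum_product']
  rw [this, sq]
  have h := sum_abs_sb z R
  have h0 : 0 ≤ ∑ i ∈ sI z R, |sb i| := Finset.sum_nonneg fun _ _ => abs_nonneg _
  exact mul_le_mul h h h0 (by positivity)

lemma quad_T (B : Finset ℕ) (t : ℕ → ℝ) (z R : ℕ) (k : ℤ) (θ T : ℝ) (hT : ∀ θ, ‖sV B t k θ‖ ≤ T) :
    ‖∑ x ∈ sI z R ×ˢ sI z R, (sb x.1 : ℂ) * (sb x.2 : ℂ) * sV B t k (sx x.1 - sx x.2 + θ)‖ ≤ T * (R:ℝ) ^ 2 := by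
  have hT0 : 0 ≤ T := (norm_nonneg _).trans (hT 0)
  refine (norm_sum_le _ _).trans ?_
  refine le_trans (Finset.sum_le_sum (g := fun x => T * (|sb x.1| * |sb x.2|)) fun x _ => ?_) ?_
  · rw [norm_mul, norm_mul, Complex.norm_real, Complex.norm_real, Real.norm_eq_abs, Real.norm_eq_abs, mul_comm]
    exact mul_le_mul_of_nonneg_right (hT _) (by positivity)
  · rw [← Finset.mul_sum]
    exact mul_le_mul_of_nonneg_left (sum_abs_sb_sq z R) hT0

lemma quad_0 (B : Finset ℕ) (t : ℕ → ℝ) (z R : ℕ) (hz : 1 ≤ z) (θ N : ℝ) (hB : (B.card : ℝ) ≤ N)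
    (hfar : ∀ θ : ℝ, (∀ k : ℤ, 1 / (2 * (R:ℝ) ^ 4) ≤ |θ - k|) → ‖sV B t 0 θ‖ ≤ 4 * (R:ℝ) ^ 4) :
    ‖∑ x ∈ sI z R ×ˢ sI z R, (sb x.1 : ℂ) * (sb x.2 : ℂ) * sV B t 0 (sx x.1 - sx x.2 + θ) - ((∑ i ∈ sI z R, sb i ^ 2 : ℝ) : ℂ) * sV B t 0 θ‖
      ≤ N * (2 * sG z R / √z) + 4 * (R:ℝ) ^ 6 := by
  have hN0 : 0 ≤ N := (Nat.cast_nonneg _).trans hB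
  have htriv : ∀ θ, ‖sV B t 0 θ‖ ≤ N := by
    intro θ
    refine le_trans ?_ hB
    rw [sV]
    refine (norm_sum_le _ _).trans ?_
    simp [norm_e]
  rw [← Finset.diag_union_offDiag, Finset.sum_union (Finset.disjoint_diag_offDiag _), Finset.sum_diag]
  have e1 : ∑ i ∈ sI z R, (sb i : ℂ) * (sb i : ℂ) * sV B t 0 (sx i - sx i + θ) = ((∑ i ∈ sI z R, sb i ^ 2 : ℝ) : ℂ) * sV B t 0 θ := by
    push_cast
    rw [Finset.sum_mul]
    refine Finset.sum_congr rfl fun i _ => ?_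
    rw [sub_self, zero_add]; ring
  rw [e1, add_sub_cancel_left]
  refine (norm_sum_le _ _).trans ?_
  have hpt : ∀ x ∈ (sI z R).offDiag, ‖(sb x.1 : ℂ) * (sb x.2 : ℂ) * sV B t 0 (sx x.1 - sx x.2 + θ)‖ ≤
      N * (if (∃ k : ℤ, |sx x.1 - sx x.2 + θ - k| < 1 / (2 * (R:ℝ) ^ 4)) then |sb x.1| * |sb x.2| else 0) + 4 * (R:ℝ) ^ 4 * (|sb x.1| * |sb x.2|) := by
    intro x _
    rw [norm_mul, norm_mul, Complex.norm_real, Complex.norm_real, Real.norm_eq_abs, Real.norm_eq_abs]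
    have h0 : 0 ≤ |sb x.1| * |sb x.2| := by positivity
    split_ifs with h
    · have h1 := mul_le_mul_of_nonneg_left (htriv (sx x.1 - sx x.2 + θ)) h0
      have h2 : 0 ≤ 4 * (R:ℝ) ^ 4 * (|sb x.1| * |sb x.2|) := by positivity
      linarith
    · push Not at h
      have h1 := mul_le_mul_of_nonneg_left (hfar _ h) h0
      linarith
  refine (Finset.sum_le_sum hpt).trans ?_
  rw [Finset.sum_add_distrib, ← Finset.mul_sum, ← Finset.mul_sum]
  refine add_le_add (mul_le_mul_of_nonneg_left ?_ hN0) ?_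
  · rw [← Finset.sum_filter]
    refine le_trans (le_of_eq ?_) (near_sum z R θ hz)
    refine Finset.sum_congr ?_ fun _ _ => rfl
    ext x
    rw [sNear, Finset.mem_filter, Finset.mem_filter, Finset.mem_offDiag, Finset.mem_product]
    tauto
  · have h1 : ∑ x ∈ (sI z R).offDiag, |sb x.1| * |sb x.2| ≤ (R:ℝ) ^ 2 := by
      refine le_trans (Finset.sum_le_sum_of_subset_of_nonneg ?_ fun _ _ _ => by positivity) (sum_abs_sb_sq z R)
      intro x hx
      rw [Finset.mem_offDiag] at hx
      exact Finset.mem_product.2 ⟨hx.1, hx.2.1⟩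
    calc _ ≤ 4 * (R:ℝ) ^ 4 * (R:ℝ) ^ 2 := by gcongr
      _ = _ := by ring

noncomputable def sNu (t : ℕ → ℝ) (M z R : ℕ) (n : ℕ) : ℝ := 4 / ((M:ℝ) ^ 2 * sG z R ^ 2) * (‖sD M (t n)‖ ^ 2 * ‖sA z R n‖ ^ 2)

noncomputable def sNu0 (M z R : ℕ) : ℝ := 4 / ((M:ℝ) * sG z R ^ 2) * ∑ i ∈ sI z R, sb i ^ 2

lemma sNu0_nonneg (M z R : ℕ) : 0 ≤ sNu0 M z R :=
  mul_nonneg (by positivity) (Finset.sum_nonneg fun _ _ => by positivity)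

lemma sNu_nonneg (t : ℕ → ℝ) (M z R n : ℕ) : 0 ≤ sNu t M z R n := by rw [sNu]; positivity

lemma sNu0_le (M z R : ℕ) (hM : 1 ≤ M) (hR : 1 ≤ R) : sNu0 M z R ≤ 4 / (M * sG z R) := by
  have hall : ∑ i ∈ sI z R, sb i ^ 2 ≤ sG z R := by
    have := sum_sb_sq z R (fun _ => True)
    simpa [sG] using this
  have hG := one_le_sG z R hR
  have hM0 : (0:ℝ) < M := by exact_mod_cast hM
  rw [sNu0]
  calc _ ≤ 4 / ((M:ℝ) * sG z R ^ 2) * sG z R := by gcongr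
    _ = _ := by field_simp

theorem maj_fourier (B : Finset ℕ) (t : ℕ → ℝ) (M z R : ℕ) (hM : 1 ≤ M) (hz : 1 ≤ z) (hR : 1 ≤ R) (N T : ℝ) (hB : (B.card : ℝ) ≤ N) (hT0 : 0 ≤ T)
    (hT : ∀ k : ℤ, k ≠ 0 → |k| < M → ∀ θ : ℝ, ‖sV B t k θ‖ ≤ T)
    (hfar : ∀ θ : ℝ, (∀ k : ℤ, 1 / (2 * (R:ℝ) ^ 4) ≤ |θ - k|) → ‖sV B t 0 θ‖ ≤ 4 * (R:ℝ) ^ 4) (θ : ℝ) :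
    ‖∑ n ∈ B, ((sNu t M z R n - sNu0 M z R : ℝ) : ℂ) * e (n * θ)‖ ≤ 8 * N / (M * sG z R * √z) + 16 * (R:ℝ) ^ 6 + 4 * T * (R:ℝ) ^ 2 := by
  have hM0 : (0:ℝ) < M := by exact_mod_cast hM
  have hG := one_le_sG z R hR
  have hz0 : (0:ℝ) < z := by exact_mod_cast hz
  have hs : 0 < √(z:ℝ) := Real.sqrt_pos.2 hz0
  set c := 4 / ((M:ℝ) ^ 2 * sG z R ^ 2) with hc
  have hc0 : 0 ≤ c := by positivity
  set S0 := ∑ i ∈ sI z R, sb i ^ 2 with hS0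
  have hν0 : sNu0 M z R = c * M * S0 := by rw [sNu0, hc, ← hS0]; field_simp
  set q : ℤ → ℂ := fun k => ∑ x ∈ sI z R ×ˢ sI z R, (sb x.1 : ℂ) * (sb x.2 : ℂ) * sV B t k (sx x.1 - sx x.2 + θ) with hq
  have e1 : ∑ n ∈ B, ((sNu t M z R n - sNu0 M z R : ℝ) : ℂ) * e (n * θ) =
      (c:ℂ) * ∑ y ∈ Finset.range M ×ˢ Finset.range M, (q ((y.1:ℤ) - (y.2:ℤ)) - if y.1 = y.2 then (S0 : ℂ) * sV B t 0 θ else 0) := by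
    rw [Finset.sum_sub_distrib]
    simp only [hq]
    rw [← maj_expand]
    have e2 : ∑ y ∈ Finset.range M ×ˢ Finset.range M, (if y.1 = y.2 then (S0 : ℂ) * sV B t 0 θ else 0) = M * ((S0 : ℂ) * sV B t 0 θ) := by
      rw [Finset.sum_product]
      simp only [Finset.sum_ite_eq]
      rw [Finset.sum_congr rfl (g := fun _ => (S0 : ℂ) * sV B t 0 θ) (fun x hx => by rw [if_pos hx])]
      simp
    rw [e2, mul_sub, Finset.mul_sum, sV, Finset.mul_sum, Finset.mul_sum, Finset.mul_sum, ← Finset.sum_sub_distrib]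
    refine Finset.sum_congr rfl fun n _ => ?_
    rw [hν0, sNu, ← hc]
    push_cast
    rw [zero_mul, zero_add]
    ring
  rw [e1, norm_mul, Complex.norm_real, Real.norm_eq_abs, abs_of_nonneg hc0]
  set W := N * (2 * sG z R / √z) + 4 * (R:ℝ) ^ 6 with hW
  have hpt : ∀ y ∈ Finset.range M ×ˢ Finset.range M, ‖q ((y.1:ℤ) - (y.2:ℤ)) - if y.1 = y.2 then (S0 : ℂ) * sV B t 0 θ else 0‖ ≤
      T * (R:ℝ) ^ 2 + if y.1 = y.2 then W else 0 := by
    intro y hy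
    rw [Finset.mem_product, Finset.mem_range, Finset.mem_range] at hy
    split_ifs with h
    · rw [h, sub_self]
      have := quad_0 B t z R hz θ N hB hfar
      have h2 : 0 ≤ T * (R:ℝ) ^ 2 := by positivity
      exact this.trans (by linarith)
    · rw [sub_zero, add_zero]
      refine quad_T B t z R _ θ T (hT _ ?_ ?_)
      · intro h'; apply h; omega
      · rw [abs_lt]; omega
  have hsum : ‖∑ y ∈ Finset.range M ×ˢ Finset.range M, (q ((y.1:ℤ) - (y.2:ℤ)) - if y.1 = y.2 then (S0 : ℂ) * sV B t 0 θ else 0)‖ ≤ (M:ℝ) ^ 2 * (T * (R:ℝ) ^ 2) + M * W := by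
    refine (norm_sum_le _ _).trans ((Finset.sum_le_sum hpt).trans (le_of_eq ?_))
    rw [Finset.sum_add_distrib]
    congr 1
    · rw [Finset.sum_const, Finset.card_product, Finset.card_range, nsmul_eq_mul]; push_cast; ring
    · rw [Finset.sum_product]
      simp only [Finset.sum_ite_eq]
      rw [Finset.sum_congr rfl (g := fun _ => W) (fun x hx => by rw [if_pos hx])]
      simp
  refine (mul_le_mul_of_nonneg_left hsum hc0).trans ?_
  have e3 : c * ((M:ℝ) ^ 2 * (T * (R:ℝ) ^ 2) + M * W) = 4 * T * (R:ℝ) ^ 2 / sG z R ^ 2 + 8 * N / (M * sG z R * √z) + 16 * (R:ℝ) ^ 6 / (M * sG z R ^ 2) := by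
    rw [hc, hW]; field_simp; ring
  rw [e3]
  have hG2 : 1 ≤ sG z R ^ 2 := one_le_pow₀ hG
  have f1 : 4 * T * (R:ℝ) ^ 2 / sG z R ^ 2 ≤ 4 * T * (R:ℝ) ^ 2 := div_le_self (by positivity) hG2
  have f2 : 16 * (R:ℝ) ^ 6 / (M * sG z R ^ 2) ≤ 16 * (R:ℝ) ^ 6 := by
    apply div_le_self (by positivity)
    have : (1:ℝ) ≤ M := by exact_mod_cast hM
    nlinarith
  linarith

lemma sD_lower (M : ℕ) (t s : ℝ) (n : ℕ) (hts : t = n - s) (hs0 : 0 ≤ s) (hs : M * s ≤ 1 / 6) : (M:ℝ) / 2 ≤ ‖sD M t‖ := by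
  refine le_trans ?_ ((Complex.re_le_norm _))
  rw [sD, Complex.re_sum]
  have : ∀ m ∈ Finset.range M, (1:ℝ) / 2 ≤ (e ((m:ℝ) * t)).re := by
    intro m hm
    have hm' : (m:ℝ) ≤ M := by exact_mod_cast (Finset.mem_range.1 hm).le
    have h1 : (m:ℝ) * s ≤ 1 / 6 := le_trans (mul_le_mul_of_nonneg_right hm' hs0) hs
    have h0 : 0 ≤ (m:ℝ) * s := by positivity
    have e1 : (m:ℝ) * t = -((m:ℝ) * s) + ((m * n : ℕ) : ℤ) := by rw [hts]; push_cast; ring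
    rw [e1, e_add_int, e_re, ← Real.cos_pi_div_three]
    rw [show 2 * π * -((m:ℝ) * s) = -(2 * π * (m * s)) by ring, Real.cos_neg]
    refine Real.cos_le_cos_of_nonneg_of_le_pi (by positivity) (by linarith [Real.pi_pos]) ?_
    nlinarith [Real.pi_pos]
  have := Finset.card_nsmul_le_sum _ _ _ this
  rw [Finset.card_range, nsmul_eq_mul] at this
  linarith

lemma sV_zero_far (a b : ℕ) (t : ℕ → ℝ) (R : ℕ) (hR : 1 ≤ R) (θ : ℝ) (h : ∀ k : ℤ, 1 / (2 * (R:ℝ) ^ 4) ≤ |θ - k|) :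
    ‖sV (Finset.Ico a b) t 0 θ‖ ≤ 4 * (R:ℝ) ^ 4 := by
  have hR0 : (0:ℝ) < R := by exact_mod_cast hR
  have h1 := h ⌊θ⌋
  have h2 := h (⌊θ⌋ + 1)
  have f1 := Int.floor_le θ
  have f2 := Int.lt_floor_add_one θ
  rw [abs_of_nonneg (by linarith)] at h1
  rw [abs_of_nonpos (by push_cast; linarith)] at h2
  push_cast at h2
  have := geom_bound a b θ (1 / (2 * (R:ℝ) ^ 4)) ⌊θ⌋ (by positivity) (by linarith) (by linarith)
  have e1 : 2 / (1 / (2 * (R:ℝ) ^ 4)) = 4 * (R:ℝ) ^ 4 := by field_simp; norm_num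
  rw [e1] at this
  simpa [sV] using this

lemma sV_neg (B : Finset ℕ) (t : ℕ → ℝ) (k : ℤ) (θ : ℝ) : ‖sV B t (-k) θ‖ = ‖sV B t k (-θ)‖ := by
  have : sV B t (-k) θ = (starRingEnd ℂ) (sV B t k (-θ)) := by
    rw [sV, sV, map_sum]
    refine Finset.sum_congr rfl fun n _ => ?_
    rw [← e_neg]; congr 1; push_cast; ring
  rw [this, Complex.norm_conj]

namespace Reg
variable {S : Set ℕ} {γ' Y0 : ℝ} {φ φ1 H H1 : ℝ → ℝ}

lemma sV_T (R : Reg S γ' φ φ1 H H1 Y0) (hγ : 15 / 16 < γ') {N : ℕ} (hN : 4 * Y0 ≤ N) (k : ℤ) (hk : k ≠ 0) (hkM : |(k:ℝ)| * φ N ≤ N) (θ : ℝ) :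
    ‖sV (Finset.Ico (N / 4 + 1) (N + 1)) (fun n => φ n) k θ‖ ≤ 49152 * (N:ℝ) ^ (17/32:ℝ) := by
  have hY := R.one_le_Y0
  have hN1 : (1:ℝ) ≤ N := by linarith
  have main : ∀ k : ℤ, 0 < k → (k:ℝ) * φ N ≤ N → ∀ θ : ℝ, ‖sV (Finset.Ico (N / 4 + 1) (N + 1)) (fun n => φ n) k θ‖ ≤ 49152 * (N:ℝ) ^ (17/32:ℝ) := by
    intro k hk hkM θ
    have hk1 : (1:ℝ) ≤ k := by exact_mod_cast hk
    have := R.expsum_T hγ.le (C1 := 1) le_rfl hN k θ hk1 (by linarith) 1 le_rfl (by simpa using hN1) (N / 4 + 1) (N + 1)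
      (by
        have : N ≤ 4 * (1 * (N / 4 + 1)) := by omega
        exact_mod_cast this)
      (by push_cast; linarith)
    rw [mul_one] at this
    refine le_trans (le_of_eq ?_) this
    rw [sV]
    congr 1
    refine Finset.sum_congr rfl fun n _ => ?_
    congr 1; push_cast; rw [one_mul]; ring
  rcases lt_or_gt_of_ne hk with h | h
  · have := main (-k) (by omega) (by
      push_cast
      rwa [abs_of_neg (by exact_mod_cast h)] at hkM) (-θ)
    rw [sV_neg, neg_neg] at this
    exact this
  · exact main k h (by rwa [abs_of_pos (by exact_mod_cast h)] at hkM) θ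

theorem maj (R : Reg S γ' φ φ1 H H1 Y0) (hγ : 15 / 16 < γ') (κ : ℝ) (hκ : 0 < κ) : ∃ C > 0, ∃ N0 : ℕ, ∀ N : ℕ, N0 ≤ N → ∀ z : ℕ, 1 ≤ z →
    ∃ (ν : ℕ → ℝ) (ν0 : ℝ), (∀ n, 0 ≤ ν n) ∧ 0 ≤ ν0 ∧ (∀ p ∈ (Finset.Ico (N / 4 + 1) (N + 1)).filter (fun p => p ∈ S), 1 ≤ ν p) ∧
      ν0 ≤ C * (φ N / Real.log N) * (z:ℝ) ^ κ / N ∧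
      ∀ θ : ℝ, ‖∑ n ∈ Finset.Ico (N / 4 + 1) (N + 1), ((ν n - ν0 : ℝ) : ℂ) * e (n * θ)‖ ≤
        C * (φ N / Real.log N) * ((z:ℝ) ^ κ / √z) + (N:ℝ) ^ (66/100 : ℝ) := by
  obtain ⟨C, hC, hG⟩ := sG_lower κ hκ
  have hev : ∀ᶠ x : ℝ in atTop, (4 * Y0 ≤ x ∧ φ x / x ≤ 1 / 48 ∧ 8 ≤ x) ∧ (2 : ℝ) * x ^ (1/40:ℝ) ≤ x ^ (1/20:ℝ) ∧
      (8 : ℝ) * x ^ (1/20 : ℝ) ≤ x ^ (1:ℝ) ∧ (32:ℝ) * x ^ (3/10:ℝ) ≤ x ^ (66/100 : ℝ) ∧ (393216 : ℝ) * x ^ (101/160 : ℝ) ≤ x ^ (66/100 : ℝ) := by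
    refine ((eventually_ge_atTop _).and ((R.small.eventually_le_const (by norm_num)).and (eventually_ge_atTop 8))).and ((ev_pow _ _ _ (by norm_num)).and ((ev_pow _ _ _ (by norm_num)).and ((ev_pow _ _ _ (by norm_num)).and (ev_pow _ _ _ (by norm_num)))))
  obtain ⟨N0, hN0⟩ := eventually_atTop.1 (tendsto_natCast_atTop_atTop.eventually hev)
  refine ⟨15360 * C, by positivity, N0, fun N hN z hz => ?_⟩
  obtain ⟨⟨h4, hs, h8⟩, hp1, hp2, hp3, hp4⟩ := hN0 N hN
  have hY := R.one_le_Y0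
  have hNp : (0:ℝ) < N := by linarith
  have hφ : 1 ≤ φ N := R.one_le N (by show Y0 ≤ (N:ℝ); linarith)
  have hlN : 0 < Real.log N := Real.log_pos (by linarith)
  have hz0 : (0:ℝ) < z := by exact_mod_cast hz
  -- M
  obtain ⟨M, hMdef⟩ : ∃ M : ℕ, M = ⌊(N:ℝ) / (24 * φ N)⌋₊ := ⟨_, rfl⟩
  have hq : 2 ≤ (N:ℝ) / (24 * φ N) := by
    rw [le_div_iff₀ (by positivity)]
    rw [div_le_iff₀ hNp] at hs; linarith
  have hM1 : (M:ℝ) ≤ (N:ℝ) / (24 * φ N) := by rw [hMdef]; exact Nat.floor_le (by positivity)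
  have hM2 : (N:ℝ) / (24 * φ N) < M + 1 := by rw [hMdef]; exact Nat.lt_floor_add_one _
  have hM3 : (N:ℝ) / (48 * φ N) ≤ M := by
    have : (N:ℝ) / (48 * φ N) = (N:ℝ) / (24 * φ N) / 2 := by field_simp; norm_num
    linarith
  have hMpos : (0:ℝ) < M := by linarith
  have hMge : 1 ≤ M := by exact_mod_cast hMpos
  have hMφ : (M:ℝ) * (24 * φ N) ≤ N := by rwa [le_div_iff₀ (by positivity)] at hM1
  have hMinv : 1 / (M:ℝ) ≤ 48 * φ N / N := by
    rw [div_le_div_iff₀ hMpos hNp]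
    rw [div_le_iff₀ (by positivity)] at hM3; linarith
  -- R
  obtain ⟨Q, hQdef⟩ : ∃ Q : ℕ, Q = ⌊(N:ℝ) ^ (1/20:ℝ)⌋₊ := ⟨_, rfl⟩
  have h40 : (1:ℝ) ≤ (N:ℝ) ^ (1/40:ℝ) := Real.one_le_rpow (by linarith) (by norm_num)
  have hQ1 : (Q:ℝ) ≤ (N:ℝ) ^ (1/20:ℝ) := by rw [hQdef]; exact Nat.floor_le (by positivity)
  have hQ2 : (N:ℝ) ^ (1/20:ℝ) < Q + 1 := by rw [hQdef]; exact Nat.lt_floor_add_one _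
  have hQ3 : (N:ℝ) ^ (1/40:ℝ) ≤ Q := by linarith
  have hQge : 1 ≤ Q := by
    have : (1:ℝ) ≤ Q := by linarith
    exact_mod_cast this
  have hQ8 : 8 * (Q:ℝ) ≤ N := by rw [Real.rpow_one] at hp2; linarith
  have hlQ : Real.log N / 40 ≤ Real.log Q := by
    have := Real.log_le_log (by positivity) hQ3
    rw [Real.log_rpow hNp] at this; linarith
  have hGz := hG z Q hz
  have hG1 := one_le_sG z Q hQge
  have hG0 : 0 < sG z Q := by linarith
  have hMG : 1 / (M * sG z Q) ≤ 1920 * C * (φ N / Real.log N) * (z:ℝ) ^ κ / N := by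
    have h1 : 1 / sG z Q ≤ 40 * C * (z:ℝ) ^ κ / Real.log N := by
      rw [div_le_div_iff₀ hG0 hlN]; linarith
    calc 1 / (M * sG z Q) = 1 / (M:ℝ) * (1 / sG z Q) := by field_simp
      _ ≤ 48 * φ N / N * (40 * C * (z:ℝ) ^ κ / Real.log N) := by gcongr
      _ = _ := by field_simp; norm_num
  refine ⟨sNu (fun n => φ n) M z Q, sNu0 M z Q, sNu_nonneg _ M z Q, sNu0_nonneg M z Q, ?_, ?_, ?_⟩
  · intro p hp
    rw [Finset.mem_filter, Finset.mem_Ico] at hp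
    have hp4 : (N:ℝ) ≤ 4 * p := by
      have : N ≤ 4 * p := by omega
      exact_mod_cast this
    obtain ⟨hpp, n, hn1, hn2⟩ := (R.mem p (by linarith)).1 hp.2
    have hd := R.phi_diff_hi h4 (y := p) (by linarith)
    have hD := sD_lower M (φ p) (n - φ p) n (by ring) (by linarith) (by
      calc (M:ℝ) * (n - φ p) ≤ M * (4 * φ N / N) := by gcongr; linarith
        _ = (M * (24 * φ N)) / (6 * N) := by field_simp; norm_num
        _ ≤ N / (6 * N) := by gcongr
        _ = 1 / 6 := by field_simp)
    have hA := sA_prime z Q p hpp (by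
      have h1 : (1:ℝ) ≤ Q := by exact_mod_cast hQge
      have : (Q:ℝ) < p := by linarith only [h1, hQ8, hp4]
      exact_mod_cast this)
    rw [sNu, hA, Complex.norm_real, Real.norm_eq_abs, sq_abs]
    have : (M:ℝ) ^ 2 / 4 ≤ ‖sD M (φ p)‖ ^ 2 := by
      calc (M:ℝ) ^ 2 / 4 = ((M:ℝ) / 2) ^ 2 := by ring
        _ ≤ _ := by gcongr
    calc (1:ℝ) = 4 / ((M:ℝ) ^ 2 * sG z Q ^ 2) * ((M:ℝ) ^ 2 / 4 * sG z Q ^ 2) := by field_simp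
      _ ≤ _ := by gcongr
  · refine (sNu0_le M z Q hMge hQge).trans ?_
    calc 4 / (M * sG z Q) = 4 * (1 / (M * sG z Q)) := by ring
      _ ≤ 4 * (1920 * C * (φ N / Real.log N) * (z:ℝ) ^ κ / N) := by gcongr
      _ ≤ 8 * (1920 * C * (φ N / Real.log N) * (z:ℝ) ^ κ / N) := by gcongr; norm_num
      _ = _ := by ring
  · intro θ
    have hT : ∀ k : ℤ, k ≠ 0 → |k| < M → ∀ θ : ℝ, ‖sV (Finset.Ico (N / 4 + 1) (N + 1)) (fun n => φ n) k θ‖ ≤ 49152 * (N:ℝ) ^ (17/32:ℝ) := by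
      intro k hk hkM θ
      refine R.sV_T hγ h4 k hk ?_ θ
      have : |(k:ℝ)| ≤ M := by exact_mod_cast hkM.le
      calc |(k:ℝ)| * φ N ≤ M * φ N := by gcongr
        _ ≤ N := by
          have h0 : 0 ≤ (M:ℝ) * φ N := by positivity
          linarith only [h0, hMφ]
    have := maj_fourier (Finset.Ico (N / 4 + 1) (N + 1)) (fun n => φ n) M z Q hMge hz hQge N (49152 * (N:ℝ) ^ (17/32:ℝ))
      (by rw [Nat.card_Ico]; have : N + 1 - (N / 4 + 1) ≤ N := by omega
          exact_mod_cast this) (by positivity) hT (fun θ h => sV_zero_far _ _ _ Q hQge θ h) θ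
    refine this.trans ?_
    have t1 : 8 * (N:ℝ) / (M * sG z Q * √z) ≤ 15360 * C * (φ N / Real.log N) * ((z:ℝ) ^ κ / √z) := by
      calc 8 * (N:ℝ) / (M * sG z Q * √z) = 8 * N / √z * (1 / (M * sG z Q)) := by field_simp
        _ ≤ 8 * N / √z * (1920 * C * (φ N / Real.log N) * (z:ℝ) ^ κ / N) := by gcongr
        _ = _ := by field_simp; norm_num
    have t2 : 16 * (Q:ℝ) ^ 6 ≤ (N:ℝ) ^ (66/100 : ℝ) / 2 := by
      have : (Q:ℝ) ^ 6 ≤ (N:ℝ) ^ (3/10 : ℝ) := by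
        calc (Q:ℝ) ^ 6 ≤ ((N:ℝ) ^ (1/20:ℝ)) ^ 6 := by gcongr
          _ = _ := by rw [← Real.rpow_natCast, ← Real.rpow_mul hNp.le]; norm_num
      linarith
    have t3 : 4 * (49152 * (N:ℝ) ^ (17/32:ℝ)) * (Q:ℝ) ^ 2 ≤ (N:ℝ) ^ (66/100 : ℝ) / 2 := by
      have : (N:ℝ) ^ (17/32:ℝ) * (Q:ℝ) ^ 2 ≤ (N:ℝ) ^ (101/160 : ℝ) := by
        calc (N:ℝ) ^ (17/32:ℝ) * (Q:ℝ) ^ 2 ≤ (N:ℝ) ^ (17/32:ℝ) * ((N:ℝ) ^ (1/20:ℝ)) ^ 2 := by gcongr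
          _ = _ := by rw [← Real.rpow_natCast, ← Real.rpow_mul hNp.le, ← Real.rpow_add hNp]; norm_num
      linarith
    linarith

end Reg
lemma int_e (k : ℤ) (hk : k ≠ 0) : ∫ ξ in (0:ℝ)..1, e (k * ξ) = 0 := by
  have hc : (2 * Real.pi * Complex.I * k : ℂ) ≠ 0 := by
    simp [Real.pi_ne_zero, hk]
  have : ∀ ξ : ℝ, e (k * ξ) = Complex.exp ((2 * Real.pi * Complex.I * k) * ξ) := by
    intro ξ; rw [e]; congr 1; push_cast; ring
  simp only [this]
  rw [integral_exp_mul_complex hc]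
  have h1 : Complex.exp ((2 * Real.pi * Complex.I * k) * (1:ℝ)) = 1 := by
    have := e_int k
    rw [e] at this
    rw [← this]; congr 1; push_cast; ring
  rw [h1]; simp

noncomputable def tp (B : Finset ℕ) (c : ℕ → ℂ) (ξ : ℝ) : ℂ := ∑ n ∈ B, c n * e (n * ξ)

lemma continuous_tp (B : Finset ℕ) (c : ℕ → ℂ) : Continuous (tp B c) := by
  unfold tp
  exact continuous_finsetSum _ fun n _ => continuous_const.mul (continuous_e.comp (by fun_prop))

lemma norm_tp_le (B : Finset ℕ) (c : ℕ → ℂ) (hc : ∀ n, ‖c n‖ ≤ 1) (ξ : ℝ) : ‖tp B c ξ‖ ≤ B.card := by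
  refine (norm_sum_le _ _).trans ?_
  refine (Finset.sum_le_card_nsmul _ _ 1 fun n _ => ?_).trans (by simp)
  rw [norm_mul, norm_e, mul_one]; exact hc n

lemma parseval (B : Finset ℕ) (c : ℕ → ℂ) : ∫ ξ in (0:ℝ)..1, ‖tp B c ξ‖ ^ 2 = ∑ n ∈ B, ‖c n‖ ^ 2 := by
  have h1 : ∀ ξ : ℝ, ((‖tp B c ξ‖ ^ 2 : ℝ) : ℂ) = ∑ n ∈ B, ∑ m ∈ B, c n * (starRingEnd ℂ) (c m) * e (((n:ℤ) - (m:ℤ) : ℤ) * ξ) := by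
    intro ξ
    push_cast
    rw [← Complex.mul_conj', tp, map_sum, Finset.sum_mul_sum]
    refine Finset.sum_congr rfl fun n _ => Finset.sum_congr rfl fun (m:ℕ) _ => ?_
    rw [map_mul, sub_mul, e_sub]; ring
  have h2 : ((∫ ξ in (0:ℝ)..1, ‖tp B c ξ‖ ^ 2 : ℝ) : ℂ) = ((∑ n ∈ B, ‖c n‖ ^ 2 : ℝ) : ℂ) := by
    rw [← intervalIntegral.integral_ofReal]
    simp only [h1]
    have hci : ∀ k : ℤ, Continuous fun ξ : ℝ => e (k * ξ) := fun k => continuous_e.comp (by fun_prop)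
    rw [intervalIntegral.integral_finsetSum fun n _ => ?_]
    · rw [Complex.ofReal_sum]
      refine Finset.sum_congr rfl fun n hn => ?_
      rw [intervalIntegral.integral_finsetSum fun (m:ℕ) _ => ((hci ((n:ℤ) - (m:ℤ))).const_mul _).intervalIntegrable _ _]
      rw [Finset.sum_eq_single n]
      · simp only [sub_self, Int.cast_zero, zero_mul, e_zero]
        rw [mul_one, intervalIntegral.integral_const, Complex.mul_conj']; simp
      · intro m _ hm
        rw [intervalIntegral.integral_const_mul, int_e _ (by omega), mul_zero]
      · intro h; exact absurd hn h
    · exact (continuous_finsetSum _ fun (m:ℕ) _ => (hci ((n:ℤ) - (m:ℤ))).const_mul _).intervalIntegrable _ _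
  exact_mod_cast h2

noncomputable def bE (E : Set ℝ) (u : ℝ → ℂ) (n : ℕ) : ℂ := ∫ ξ in E, e (n * ξ) * u ξ

lemma intOn_mul (E : Set ℝ) (hEf : MeasureTheory.volume E ≠ ⊤) (u : ℝ → ℂ) (hu : Measurable u) (hu1 : ∀ ξ, ‖u ξ‖ ≤ 1)
    (g : ℝ → ℂ) (hg : Continuous g) (K : ℝ) (hK : ∀ ξ, ‖g ξ‖ ≤ K) : MeasureTheory.IntegrableOn (fun ξ => g ξ * u ξ) E := by
  refine MeasureTheory.Measure.integrableOn_of_bounded (M := K) hEf (hg.measurable.mul hu).aestronglyMeasurable ?_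
  refine Filter.Eventually.of_forall fun ξ => ?_
  rw [norm_mul]
  have h0 : 0 ≤ K := (norm_nonneg _).trans (hK ξ)
  calc ‖g ξ‖ * ‖u ξ‖ ≤ K * 1 := mul_le_mul (hK ξ) (hu1 ξ) (norm_nonneg _) h0
    _ = K := mul_one K

lemma sum_bE (E : Set ℝ) (hEf : MeasureTheory.volume E ≠ ⊤) (u : ℝ → ℂ) (hu : Measurable u) (hu1 : ∀ ξ, ‖u ξ‖ ≤ 1)
    (B : Finset ℕ) (d : ℕ → ℂ) : ∑ n ∈ B, d n * bE E u n = ∫ ξ in E, tp B d ξ * u ξ := by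
  have h : ∀ n ∈ B, MeasureTheory.IntegrableOn (fun ξ => d n * (e (n * ξ) * u ξ)) E := by
    intro n _
    exact (intOn_mul E hEf u hu hu1 (fun ξ => e (n * ξ)) (continuous_e.comp (by fun_prop)) 1 (fun ξ => (norm_e _).le)).const_mul _
  have e1 : ∀ ξ, tp B d ξ * u ξ = ∑ n ∈ B, d n * (e (n * ξ) * u ξ) := by
    intro ξ; rw [tp, Finset.sum_mul]; exact Finset.sum_congr rfl fun n _ => by ring
  simp only [e1]
  rw [MeasureTheory.integral_finsetSum _ h]
  refine Finset.sum_congr rfl fun n _ => ?_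
  rw [MeasureTheory.integral_const_mul, bE]

lemma sum_bE_le (E : Set ℝ) (hEf : MeasureTheory.volume E ≠ ⊤) (u : ℝ → ℂ) (hu : Measurable u) (hu1 : ∀ ξ, ‖u ξ‖ ≤ 1)
    (B : Finset ℕ) (d : ℕ → ℂ) (K : ℝ) (hK : ∀ ξ, ‖tp B d ξ‖ ≤ K) : ‖∑ n ∈ B, d n * bE E u n‖ ≤ K * MeasureTheory.volume.real E := by
  rw [sum_bE E hEf u hu hu1]
  refine MeasureTheory.norm_setIntegral_le_of_norm_le_const hEf.lt_top fun ξ _ => ?_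
  rw [norm_mul]
  have h0 : 0 ≤ K := (norm_nonneg _).trans (hK ξ)
  calc ‖tp B d ξ‖ * ‖u ξ‖ ≤ K * 1 := mul_le_mul (hK ξ) (hu1 ξ) (norm_nonneg _) h0
    _ = K := mul_one K

lemma quad_bE (E : Set ℝ) (hEf : MeasureTheory.volume E ≠ ⊤) (u : ℝ → ℂ) (hu : Measurable u) (hu1 : ∀ ξ, ‖u ξ‖ ≤ 1)
    (B : Finset ℕ) (ρ : ℕ → ℝ) (Err : ℝ) (hρ : ∀ θ : ℝ, ‖∑ n ∈ B, (ρ n : ℂ) * e (n * θ)‖ ≤ Err) :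
    ∑ n ∈ B, ρ n * ‖bE E u n‖ ^ 2 ≤ Err * MeasureTheory.volume.real E ^ 2 := by
  have h1 : ∀ ξ, ‖tp B (fun n => (ρ n : ℂ) * (starRingEnd ℂ) (bE E u n)) ξ‖ ≤ Err * MeasureTheory.volume.real E := by
    intro ξ
    have h2 := sum_bE_le E hEf u hu hu1 B (fun n => (ρ n : ℂ) * e (-(n * ξ))) Err (by
      intro η
      have := hρ (η - ξ)
      refine le_trans (le_of_eq ?_) this
      rw [tp]; congr 1
      refine Finset.sum_congr rfl fun n _ => ?_
      rw [mul_assoc, ← e_add]; congr 2; ring)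
    refine le_trans (le_of_eq ?_) h2
    rw [← Complex.norm_conj, tp, map_sum]
    congr 1
    refine Finset.sum_congr rfl fun n _ => ?_
    rw [map_mul, map_mul, Complex.conj_conj, Complex.conj_ofReal, e_neg]; ring
  have h3 := sum_bE_le E hEf u hu hu1 B _ _ h1
  have e1 : ∑ n ∈ B, (ρ n : ℂ) * (starRingEnd ℂ) (bE E u n) * bE E u n = ((∑ n ∈ B, ρ n * ‖bE E u n‖ ^ 2 : ℝ) : ℂ) := by
    push_cast
    refine Finset.sum_congr rfl fun n _ => ?_
    rw [mul_assoc, Complex.conj_mul']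
  rw [e1, Complex.norm_real, Real.norm_eq_abs] at h3
  calc _ ≤ _ := (le_abs_self _).trans h3
    _ = _ := by ring

lemma bessel_bE (E : Set ℝ) (hEm : MeasurableSet E) (hE : E ⊆ Ioc 0 1) (u : ℝ → ℂ) (hu : Measurable u) (hu1 : ∀ ξ, ‖u ξ‖ ≤ 1)
    (B : Finset ℕ) : ∑ n ∈ B, ‖bE E u n‖ ^ 2 ≤ MeasureTheory.volume.real E := by
  have hEf : MeasureTheory.volume E ≠ ⊤ := ((MeasureTheory.measure_mono hE).trans_lt (by simp)).ne
  obtain ⟨d, hd⟩ : ∃ d : ℕ → ℂ, d = fun n => (starRingEnd ℂ) (bE E u n) := ⟨_, rfl⟩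
  have e1 : ∑ n ∈ B, d n * bE E u n = ((∑ n ∈ B, ‖bE E u n‖ ^ 2 : ℝ) : ℂ) := by
    push_cast
    refine Finset.sum_congr rfl fun n _ => ?_
    rw [hd, Complex.conj_mul']
  have h1 := sum_bE E hEf u hu hu1 B d
  rw [e1] at h1
  have hc : Continuous fun ξ => ‖tp B d ξ‖ ^ 2 := (continuous_tp B d).norm.pow 2
  have hi : MeasureTheory.IntegrableOn (fun ξ => ‖tp B d ξ‖ ^ 2) (Ioc 0 1) := (hc.integrableOn_Icc (a := 0) (b := 1)).mono_set Ioc_subset_Icc_self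
  have hiE := hi.mono_set hE
  have h1i : MeasureTheory.IntegrableOn (fun _ : ℝ => (1:ℝ)) E := MeasureTheory.integrableOn_const hEf
  have h2 : ‖∫ ξ in E, tp B d ξ * u ξ‖ ≤ ∫ ξ in E, ((‖tp B d ξ‖ ^ 2 + 1) / 2) := by
    refine MeasureTheory.norm_integral_le_of_norm_le ((hiE.add h1i).div_const 2) ?_
    refine Filter.Eventually.of_forall fun ξ => ?_
    rw [norm_mul]
    have := hu1 ξ
    have h0 := norm_nonneg (tp B d ξ)
    nlinarith [sq_nonneg (‖tp B d ξ‖ - 1)]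
  have h3 : ∫ ξ in E, ((‖tp B d ξ‖ ^ 2 + 1) / 2) = ((∫ ξ in E, ‖tp B d ξ‖ ^ 2) + MeasureTheory.volume.real E) / 2 := by
    rw [MeasureTheory.integral_div, MeasureTheory.integral_add hiE h1i]
    simp
  have h4 : ∫ ξ in E, ‖tp B d ξ‖ ^ 2 ≤ ∑ n ∈ B, ‖bE E u n‖ ^ 2 := by
    have : ∫ ξ in E, ‖tp B d ξ‖ ^ 2 ≤ ∫ ξ in Ioc 0 1, ‖tp B d ξ‖ ^ 2 :=
      MeasureTheory.setIntegral_mono_set hi (Filter.Eventually.of_forall fun ξ => by positivity) (HasSubset.Subset.eventuallyLE hE)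
    refine this.trans (le_of_eq ?_)
    rw [← intervalIntegral.integral_of_le (by norm_num), parseval]
    simp [hd]
  rw [← h1, Complex.norm_real, Real.norm_eq_abs, h3] at h2
  have := le_abs_self (∑ n ∈ B, ‖bE E u n‖ ^ 2)
  linarith

theorem level_set (B P : Finset ℕ) (hPB : P ⊆ B) (ν : ℕ → ℝ) (ν0 Err : ℝ) (hν : ∀ n, 0 ≤ ν n) (hν0 : 0 ≤ ν0)
    (hP : ∀ p ∈ P, 1 ≤ ν p) (hErr : ∀ θ : ℝ, ‖∑ n ∈ B, ((ν n - ν0 : ℝ) : ℂ) * e (n * θ)‖ ≤ Err)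
    (c : ℕ → ℂ) (hc : ∀ n, ‖c n‖ ≤ 1) (lam : ℝ) (hlam : 0 ≤ lam) (E : Set ℝ) (hEdef : E = {ξ | ξ ∈ Ioc (0:ℝ) 1 ∧ lam < ‖tp P c ξ‖}) :
    (lam * MeasureTheory.volume.real E) ^ 2 ≤ P.card * (ν0 * MeasureTheory.volume.real E + Err * MeasureTheory.volume.real E ^ 2) := by
  have hcont := continuous_tp P c
  have hEm : MeasurableSet E := by
    rw [hEdef]
    exact measurableSet_Ioc.inter (measurableSet_lt measurable_const hcont.norm.measurable)
  have hE : E ⊆ Ioc 0 1 := by rw [hEdef]; exact fun ξ h => h.1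
  have hEf : MeasureTheory.volume E ≠ ⊤ := ((MeasureTheory.measure_mono hE).trans_lt (by simp)).ne
  obtain ⟨m, hm⟩ : ∃ m, m = MeasureTheory.volume.real E := ⟨_, rfl⟩
  have hm0 : 0 ≤ m := by rw [hm]; exact MeasureTheory.measureReal_nonneg
  obtain ⟨u, hu⟩ : ∃ u : ℝ → ℂ, u = fun ξ => (starRingEnd ℂ) (tp P c ξ) / ‖tp P c ξ‖ := ⟨_, rfl⟩
  have hum : Measurable u := by
    rw [hu]
    exact (Complex.continuous_conj.measurable.comp hcont.measurable).div (Complex.measurable_ofReal.comp hcont.norm.measurable)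
  have hu1 : ∀ ξ, ‖u ξ‖ ≤ 1 := by
    intro ξ
    rw [hu]
    simp only [norm_div, Complex.norm_conj, Complex.norm_real, norm_norm]
    exact div_self_le_one _
  have hfu : ∀ ξ, tp P c ξ * u ξ = ((‖tp P c ξ‖ : ℝ) : ℂ) := by
    intro ξ
    rw [hu]
    by_cases h : tp P c ξ = 0
    · simp [h]
    · have : ((‖tp P c ξ‖ : ℝ) : ℂ) ≠ 0 := by simpa using h
      simp only
      rw [mul_div_assoc', Complex.mul_conj', div_eq_iff this]; ring
  have hin : MeasureTheory.IntegrableOn (fun ξ => ‖tp P c ξ‖) E := ((hcont.norm.integrableOn_Icc (a := 0) (b := 1)).mono_set Ioc_subset_Icc_self).mono_set hE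
  have hlow : lam * m ≤ ∑ n ∈ P, ‖bE E u n‖ := by
    have h1 : lam * m ≤ ∫ ξ in E, ‖tp P c ξ‖ := by
      have := MeasureTheory.setIntegral_mono_on (f := fun _ => lam) (MeasureTheory.integrableOn_const hEf) hin hEm (fun ξ h => by
        rw [hEdef] at h; exact h.2.le)
      simpa [← hm, mul_comm] using this
    have h2 := sum_bE E hEf u hum hu1 P c
    simp only [hfu] at h2
    rw [integral_complex_ofReal] at h2
    have h3 : ‖∑ n ∈ P, c n * bE E u n‖ ≤ ∑ n ∈ P, ‖bE E u n‖ := by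
      refine (norm_sum_le _ _).trans (Finset.sum_le_sum fun n _ => ?_)
      rw [norm_mul]
      exact mul_le_of_le_one_left (norm_nonneg _) (hc n)
    rw [h2, Complex.norm_real, Real.norm_eq_abs] at h3
    exact h1.trans ((le_abs_self _).trans h3)
  have hcs : (∑ n ∈ P, ‖bE E u n‖) ^ 2 ≤ P.card * ∑ n ∈ P, ‖bE E u n‖ ^ 2 := sq_sum_le_card_mul_sum_sq
  have hub : ∑ n ∈ P, ‖bE E u n‖ ^ 2 ≤ ν0 * m + Err * m ^ 2 := by
    calc ∑ n ∈ P, ‖bE E u n‖ ^ 2 ≤ ∑ n ∈ P, ν n * ‖bE E u n‖ ^ 2 := Finset.sum_le_sum fun n hn => le_mul_of_one_le_left (by positivity) (hP n hn)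
      _ ≤ ∑ n ∈ B, ν n * ‖bE E u n‖ ^ 2 := Finset.sum_le_sum_of_subset_of_nonneg hPB fun n _ _ => mul_nonneg (hν n) (by positivity)
      _ = ν0 * (∑ n ∈ B, ‖bE E u n‖ ^ 2) + ∑ n ∈ B, (ν n - ν0) * ‖bE E u n‖ ^ 2 := by
        rw [Finset.mul_sum, ← Finset.sum_add_distrib]; exact Finset.sum_congr rfl fun n _ => by ring
      _ ≤ _ := by
        refine add_le_add (mul_le_mul_of_nonneg_left ?_ hν0) ?_
        · rw [hm]; exact bessel_bE E hEm hE u hum hu1 B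
        · rw [hm]; exact quad_bE E hEf u hum hu1 B _ Err hErr
  rw [← hm]
  calc (lam * m) ^ 2 ≤ (∑ n ∈ P, ‖bE E u n‖) ^ 2 := by gcongr
    _ ≤ _ := hcs
    _ ≤ _ := by gcongr

lemma dyadic_pt1 (F P0 r : ℝ) (hr : 2 < r) (hF : 0 ≤ F) (hFP : F ≤ P0) (J : ℕ) (h : P0 * (1 / 2) ^ J < F) :
    F ^ r ≤ ∑ j ∈ Finset.range J, if P0 * (1 / 2) ^ (j + 1) < F then (P0 * (1 / 2) ^ j) ^ r else 0 := by
  have hP0 : 0 ≤ P0 := hF.trans hFP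
  induction J with
  | zero => simp at h; linarith
  | succ J ih =>
    rw [Finset.sum_range_succ]
    by_cases h2 : P0 * (1 / 2) ^ J < F
    · refine (ih h2).trans (le_add_of_nonneg_right ?_)
      split_ifs <;> positivity
    · push Not at h2
      rw [if_pos h]
      refine le_add_of_nonneg_of_le (Finset.sum_nonneg fun j _ => ?_) ?_
      · split_ifs <;> positivity
      · exact Real.rpow_le_rpow hF h2 (by linarith)

lemma dyadic_pt (F P0 r : ℝ) (hr : 2 < r) (hF : 0 ≤ F) (hFP : F ≤ P0) (J : ℕ) :
    F ^ r ≤ (∑ j ∈ Finset.range J, if P0 * (1 / 2) ^ (j + 1) < F then (P0 * (1 / 2) ^ j) ^ r else 0) + (P0 * (1 / 2) ^ J) ^ (r - 2) * F ^ 2 := by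
  have hP0 : 0 ≤ P0 := hF.trans hFP
  by_cases h : P0 * (1 / 2) ^ J < F
  · exact (dyadic_pt1 F P0 r hr hF hFP J h).trans (le_add_of_nonneg_right (by positivity))
  · push Not at h
    refine le_add_of_nonneg_of_le (Finset.sum_nonneg fun j _ => ?_) ?_
    · split_ifs <;> positivity
    · have : F ^ r = F ^ (r - 2) * F ^ 2 := by
        rw [← Real.rpow_natCast F 2, ← Real.rpow_add' hF (by push_cast; linarith)]
        congr 1; push_cast; ring
      rw [this]
      exact mul_le_mul_of_nonneg_right (Real.rpow_le_rpow hF h (by linarith)) (by positivity)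

lemma cont_tp_rpow (P : Finset ℕ) (c : ℕ → ℂ) {r : ℝ} (hr : 0 ≤ r) : Continuous fun ξ => ‖tp P c ξ‖ ^ r :=
  (continuous_tp P c).norm.rpow_const fun _ => Or.inr hr

theorem dyadic_int (P : Finset ℕ) (c : ℕ → ℂ) (hc : ∀ n, ‖c n‖ ≤ 1) (P0 r s K : ℝ) (hP0 : (P.card : ℝ) ≤ P0) (hr : 2 < r) (hs : s < r) (hK : 0 ≤ K) (J : ℕ)
    (hlev : ∀ j < J, MeasureTheory.volume.real {ξ | ξ ∈ Ioc (0:ℝ) 1 ∧ P0 * (1 / 2) ^ (j + 1) < ‖tp P c ξ‖} ≤ K * ((2:ℝ) ^ s) ^ (j + 1)) :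
    ∫ ξ in (0:ℝ)..1, ‖tp P c ξ‖ ^ r ≤ P0 ^ r * K * (2:ℝ) ^ s / (1 - (2:ℝ) ^ (s - r)) + (P0 * (1 / 2) ^ J) ^ (r - 2) * P0 := by
  have hP00 : 0 ≤ P0 := (Nat.cast_nonneg _).trans hP0
  have hcont := continuous_tp P c
  set E : ℕ → Set ℝ := fun j => {ξ | ξ ∈ Ioc (0:ℝ) 1 ∧ P0 * (1 / 2) ^ (j + 1) < ‖tp P c ξ‖} with hE
  have hEm : ∀ j, MeasurableSet (E j) := fun j =>
    measurableSet_Ioc.inter (measurableSet_lt measurable_const hcont.norm.measurable)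
  have hEs : ∀ j, E j ⊆ Ioc 0 1 := fun j ξ h => h.1
  have hEf : ∀ j, MeasureTheory.volume (E j) ≠ ⊤ := fun j => ((MeasureTheory.measure_mono (hEs j)).trans_lt (by simp)).ne
  have hi2 : MeasureTheory.IntegrableOn (fun ξ => ‖tp P c ξ‖ ^ 2) (Ioc 0 1) := ((hcont.norm.pow 2).integrableOn_Icc (a := 0) (b := 1)).mono_set Ioc_subset_Icc_self
  have hir : MeasureTheory.IntegrableOn (fun ξ => ‖tp P c ξ‖ ^ r) (Ioc 0 1) := ((cont_tp_rpow P c (by linarith)).integrableOn_Icc (a := 0) (b := 1)).mono_set Ioc_subset_Icc_self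
  have hind : ∀ j ∈ Finset.range J, MeasureTheory.IntegrableOn ((E j).indicator fun _ => (P0 * (1 / 2) ^ j) ^ r) (Ioc 0 1) := fun j _ =>
    ((MeasureTheory.integrable_indicator_iff (hEm j)).2 (MeasureTheory.integrableOn_const (hEf j))).integrableOn
  have hsumi : MeasureTheory.IntegrableOn (fun ξ => ∑ j ∈ Finset.range J, (E j).indicator (fun _ => (P0 * (1 / 2) ^ j) ^ r) ξ) (Ioc 0 1) :=
    MeasureTheory.integrable_finsetSum _ hind
  rw [intervalIntegral.integral_of_le (by norm_num)]
  have h1 : ∫ ξ in Ioc (0:ℝ) 1, ‖tp P c ξ‖ ^ r ≤ ∫ ξ in Ioc (0:ℝ) 1, ((∑ j ∈ Finset.range J, (E j).indicator (fun _ => (P0 * (1 / 2) ^ j) ^ r) ξ) + (P0 * (1 / 2) ^ J) ^ (r - 2) * ‖tp P c ξ‖ ^ 2) := by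
    refine MeasureTheory.setIntegral_mono_on hir (hsumi.add (hi2.const_mul _)) measurableSet_Ioc fun ξ hξ => ?_
    refine (dyadic_pt _ P0 r hr (norm_nonneg _) ((norm_tp_le P c hc ξ).trans hP0) J).trans (le_of_eq ?_)
    congr 1
    refine Finset.sum_congr rfl fun j _ => ?_
    rw [Set.indicator_apply]
    refine if_congr ?_ rfl rfl
    exact ⟨fun h => ⟨hξ, h⟩, fun h => h.2⟩
  refine h1.trans ?_
  rw [MeasureTheory.integral_add hsumi (hi2.const_mul _), MeasureTheory.integral_finsetSum _ hind, MeasureTheory.integral_const_mul]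
  refine add_le_add ?_ ?_
  · have h2 : ∀ j ∈ Finset.range J, ∫ ξ in Ioc (0:ℝ) 1, (E j).indicator (fun _ => (P0 * (1 / 2) ^ j) ^ r) ξ ≤ P0 ^ r * K * (2:ℝ) ^ s * ((2:ℝ) ^ (s - r)) ^ j := by
      intro j hj
      rw [MeasureTheory.setIntegral_indicator (hEm j), Set.inter_eq_right.2 (hEs j), MeasureTheory.setIntegral_const, smul_eq_mul]
      have h3 := hlev j (Finset.mem_range.1 hj)
      calc MeasureTheory.volume.real (E j) * (P0 * (1 / 2) ^ j) ^ r ≤ (K * ((2:ℝ) ^ s) ^ (j + 1)) * (P0 * (1 / 2) ^ j) ^ r := by gcongr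
        _ = _ := by
          have e1 : (((1:ℝ) / 2) ^ j) ^ r = (((2:ℝ) ^ r) ^ j)⁻¹ := by
            rw [one_div, inv_pow, Real.inv_rpow (by positivity), ← Real.rpow_natCast 2 j, ← Real.rpow_mul (by norm_num), mul_comm (j:ℝ) r, Real.rpow_mul (by norm_num), Real.rpow_natCast]
          rw [Real.mul_rpow hP00 (by positivity), e1, Real.rpow_sub (by norm_num), div_pow, pow_succ]
          field_simp
    refine (Finset.sum_le_sum h2).trans ?_
    rw [← Finset.mul_sum, div_eq_mul_inv]
    have hq : (2:ℝ) ^ (s - r) < 1 := Real.rpow_lt_one_of_one_lt_of_neg (by norm_num) (by linarith)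
    have hq0 : (0:ℝ) ≤ (2:ℝ) ^ (s - r) := by positivity
    have : ∑ j ∈ Finset.range J, ((2:ℝ) ^ (s - r)) ^ j ≤ (1 - (2:ℝ) ^ (s - r))⁻¹ := by
      rw [← tsum_geometric_of_lt_one hq0 hq]
      exact (summable_geometric_of_lt_one hq0 hq).sum_le_tsum _ fun _ _ => by positivity
    gcongr
  · refine mul_le_mul_of_nonneg_left ?_ (by positivity)
    rw [← intervalIntegral.integral_of_le (by norm_num), parseval]
    refine (Finset.sum_le_card_nsmul _ _ 1 fun n _ => ?_).trans (by simpa using hP0)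
    exact pow_le_one₀ (norm_nonneg _) (hc n)

lemma ev_log (ε : ℝ) (hε : 0 < ε) : ∀ᶠ x : ℝ in atTop, Real.log x ≤ x ^ ε := by
  have h := (isLittleO_log_rpow_atTop hε).bound (show (0:ℝ) < 1 by norm_num)
  filter_upwards [h, eventually_ge_atTop (1:ℝ)] with x hx h1
  rw [one_mul, Real.norm_eq_abs, Real.norm_eq_abs, abs_of_nonneg (by positivity : 0 ≤ x ^ ε)] at hx
  exact (le_abs_self _).trans hx

namespace Reg
variable {S : Set ℕ} {γ' Y0 : ℝ} {φ φ1 H H1 : ℝ → ℝ}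

lemma X_lower (R : Reg S γ' φ φ1 H H1 Y0) (β : ℝ) (hβ : β < γ') : ∀ᶠ x : ℝ in atTop, x ^ β ≤ φ x / Real.log x := by
  filter_upwards [ev_log (γ' - β) (by linarith), eventually_ge_atTop Y0, eventually_ge_atTop (3:ℝ)] with x h1 h2 h3
  have hl : 0 < Real.log x := Real.log_pos (by linarith)
  rw [le_div_iff₀ hl]
  calc x ^ β * Real.log x ≤ x ^ β * x ^ (γ' - β) := by gcongr
    _ = x ^ γ' := by rw [← Real.rpow_add (by linarith)]; congr 1; ring
    _ ≤ _ := R.growth' h2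

set_option maxHeartbeats 2000000 in
theorem block (R : Reg S γ' φ φ1 H H1 Y0) (hγ : 15 / 16 < γ') (r : ℝ) (hr : 2 < r) (hγr : 1 - (r - 2) / 8 < γ') :
    ∃ C > 0, ∃ N0 : ℕ, ∀ N : ℕ, N0 ≤ N → ∀ c : ℕ → ℂ, (∀ n, ‖c n‖ ≤ 1) →
    ∫ ξ in (0:ℝ)..1, ‖tp ((Finset.Ico (N / 4 + 1) (N + 1)).filter (fun p => p ∈ S)) c ξ‖ ^ r ≤ C * ((φ N / Real.log N) ^ r / N) := by
  obtain ⟨κ, hκ⟩ : ∃ κ : ℝ, κ = min (1/4) ((r - 2) / 16) := ⟨_, rfl⟩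
  have hκ0 : 0 < κ := by rw [hκ]; exact lt_min (by norm_num) (by linarith)
  have hκ4 : κ ≤ 1 / 4 := by rw [hκ]; exact min_le_left _ _
  have hκr : κ ≤ (r - 2) / 16 := by rw [hκ]; exact min_le_right _ _
  obtain ⟨s, hs⟩ : ∃ s : ℝ, s = 2 + 8 * κ := ⟨_, rfl⟩
  have hsr : s < r := by linarith
  obtain ⟨C, hC, N1, hmaj⟩ := R.maj hγ κ hκ0
  have hev : ∀ᶠ x : ℝ in atTop, x ^ (93/100:ℝ) ≤ φ x / Real.log x ∧ x ^ (1 - (r - 2) / 8) ≤ φ x / Real.log x ∧ (4:ℝ) * x ^ (91/100:ℝ) ≤ x ^ (93/100:ℝ) ∧ 2 ≤ x :=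
    (R.X_lower _ (by linarith)).and ((R.X_lower _ hγr).and ((ev_pow _ _ _ (by norm_num)).and (eventually_ge_atTop 2)))
  obtain ⟨N2, hN2⟩ := eventually_atTop.1 (tendsto_natCast_atTop_atTop.eventually hev)
  have hq : (2:ℝ) ^ (s - r) < 1 := Real.rpow_lt_one_of_one_lt_of_neg (by norm_num) (by linarith)
  have hq1 : 0 < 1 - (2:ℝ) ^ (s - r) := by linarith
  refine ⟨(2 * C + 1) ^ r * (4:ℝ) ^ (4 * κ) * (2:ℝ) ^ s / (1 - (2:ℝ) ^ (s - r)) + (2 * C + 1) ^ r * (2:ℝ) ^ (r - 2), by positivity, max N1 N2, fun N hN c hc => ?_⟩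
  have hmaj := hmaj N ((le_max_left _ _).trans hN)
  obtain ⟨hX1, hX2, hp, h2⟩ := hN2 N ((le_max_right _ _).trans hN)
  set B := Finset.Ico (N / 4 + 1) (N + 1) with hB
  set P := B.filter (fun p => p ∈ S) with hP
  obtain ⟨X, hXdef⟩ : ∃ X, X = φ N / Real.log N := ⟨_, rfl⟩
  rw [← hXdef] at hmaj hX1 hX2 ⊢
  have hNp : (0:ℝ) < N := by linarith
  have hX0 : 0 < X := lt_of_lt_of_le (by positivity) hX1
  have h66 : ∀ t : ℝ, 0 < t → t ≤ (N:ℝ) ^ (1/8:ℝ) → (N:ℝ) ^ (66/100:ℝ) ≤ X / (4 * t ^ 2) := by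
    intro t ht0 ht
    have h1 : t ^ 2 ≤ (N:ℝ) ^ (1/4:ℝ) := by
      calc t ^ 2 ≤ ((N:ℝ) ^ (1/8:ℝ)) ^ 2 := by gcongr
        _ = _ := by rw [← Real.rpow_natCast, ← Real.rpow_mul hNp.le]; norm_num
    rw [le_div_iff₀ (by positivity)]
    calc (N:ℝ) ^ (66/100:ℝ) * (4 * t ^ 2) ≤ (N:ℝ) ^ (66/100:ℝ) * (4 * (N:ℝ) ^ (1/4:ℝ)) := by gcongr
      _ = 4 * (N:ℝ) ^ (91/100:ℝ) := by
        rw [show (91/100:ℝ) = 66/100 + 1/4 by norm_num, Real.rpow_add hNp]; ring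
      _ ≤ X := hp.trans hX1
  have h18 : (1:ℝ) ≤ (N:ℝ) ^ (1/8:ℝ) := Real.one_le_rpow (by linarith) (by norm_num)
  have hBc : (B.card : ℝ) ≤ N := by
    rw [hB, Nat.card_Ico]; have : N + 1 - (N / 4 + 1) ≤ N := by omega
    exact_mod_cast this
  -- count
  have hcard : (P.card : ℝ) ≤ (2 * C + 1) * X := by
    obtain ⟨ν, ν0, hν, hν0, hνP, hν0le, hErr⟩ := hmaj 1 le_rfl
    have h1 := hErr 0
    simp only [mul_zero, e_zero, mul_one, Nat.cast_one, Real.one_rpow, Real.sqrt_one, div_one] at h1 hν0le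
    rw [← Complex.ofReal_sum, Complex.norm_real, Real.norm_eq_abs, Finset.sum_sub_distrib, Finset.sum_const, nsmul_eq_mul] at h1
    have h3 := (le_abs_self _).trans h1
    have h4 : (P.card : ℝ) ≤ ∑ n ∈ B, ν n := by
      calc (P.card : ℝ) = ∑ n ∈ P, 1 := by simp
        _ ≤ ∑ n ∈ P, ν n := Finset.sum_le_sum hνP
        _ ≤ _ := Finset.sum_le_sum_of_subset_of_nonneg (Finset.filter_subset _ _) fun n _ _ => hν n
    have h5 : (B.card : ℝ) * ν0 ≤ C * X := by
      calc (B.card : ℝ) * ν0 ≤ N * (C * X / N) := by gcongr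
        _ = C * X := by field_simp
    have h6 := h66 1 one_pos h18
    have h7 : X / (4 * 1 ^ 2) ≤ X := by rw [one_pow, mul_one]; linarith
    linarith
  obtain ⟨P0, hP0⟩ : ∃ P0, P0 = (2 * C + 1) * X := ⟨_, rfl⟩
  rw [← hP0] at hcard
  have hP0p : 0 < P0 := by rw [hP0]; positivity
  obtain ⟨J, hJ1, hJ2⟩ := exists_nat_pow_near h18 (show (1:ℝ) < 2 by norm_num)
  have hmain := dyadic_int P c hc P0 r s ((4:ℝ) ^ (4 * κ) / N) hcard hr hsr (by positivity) J (by
    intro j hj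
    obtain ⟨t, ht⟩ : ∃ t : ℝ, t = 2 ^ (j + 1) := ⟨_, rfl⟩
    have ht0 : 0 < t := by rw [ht]; positivity
    have ht1 : t ≤ (N:ℝ) ^ (1/8:ℝ) := by
      refine le_trans ?_ hJ1
      rw [ht]; exact pow_le_pow_right₀ (by norm_num) hj
    have hα : ((1:ℝ) / 2) ^ (j + 1) = 1 / t := by rw [ht, one_div_pow]
    rw [hα]
    have hts : ((2:ℝ) ^ s) ^ (j + 1) = t ^ s := by
      rw [ht, ← Real.rpow_natCast, ← Real.rpow_natCast, ← Real.rpow_mul (by norm_num), ← Real.rpow_mul (by norm_num), mul_comm]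
    rw [hts]
    obtain ⟨ν, ν0, hν, hν0, hνP, hν0le, hErr⟩ := hmaj ((4 * (2 ^ (j + 1)) ^ 2) ^ 4) (Nat.one_le_iff_ne_zero.2 (by positivity))
    have hz : (((4 * (2 ^ (j + 1)) ^ 2) ^ 4 : ℕ) : ℝ) = (4 * t ^ 2) ^ 4 := by rw [ht]; push_cast; ring
    rw [hz] at hν0le hErr
    obtain ⟨w, hw⟩ : ∃ w, w = 4 * t ^ 2 := ⟨_, rfl⟩
    rw [← hw] at hν0le hErr
    have hw1 : 1 ≤ w := by
      have : (1:ℝ) ≤ t := by rw [ht]; exact one_le_pow₀ (by norm_num)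
      rw [hw]; nlinarith
    have hwκ : (w ^ 4) ^ κ = w ^ (4 * κ) := by rw [← Real.rpow_natCast w 4, ← Real.rpow_mul (by linarith)]; norm_num
    have hwκ1 : w ^ (4 * κ) ≤ w := by
      calc w ^ (4 * κ) ≤ w ^ (1:ℝ) := Real.rpow_le_rpow_of_exponent_le hw1 (by linarith)
        _ = w := Real.rpow_one w
    have hwκ2 : w ^ (4 * κ) = (4:ℝ) ^ (4 * κ) * t ^ (8 * κ) := by
      rw [hw, Real.mul_rpow (by norm_num) (by positivity), ← Real.rpow_natCast t 2, ← Real.rpow_mul ht0.le]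
      congr 2; push_cast; ring
    have hsq : √(w ^ 4) = w ^ 2 := by
      rw [show w ^ 4 = (w ^ 2) ^ 2 by ring]; exact Real.sqrt_sq (by positivity)
    rw [hwκ, hsq] at hErr
    rw [hwκ] at hν0le
    have hlev := level_set B P (Finset.filter_subset _ _) ν ν0 (P0 / (2 * t ^ 2)) hν hν0 hνP (fun θ => (hErr θ).trans (by
      have h6 := h66 t ht0 ht1
      rw [← hw] at h6
      have e1 : w ^ (4 * κ) / w ^ 2 ≤ 1 / w := by
        rw [div_le_div_iff₀ (by positivity) (by positivity)]; nlinarith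
      calc C * X * (w ^ (4 * κ) / w ^ 2) + (N:ℝ) ^ (66/100:ℝ) ≤ C * X * (1 / w) + X / w := by gcongr
        _ = (C + 1) * X / w := by ring
        _ ≤ 2 * ((2 * C + 1) * X) / w := div_le_div_of_nonneg_right (by have := mul_pos hC hX0; linarith) (by linarith)
        _ = P0 / (2 * t ^ 2) := by rw [hP0, hw]; field_simp; norm_num)) c hc (P0 * (1 / t)) (by positivity) _ rfl
    obtain ⟨m, hm⟩ : ∃ m, m = MeasureTheory.volume.real {ξ | ξ ∈ Ioc (0:ℝ) 1 ∧ P0 * (1 / t) < ‖tp P c ξ‖} := ⟨_, rfl⟩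
    rw [← hm] at hlev ⊢
    have hm0 : 0 ≤ m := by rw [hm]; exact MeasureTheory.measureReal_nonneg
    rcases hm0.eq_or_lt with h0 | hmp
    · rw [← h0]; positivity
    have hl2 : (P0 * (1 / t) * m) ^ 2 ≤ P0 * (ν0 * m + P0 / (2 * t ^ 2) * m ^ 2) :=
      hlev.trans (mul_le_mul_of_nonneg_right hcard (by positivity))
    have hl3 : P0 * m ≤ 2 * t ^ 2 * ν0 := by
      have e1 : (P0 * (1 / t) * m) ^ 2 = P0 * m * (P0 * m / t ^ 2) := by field_simp
      have e2 : P0 * (ν0 * m + P0 / (2 * t ^ 2) * m ^ 2) = P0 * m * (ν0 + P0 * m / t ^ 2 / 2) := by field_simp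
      rw [e1, e2] at hl2
      have := le_of_mul_le_mul_left hl2 (by positivity)
      have h8 : P0 * m / t ^ 2 ≤ 2 * ν0 := by linarith
      rw [div_le_iff₀ (by positivity)] at h8; linarith
    have hl4 : P0 * m ≤ P0 * ((4:ℝ) ^ (4 * κ) / N * t ^ s) := by
      refine hl3.trans ?_
      calc 2 * t ^ 2 * ν0 ≤ 2 * t ^ 2 * (C * X * w ^ (4 * κ) / N) := by gcongr
        _ = (2 * C) * X * (w ^ (4 * κ) / N * t ^ 2) := by ring
        _ ≤ (2 * C + 1) * X * (w ^ (4 * κ) / N * t ^ 2) := by gcongr; linarith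
        _ = _ := by
          rw [← hP0, hwκ2, hs, Real.rpow_add ht0, ← Real.rpow_natCast t 2]; push_cast; ring
    exact le_of_mul_le_mul_left hl4 hP0p)
  refine hmain.trans ?_
  have hP0r : P0 ^ r = (2 * C + 1) ^ r * X ^ r := by rw [hP0, Real.mul_rpow (by positivity) hX0.le]
  have hsecond : (P0 * (1 / 2) ^ J) ^ (r - 2) * P0 ≤ (2 * C + 1) ^ r * (2:ℝ) ^ (r - 2) * (X ^ r / N) := by
    have h1 : ((1:ℝ) / 2) ^ J ≤ 2 * (N:ℝ) ^ (-(1/8):ℝ) := by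
      rw [one_div_pow, Real.rpow_neg hNp.le, ← div_eq_mul_inv, div_le_div_iff₀ (by positivity) (by positivity), one_mul, ← pow_succ']
      exact hJ2.le
    have h3 : (((1:ℝ) / 2) ^ J) ^ (r - 2) ≤ (2:ℝ) ^ (r - 2) * (X / N) := by
      calc (((1:ℝ) / 2) ^ J) ^ (r - 2) ≤ (2 * (N:ℝ) ^ (-(1/8):ℝ)) ^ (r - 2) := Real.rpow_le_rpow (by positivity) h1 (by linarith)
        _ = (2:ℝ) ^ (r - 2) * ((N:ℝ) ^ (1 - (r - 2) / 8) / N) := by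
          rw [Real.mul_rpow (by norm_num) (by positivity), ← Real.rpow_mul hNp.le, Real.rpow_sub hNp, Real.rpow_one]
          rw [show -(1/8) * (r - 2) = -((r - 2) / 8) by ring, Real.rpow_neg hNp.le]
          field_simp
        _ ≤ _ := by gcongr
    rw [Real.mul_rpow hP0p.le (by positivity)]
    calc P0 ^ (r - 2) * (((1:ℝ) / 2) ^ J) ^ (r - 2) * P0 ≤ P0 ^ (r - 2) * ((2:ℝ) ^ (r - 2) * (X / N)) * P0 := by gcongr
      _ ≤ P0 ^ (r - 2) * ((2:ℝ) ^ (r - 2) * (P0 / N)) * P0 := by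
        gcongr; rw [hP0]; nlinarith
      _ = P0 ^ r * (2:ℝ) ^ (r - 2) / N := by
        have : P0 ^ r = P0 ^ (r - 2) * P0 ^ 2 := by
          rw [← Real.rpow_natCast P0 2, ← Real.rpow_add hP0p]; congr 1; push_cast; ring
        rw [this]; ring
      _ = _ := by rw [hP0r]; ring
  have hfirst : P0 ^ r * ((4:ℝ) ^ (4 * κ) / N) * (2:ℝ) ^ s / (1 - (2:ℝ) ^ (s - r)) = (2 * C + 1) ^ r * (4:ℝ) ^ (4 * κ) * (2:ℝ) ^ s / (1 - (2:ℝ) ^ (s - r)) * (X ^ r / N) := by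
    rw [hP0r]; field_simp
  rw [hfirst, add_mul]
  linarith

end Reg

lemma lower_int (P : Finset ℕ) (N : ℕ) (hN : 1 ≤ N) (hP : ∀ p ∈ P, p ≤ N) (r : ℝ) (hr : 0 < r) :
    ((P.card : ℝ) / 2) ^ r / (6 * N) ≤ ∫ ξ in (0:ℝ)..1, ‖tp P (fun _ => 1) ξ‖ ^ r := by
  have hN0 : (1:ℝ) ≤ N := by exact_mod_cast hN
  have hd : 1 / (6 * (N:ℝ)) ≤ 1 := by rw [div_le_one (by positivity)]; linarith
  have hd0 : 0 < 1 / (6 * (N:ℝ)) := by positivity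
  have hcont := cont_tp_rpow P (fun _ => 1) hr.le
  have hi : MeasureTheory.IntegrableOn (fun ξ => ‖tp P (fun _ => 1) ξ‖ ^ r) (Ioc 0 1) := (hcont.integrableOn_Icc (a := 0) (b := 1)).mono_set Ioc_subset_Icc_self
  have hsub : Ioc 0 (1 / (6 * (N:ℝ))) ⊆ Ioc 0 1 := Ioc_subset_Ioc_right hd
  rw [intervalIntegral.integral_of_le (by norm_num)]
  have h1 : ∫ ξ in Ioc 0 (1 / (6 * (N:ℝ))), ‖tp P (fun _ => 1) ξ‖ ^ r ≤ ∫ ξ in Ioc (0:ℝ) 1, ‖tp P (fun _ => 1) ξ‖ ^ r :=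
    MeasureTheory.setIntegral_mono_set hi (Filter.Eventually.of_forall fun ξ => by positivity) (LE.le.eventuallyLE hsub)
  refine le_trans ?_ h1
  have h2 : ∫ ξ in Ioc 0 (1 / (6 * (N:ℝ))), ((P.card : ℝ) / 2) ^ r ≤ ∫ ξ in Ioc 0 (1 / (6 * (N:ℝ))), ‖tp P (fun _ => 1) ξ‖ ^ r := by
    refine MeasureTheory.setIntegral_mono_on (MeasureTheory.integrableOn_const measure_Ioc_lt_top.ne) (hi.mono_set hsub) measurableSet_Ioc fun ξ hξ => ?_
    refine Real.rpow_le_rpow (by positivity) ?_ hr.le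
    refine le_trans ?_ (Complex.re_le_norm _)
    rw [tp, Complex.re_sum]
    have : ∀ p ∈ P, (1:ℝ) / 2 ≤ (1 * e (p * ξ)).re := by
      intro p hp
      have hp' : (p:ℝ) ≤ N := by exact_mod_cast hP p hp
      have h3 : (p:ℝ) * ξ ≤ 1 / 6 := by
        calc (p:ℝ) * ξ ≤ N * (1 / (6 * N)) := mul_le_mul hp' hξ.2 hξ.1.le (by linarith)
          _ = 1 / 6 := by field_simp
      have h0 : 0 ≤ (p:ℝ) * ξ := mul_nonneg (by positivity) hξ.1.le
      rw [one_mul, e_re, ← Real.cos_pi_div_three]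
      refine Real.cos_le_cos_of_nonneg_of_le_pi (by positivity) (by linarith [Real.pi_pos]) ?_
      nlinarith [Real.pi_pos]
    have := Finset.card_nsmul_le_sum _ _ _ this
    rw [nsmul_eq_mul] at this
    linarith
  refine le_trans (le_of_eq ?_) h2
  rw [MeasureTheory.setIntegral_const]
  simp
  ring

lemma upper_int (P : Finset ℕ) (c : ℕ → ℂ) (hc : ∀ n, ‖c n‖ ≤ 1) (r : ℝ) (hr : 0 < r) :
    ∫ ξ in (0:ℝ)..1, ‖tp P c ξ‖ ^ r ≤ (P.card : ℝ) ^ r := by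
  have := intervalIntegral.integral_mono_on (f := fun ξ => ‖tp P c ξ‖ ^ r) (g := fun _ => (P.card : ℝ) ^ r) (a := 0) (b := 1) (μ := MeasureTheory.volume) (by norm_num)
    ((cont_tp_rpow P c hr.le).intervalIntegrable _ _) (continuous_const.intervalIntegrable _ _)
    (fun ξ _ => Real.rpow_le_rpow (norm_nonneg _) (norm_tp_le P c hc ξ) hr.le)
  simpa using this

lemma add_rpow_tau (u v τ r : ℝ) (hu : 0 ≤ u) (hv : 0 ≤ v) (hτ : 0 < τ) (hr : 0 < r) :
    (u + v) ^ r ≤ (1 + τ) ^ r * u ^ r + (1 + 1 / τ) ^ r * v ^ r := by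
  by_cases h : v ≤ τ * u
  · refine le_add_of_le_of_nonneg ?_ (by positivity)
    rw [← Real.mul_rpow (by positivity) hu]
    exact Real.rpow_le_rpow (by positivity) (by linarith) hr.le
  · push Not at h
    refine le_add_of_nonneg_of_le (by positivity) ?_
    rw [← Real.mul_rpow (by positivity) hv]
    refine Real.rpow_le_rpow (by positivity) ?_ hr.le
    have : u ≤ v / τ := by rw [le_div_iff₀ hτ]; linarith
    calc u + v ≤ v / τ + v := by linarith
      _ = _ := by ring

lemma int_add_le (A B P : Finset ℕ) (hAB : Disjoint A B) (hP : P = A ∪ B) (c : ℕ → ℂ) (τ r : ℝ) (hτ : 0 < τ) (hr : 0 < r) :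
    ∫ ξ in (0:ℝ)..1, ‖tp P c ξ‖ ^ r ≤ (1 + τ) ^ r * (∫ ξ in (0:ℝ)..1, ‖tp A c ξ‖ ^ r) + (1 + 1 / τ) ^ r * ∫ ξ in (0:ℝ)..1, ‖tp B c ξ‖ ^ r := by
  have hA := cont_tp_rpow A c hr.le
  have hB := cont_tp_rpow B c hr.le
  rw [← intervalIntegral.integral_const_mul, ← intervalIntegral.integral_const_mul, ← intervalIntegral.integral_add
    ((hA.const_mul _).intervalIntegrable _ _) ((hB.const_mul _).intervalIntegrable _ _)]
  refine intervalIntegral.integral_mono_on (by norm_num) ((cont_tp_rpow P c hr.le).intervalIntegrable _ _)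
    (((hA.const_mul _).add (hB.const_mul _)).intervalIntegrable _ _) fun ξ _ => ?_
  refine le_trans (Real.rpow_le_rpow (norm_nonneg _) ?_ hr.le) (add_rpow_tau _ _ τ r (norm_nonneg _) (norm_nonneg _) hτ hr)
  rw [hP, tp, Finset.sum_union hAB]
  exact norm_add_le _ _

namespace Reg
variable {S : Set ℕ} {γ' Y0 : ℝ} {φ φ1 H H1 : ℝ → ℝ}

lemma T_step (R : Reg S γ' φ φ1 H H1 Y0) (r : ℝ) (hr : 2 < r) : ∃ N0 : ℕ, ∀ N : ℕ, N0 ≤ N →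
    (φ (N / 4 : ℕ) / Real.log (N / 4 : ℕ)) ^ r / (N / 4 : ℕ) ≤ 1 / 2 * ((φ N / Real.log N) ^ r / N) := by
  have hev : ∀ᶠ x : ℝ in atTop, 8 * Y0 ≤ x ∧ 8 ≤ x ∧ (8:ℝ) * x ^ (9/10:ℝ) ≤ x ^ (1:ℝ) :=
    (eventually_ge_atTop _).and ((eventually_ge_atTop _).and (ev_pow _ _ _ (by norm_num)))
  obtain ⟨N0, hN0⟩ := eventually_atTop.1 (tendsto_natCast_atTop_atTop.eventually hev)
  refine ⟨N0, fun N hN => ?_⟩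
  obtain ⟨hY8, h8, hp⟩ := hN0 N hN
  rw [Real.rpow_one] at hp
  have hY := R.one_le_Y0
  have h8' : 8 ≤ N := by exact_mod_cast h8
  have hM1 : 4 * (N / 4) ≤ N := by omega
  have hM2 : N ≤ 8 * (N / 4) := by omega
  obtain ⟨M, hM⟩ : ∃ M : ℕ, M = N / 4 := ⟨_, rfl⟩
  rw [← hM] at hM1 hM2 ⊢
  have hM1' : 4 * (M:ℝ) ≤ N := by exact_mod_cast hM1
  have hM2' : (N:ℝ) ≤ 8 * M := by exact_mod_cast hM2
  have hN0' : (0:ℝ) < N := by linarith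
  have hM0 : (0:ℝ) < M := by linarith
  have hlN : 0 < Real.log N := Real.log_pos (by linarith)
  have hlM : 9 / 10 * Real.log N ≤ Real.log M := by
    rw [← Real.log_rpow hN0']
    exact Real.log_le_log (by positivity) (by linarith)
  have hφN : 1 ≤ φ N := R.one_le N (by show Y0 ≤ (N:ℝ); linarith)
  have hφM : 1 ≤ φ M := R.one_le M (by show Y0 ≤ (M:ℝ); linarith)
  obtain ⟨w, hw⟩ : ∃ w : ℝ, w = M / N := ⟨_, rfl⟩
  have hw0 : 0 < w := by rw [hw]; positivity
  have hw4 : w ≤ 1 / 4 := by rw [hw, div_le_div_iff₀ hN0' (by norm_num)]; linarith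
  have h1 : φ M ≤ w ^ (15/16:ℝ) * φ N := by
    have := R.phi_pow (show Y0 ≤ (M:ℝ) by linarith) (show Y0 ≤ (N:ℝ) by linarith) (by linarith)
    simp only at this
    rw [Real.rpow_neg hM0.le, Real.rpow_neg hN0'.le, ← div_eq_mul_inv, ← div_eq_mul_inv, div_le_div_iff₀ (by positivity) (by positivity)] at this
    rw [hw, Real.div_rpow hM0.le hN0'.le, div_mul_eq_mul_div, le_div_iff₀ (by positivity)]
    linarith
  have h2 : w ^ (1/8:ℝ) ≤ 9 / 10 := by
    calc w ^ (1/8:ℝ) ≤ ((9/10:ℝ) ^ 8) ^ (1/8:ℝ) := Real.rpow_le_rpow hw0.le (hw4.trans (by norm_num)) (by norm_num)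
      _ = 9 / 10 := by rw [← Real.rpow_natCast, ← Real.rpow_mul (by norm_num)]; norm_num
  have h3 : φ M / Real.log M ≤ w ^ (13/16:ℝ) * (φ N / Real.log N) := by
    calc φ M / Real.log M ≤ (w ^ (15/16:ℝ) * φ N) / (9 / 10 * Real.log N) := by gcongr
      _ = w ^ (13/16:ℝ) * (w ^ (1/8:ℝ) / (9 / 10)) * (φ N / Real.log N) := by
        rw [show (15/16:ℝ) = 13/16 + 1/8 by norm_num, Real.rpow_add hw0]; field_simp
      _ ≤ w ^ (13/16:ℝ) * 1 * (φ N / Real.log N) := by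
        gcongr; rw [div_le_one (by norm_num)]; exact h2
      _ = _ := by ring
  have hlM0 : 0 < Real.log M := by linarith
  calc (φ M / Real.log M) ^ r / M ≤ (w ^ (13/16:ℝ) * (φ N / Real.log N)) ^ r / M := by gcongr
    _ = w ^ (13/16 * r - 1) * ((φ N / Real.log N) ^ r / N) := by
      rw [Real.mul_rpow (by positivity) (by positivity), ← Real.rpow_mul hw0.le, Real.rpow_sub hw0, Real.rpow_one]
      nth_rewrite 3 [hw]
      field_simp
    _ ≤ w ^ (1/2:ℝ) * ((φ N / Real.log N) ^ r / N) := by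
      gcongr ?_ * _
      exact Real.rpow_le_rpow_of_exponent_ge hw0 (by linarith) (by linarith)
    _ ≤ _ := by
      gcongr ?_ * _
      calc w ^ (1/2:ℝ) ≤ ((1/2:ℝ) ^ 2) ^ (1/2:ℝ) := Real.rpow_le_rpow hw0.le (hw4.trans (by norm_num)) (by norm_num)
        _ = 1 / 2 := by rw [← Real.rpow_natCast, ← Real.rpow_mul (by norm_num)]; norm_num

theorem full_upper (R : Reg S γ' φ φ1 H H1 Y0) (hγ : 15 / 16 < γ') (r : ℝ) (hr : 2 < r) (hγr : 1 - (r - 2) / 8 < γ') :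
    ∃ C > 0, ∃ N0 : ℕ, ∀ N : ℕ, N0 ≤ N → ∀ c : ℕ → ℂ, (∀ n, ‖c n‖ ≤ 1) →
    ∫ ξ in (0:ℝ)..1, ‖tp ((Finset.Icc 1 N).filter (fun p => p ∈ S)) c ξ‖ ^ r ≤ C * ((φ N / Real.log N) ^ r / N) := by
  obtain ⟨Cb, hCb, N1, hblock⟩ := R.block hγ r hr hγr
  obtain ⟨N2, hstep⟩ := R.T_step r hr
  have hev : ∀ᶠ x : ℝ in atTop, Y0 ≤ x ∧ 2 ≤ x := (eventually_ge_atTop _).and (eventually_ge_atTop _)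
  obtain ⟨N3, hN3⟩ := eventually_atTop.1 (tendsto_natCast_atTop_atTop.eventually hev)
  obtain ⟨n0, hn0⟩ : ∃ n0, n0 = max N1 (max N2 N3) := ⟨_, rfl⟩
  have hn1 : N1 ≤ n0 := by omega
  have hn2 : N2 ≤ n0 := by omega
  have hn3 : N3 ≤ n0 := by omega
  obtain ⟨T, hT⟩ : ∃ T : ℕ → ℝ, T = fun N : ℕ => (φ N / Real.log N) ^ r / N := ⟨_, rfl⟩
  have hTpos : ∀ N : ℕ, n0 ≤ N → 0 < T N := by
    intro N hN
    obtain ⟨h1, h2⟩ := hN3 N (hn3.trans hN)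
    have hl : 0 < Real.log N := Real.log_pos (by linarith)
    have hφ : 1 ≤ φ N := R.one_le N h1
    rw [hT]
    have : (0:ℝ) < N := by linarith
    simp only
    positivity
  obtain ⟨τ, hτ⟩ : ∃ τ : ℝ, τ = (3/2:ℝ) ^ (1 / r) - 1 := ⟨_, rfl⟩
  have hτ0 : 0 < τ := by
    have := Real.one_lt_rpow (show (1:ℝ) < 3/2 by norm_num) (show 0 < 1 / r by positivity)
    rw [hτ]; linarith
  have hτ1 : (1 + τ) ^ r = 3 / 2 := by
    rw [hτ, show 1 + ((3/2:ℝ) ^ (1 / r) - 1) = (3/2:ℝ) ^ (1 / r) by ring, ← Real.rpow_mul (by norm_num), one_div_mul_cancel (by linarith), Real.rpow_one]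
  obtain ⟨D, hD⟩ : ∃ D : ℝ, D = (1 + 1 / τ) ^ r * Cb := ⟨_, rfl⟩
  have hD0 : 0 < D := by rw [hD]; positivity
  obtain ⟨W, hW⟩ : ∃ W : ℝ, W = ∑ N ∈ Finset.Ico n0 (4 * n0 + 4), (N:ℝ) ^ r / T N := ⟨_, rfl⟩
  have hterm : ∀ N ∈ Finset.Ico n0 (4 * n0 + 4), 0 ≤ (N:ℝ) ^ r / T N := fun N hN => by
    have := hTpos N (Finset.mem_Ico.1 hN).1
    positivity
  have hW0 : 0 ≤ W := by rw [hW]; exact Finset.sum_nonneg hterm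
  refine ⟨4 * D + W, by positivity, n0, fun N hN c hc => ?_⟩
  have key : ∀ N : ℕ, n0 ≤ N → ∫ ξ in (0:ℝ)..1, ‖tp ((Finset.Icc 1 N).filter (fun p => p ∈ S)) c ξ‖ ^ r ≤ (4 * D + W) * T N := by
    intro N
    induction N using Nat.strong_induction_on with
    | _ N ih =>
    intro hN
    have hTN := hTpos N hN
    by_cases hb : N < 4 * n0 + 4
    · refine (upper_int _ c hc r (by linarith)).trans ?_
      have hcard : (((Finset.Icc 1 N).filter (fun p => p ∈ S)).card : ℝ) ≤ N := by
        have := Finset.card_filter_le (Finset.Icc 1 N) (fun p => p ∈ S)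
        rw [Nat.card_Icc, Nat.add_sub_cancel] at this
        exact_mod_cast this
      have h1 : (N:ℝ) ^ r / T N ≤ W := by
        rw [hW]
        exact Finset.single_le_sum (f := fun N : ℕ => (N:ℝ) ^ r / T N) hterm (Finset.mem_Ico.2 ⟨hN, hb⟩)
      rw [div_le_iff₀ hTN] at h1
      refine (Real.rpow_le_rpow (by positivity) hcard (by linarith)).trans (h1.trans ?_)
      gcongr
      linarith
    · have hM : n0 ≤ N / 4 := by omega
      have hI := ih (N / 4) (by omega) hM
      have hbl := hblock N (hn1.trans hN) c hc
      have hst := hstep N (hn2.trans hN)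
      have hst' : T (N / 4) ≤ 1 / 2 * T N := by rw [hT]; exact hst
      have hbl' : ∫ ξ in (0:ℝ)..1, ‖tp ((Finset.Ico (N / 4 + 1) (N + 1)).filter (fun p => p ∈ S)) c ξ‖ ^ r ≤ Cb * T N := by rw [hT]; exact hbl
      have hadd := int_add_le ((Finset.Icc 1 (N / 4)).filter (fun p => p ∈ S)) ((Finset.Ico (N / 4 + 1) (N + 1)).filter (fun p => p ∈ S)) ((Finset.Icc 1 N).filter (fun p => p ∈ S))
        (by
          refine Finset.disjoint_filter_filter ?_
          rw [Finset.disjoint_left]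
          intro x h1 h2
          rw [Finset.mem_Icc] at h1; rw [Finset.mem_Ico] at h2; omega)
        (by
          rw [← Finset.filter_union]
          congr 1
          ext x
          rw [Finset.mem_union, Finset.mem_Icc, Finset.mem_Icc, Finset.mem_Ico]; omega) c τ r hτ0 (by linarith)
      refine hadd.trans ?_
      rw [hτ1]
      have hc1 : (1 + 1 / τ) ^ r * ∫ ξ in (0:ℝ)..1, ‖tp ((Finset.Ico (N / 4 + 1) (N + 1)).filter (fun p => p ∈ S)) c ξ‖ ^ r ≤ D * T N := by
        rw [hD, mul_assoc]; exact mul_le_mul_of_nonneg_left hbl' (by positivity)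
      have hc2 : (4 * D + W) * T (N / 4) ≤ (4 * D + W) * (1 / 2 * T N) := mul_le_mul_of_nonneg_left hst' (by positivity)
      have : 0 ≤ W * T N := by positivity
      linarith
  have := key N hN
  rw [hT] at this
  exact this

theorem final (R : Reg S γ' φ φ1 H H1 Y0) (hγ : 15 / 16 < γ') (r : ℝ) (hr : 2 < r) (hγr : 1 - (r - 2) / 8 < γ') :
    ∃ C > 0, ∀ N : ℕ, ∀ c : ℕ → ℂ, (∀ n, ‖c n‖ ≤ 1) →
    ∫ ξ in (0:ℝ)..1, ‖tp ((Finset.Icc 1 N).filter (fun p => p ∈ S)) c ξ‖ ^ r ≤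
      C * ∫ ξ in (0:ℝ)..1, ‖tp ((Finset.Icc 1 N).filter (fun p => p ∈ S)) (fun _ => 1) ξ‖ ^ r := by
  obtain ⟨C, hC, N1, hup⟩ := R.full_upper hγ r hr hγr
  obtain ⟨d, hd, N2, hcount⟩ := R.count_lower hγ
  have hev : ∀ᶠ x : ℝ in atTop, Y0 ≤ x ∧ 2 ≤ x := (eventually_ge_atTop _).and (eventually_ge_atTop _)
  obtain ⟨N3, hN3⟩ := eventually_atTop.1 (tendsto_natCast_atTop_atTop.eventually hev)
  obtain ⟨n0, hn0⟩ : ∃ n0, n0 = max N1 (max N2 N3) := ⟨_, rfl⟩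
  have hn1 : N1 ≤ n0 := by omega
  have hn2 : N2 ≤ n0 := by omega
  have hn3 : N3 ≤ n0 := by omega
  refine ⟨C * (6 / (d / 2) ^ r) + 2 ^ r * (6 * n0), by positivity, fun N c hc => ?_⟩
  set P := (Finset.Icc 1 N).filter (fun p => p ∈ S) with hP
  have hPN : ∀ p ∈ P, p ≤ N := fun p hp => by
    rw [hP, Finset.mem_filter, Finset.mem_Icc] at hp; exact hp.1.2
  obtain ⟨I1, hI1⟩ : ∃ I1, I1 = ∫ ξ in (0:ℝ)..1, ‖tp P (fun _ => 1) ξ‖ ^ r := ⟨_, rfl⟩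
  have hI0 : 0 ≤ I1 := by
    rw [hI1]; exact intervalIntegral.integral_nonneg (by norm_num) fun ξ _ => by positivity
  rw [← hI1]
  rcases Nat.eq_zero_or_pos N with h0 | hpos
  · refine (upper_int P c hc r (by linarith)).trans ?_
    have : P.card = 0 := by rw [hP, h0]; simp
    rw [this, Nat.cast_zero, Real.zero_rpow (by linarith)]
    positivity
  have hlow := lower_int P N hpos hPN r (by linarith)
  rw [← hI1] at hlow
  have hNp : (0:ℝ) < N := by exact_mod_cast hpos
  by_cases hN : N < n0
  · refine (upper_int P c hc r (by linarith)).trans ?_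
    rw [div_le_iff₀ (by positivity), Real.div_rpow (by positivity) (by norm_num), div_le_iff₀ (by positivity)] at hlow
    have hN' : (N:ℝ) ≤ n0 := by exact_mod_cast hN.le
    calc (P.card : ℝ) ^ r ≤ I1 * (6 * N) * 2 ^ r := hlow
      _ ≤ I1 * (6 * n0) * 2 ^ r := by gcongr
      _ = 2 ^ r * (6 * n0) * I1 := by ring
      _ ≤ _ := by
        gcongr
        exact le_add_of_nonneg_left (by positivity)
  · push Not at hN
    obtain ⟨h1, h2⟩ := hN3 N (hn3.trans hN)
    have hl : 0 < Real.log N := Real.log_pos (by linarith)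
    have hφ : 1 ≤ φ N := R.one_le N h1
    have hu := hup N (hn1.trans hN) c hc
    have hcn := hcount N (hn2.trans hN)
    obtain ⟨X, hX⟩ : ∃ X, X = φ N / Real.log N := ⟨_, rfl⟩
    rw [← hX] at hu hcn
    have hX0 : 0 < X := by rw [hX]; positivity
    have hsub : (Finset.Ico (N / 4 + 1) (N + 1)).filter (fun p => p ∈ S) ⊆ P := by
      rw [hP]
      refine Finset.filter_subset_filter _ ?_
      intro x hx
      rw [Finset.mem_Ico] at hx; rw [Finset.mem_Icc]; omega
    have hcard : d * X ≤ P.card := hcn.trans (by exact_mod_cast Finset.card_le_card hsub)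
    have h3 : (d / 2) ^ r * X ^ r / (6 * N) ≤ I1 := by
      refine le_trans ?_ hlow
      rw [← Real.mul_rpow (by positivity) hX0.le]
      gcongr
      linarith
    refine hu.trans ?_
    calc C * (X ^ r / N) = C * (6 / (d / 2) ^ r) * ((d / 2) ^ r * X ^ r / (6 * N)) := by field_simp
      _ ≤ C * (6 / (d / 2) ^ r) * I1 := by gcongr
      _ ≤ _ := by
        gcongr
        exact le_add_of_nonneg_right (by positivity)

end Reg

/-- **Hardy–Littlewood majorant property for `P_h`** (Theorem 1.3 of the paper).
For `c ∈ [1, 16/15)`, `γ = 1/c`, `h ∈ F_c` and any sequence `(a_n)` with `|a_n| ≤ 1`,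
for every `r > (26 - 24γ)/(16γ - 15)` there is a constant `C` (independent of `N`) with
`‖∑_{p ∈ P_{h,N}} a_p e(pξ)‖_{L^r(𝕋)} ≤ C ‖∑_{p ∈ P_{h,N}} e(pξ)‖_{L^r(𝕋)}`. -/
theorem hardy_littlewood_majorant_Ph {c : ℝ} (hc₁ : 1 ≤ c) (hc₂ : c < 16 / 15)
    (γ : ℝ) (hγ : γ = 1 / c) (F : Fc c)
    (a : ℕ → ℂ) (ha : ∀ n : ℕ, ‖a n‖ ≤ 1)
    (r : ℝ) (hr : (26 - 24 * γ) / (16 * γ - 15) < r) :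
    ∃ C > 0, ∀ N : ℕ,
      (∫ ξ in (0:ℝ)..1,
          ‖∑ p ∈ Finset.Icc 1 N, (if p ∈ Ph F then a p * e (p * ξ) else 0)‖ ^ r) ^ (1 / r)
      ≤ C * (∫ ξ in (0:ℝ)..1,
          ‖∑ p ∈ Finset.Icc 1 N, (if p ∈ Ph F then e (p * ξ) else 0)‖ ^ r) ^ (1 / r) := by
  have hc0 : 0 < c := by linarith
  have hγ1 : γ ≤ 1 := by rw [hγ, div_le_one hc0]; exact hc₁
  have hγ2 : 15 / 16 < γ := by rw [hγ, lt_div_iff₀ hc0]; linarith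
  have hpos : 0 < 16 * γ - 15 := by linarith
  rw [div_lt_iff₀ hpos] at hr
  have hr2 : 2 < r := by
    by_contra hcon
    push Not at hcon
    nlinarith
  have hr8 : 1 - (r - 2) / 8 < γ := by
    nlinarith
  have hmax : max (15 / 16) (1 - (r - 2) / 8) < γ := max_lt hγ2 hr8
  have hm1 := le_max_left (15 / 16 : ℝ) (1 - (r - 2) / 8)
  have hm2 := le_max_right (15 / 16 : ℝ) (1 - (r - 2) / 8)
  obtain ⟨φ, φ1, H, H1, Y0, R⟩ := exists_reg hc₁ hc₂ F ((max (15 / 16) (1 - (r - 2) / 8) + γ) / 2)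
    (by linarith) (by rw [← hγ]; linarith)
  obtain ⟨C, hC, hfin⟩ := R.final (by linarith) r hr2 (by linarith)
  refine ⟨C ^ (1 / r), Real.rpow_pos_of_pos hC _, fun N => ?_⟩
  have h1 : ∀ ξ : ℝ, ∑ p ∈ Finset.Icc 1 N, (if p ∈ Ph F then a p * e (p * ξ) else 0) =
      tp ((Finset.Icc 1 N).filter (fun p => p ∈ Ph F)) a ξ := fun ξ => by
    rw [tp, Finset.sum_filter]
  have h2 : ∀ ξ : ℝ, ∑ p ∈ Finset.Icc 1 N, (if p ∈ Ph F then e (p * ξ) else 0) =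
      tp ((Finset.Icc 1 N).filter (fun p => p ∈ Ph F)) (fun _ => 1) ξ := fun ξ => by
    rw [tp, Finset.sum_filter]
    simp only [one_mul]
  simp only [h1, h2]
  have hn1 : 0 ≤ ∫ ξ in (0:ℝ)..1,
      ‖tp ((Finset.Icc 1 N).filter (fun p => p ∈ Ph F)) a ξ‖ ^ r :=
    intervalIntegral.integral_nonneg (by norm_num) fun ξ _ => by positivity
  have hn2 : 0 ≤ ∫ ξ in (0:ℝ)..1,
      ‖tp ((Finset.Icc 1 N).filter (fun p => p ∈ Ph F)) (fun _ => 1) ξ‖ ^ r :=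
    intervalIntegral.integral_nonneg (by norm_num) fun ξ _ => by positivity
  rw [← Real.mul_rpow hC.le hn2]
  exact Real.rpow_le_rpow hn1 (hfin N a ha) (by positivity)
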